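/- Let n ≥ 2, let (1/r, 1/s) lie in the interior of the triangle L_n, and let C₀ > 1. Fix a dyadic grid 𝒟 in ℝ^n and Q₀ ∈ 𝒟. Let F₁ ⊂ ℝ^n be measurable with f₁ = 1_{F₁}, and let f₂ ≥ 0 be bounded and measurable. Let 𝒬 ⊂ 𝒟 be a collection of subcubes of Q₀ such that for every Q' ∈ 𝒬 and every Q ∈ 𝒟 with Q' ⊂ Q ⊂ Q₀ one has ⟨f₁⟩_{Q,r}/⟨f₁⟩_{Q₀,r} + ⟨f₂⟩_{Q,s}/⟨f₂⟩_{Q₀,s} < C₀. Then there is a constant C = C(n,r,s,C₀) such that ∫ (sup_{Q ∈ 𝒬} A_Q f₁) · f₂ dx ≤ C |Q₀| ⟨f₁⟩_{Q₀,r} ⟨f₂⟩_{Q₀,s}. -/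

import Mathlib

open MeasureTheory Metric Set
open scoped ENNReal NNReal

noncomputable section

abbrev Rn (n : ℕ) := EuclideanSpace ℝ (Fin n)

/-- The normalized rotation-invariant measure on the unit sphere of `ℝⁿ`. -/
def sphMeasure (n : ℕ) : Measure (Rn n) :=
  ((μH[(n : ℝ) - 1]) (sphere (0 : Rn n) 1))⁻¹ • (μH[(n : ℝ) - 1]).restrict (sphere (0 : Rn n) 1)

/-- The spherical average `A_t f (x)`. -/
def sphereAvg (n : ℕ) (t : ℝ) (f : Rn n → ℝ) (x : Rn n) : ℝ :=
  ∫ y, f (x - t • y) ∂(sphMeasure n)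

/-- The lacunary spherical maximal function. -/
def Mlac (n : ℕ) (f : Rn n → ℝ) (x : Rn n) : ℝ :=
  ⨆ j : ℤ, sphereAvg n ((2 : ℝ) ^ j) (fun z => |f z|) x

/-- The full spherical maximal function. -/
def Mfull (n : ℕ) (f : Rn n → ℝ) (x : Rn n) : ℝ :=
  ⨆ t : {t : ℝ // 0 < t}, sphereAvg n (t : ℝ) (fun z => |f z|) x

/-- An axis-parallel cube in `ℝⁿ`. -/
structure Cube (n : ℕ) where
  corner : Fin n → ℝ
  side : ℝ
  side_pos : 0 < side

/-- The set of points of a cube. -/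
def Cube.toSet {n : ℕ} (Q : Cube n) : Set (Rn n) :=
  {x | ∀ i, Q.corner i ≤ x i ∧ x i ≤ Q.corner i + Q.side}

/-- `⟨f⟩_{Q,r}`, the normalized `L^r` average of `f` over the cube `Q`. -/
def cubeAvg {n : ℕ} (Q : Cube n) (r : ℝ) (f : Rn n → ℝ) : ℝ :=
  ((volume Q.toSet).toReal⁻¹ * ∫ x in Q.toSet, |f x| ^ r) ^ (1 / r)

/-- The plain average of `w` over a cube `Q`. -/
def avgCube {n : ℕ} (Q : Cube n) (w : Rn n → ℝ) : ℝ :=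
  (volume Q.toSet).toReal⁻¹ * ∫ x in Q.toSet, w x

/-- A sparse collection of cubes. -/
def IsSparse {n : ℕ} (𝒮 : Set (Cube n)) : Prop :=
  ∃ E : Cube n → Set (Rn n),
    (∀ S ∈ 𝒮, MeasurableSet (E S)) ∧ (∀ S ∈ 𝒮, E S ⊆ S.toSet) ∧
    (∀ S ∈ 𝒮, volume S.toSet < 4 * volume (E S)) ∧
    𝒮.PairwiseDisjoint E

/-- An admissible family `{F_S}` for the `m`-sparse form: pairwise disjoint, `F_S ⊆ S`. -/
def IsAdmissible {n : ℕ} (𝒮 : Set (Cube n)) (F : Cube n → Set (Rn n)) : Prop :=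
  (∀ S ∈ 𝒮, MeasurableSet (F S)) ∧ (∀ S ∈ 𝒮, F S ⊆ S.toSet) ∧ 𝒮.PairwiseDisjoint F

/-- The `(r,s)_m`-sparse form `Λ_{𝒮,r,s,m}(f,g)`. -/
def sparseFormM {n : ℕ} (𝒮 : Set (Cube n)) (F : Cube n → Set (Rn n)) (r s : ℝ)
    (f g : Rn n → ℝ) : ℝ≥0∞ :=
  ∑' S : 𝒮, volume (S : Cube n).toSet * ENNReal.ofReal (cubeAvg (S : Cube n) r f) *
    ENNReal.ofReal (cubeAvg (S : Cube n) s ((F (S : Cube n)).indicator g))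

/-- The supremum of `(r,s)_m` sparse forms over all sparse collections and admissible families. -/
def supSparseFormM (n : ℕ) (r s : ℝ) (f g : Rn n → ℝ) : ℝ≥0∞ :=
  ⨆ (𝒮 : Set (Cube n)) (F : Cube n → Set (Rn n)) (_ : IsSparse 𝒮) (_ : IsAdmissible 𝒮 F),
    sparseFormM 𝒮 F r s f g

/-- The sparse bound `‖T : (r,s)_m‖ < ∞`. -/
def SparseBoundM (n : ℕ) (r s : ℝ) (T : (Rn n → ℝ) → Rn n → ℝ) : Prop :=
  ∃ C : ℝ, 0 ≤ C ∧ ∀ f g : Rn n → ℝ, Measurable f → Measurable g →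
    (∀ x, 0 ≤ f x) → (∀ x, 0 ≤ g x) →
    (∃ M, ∀ x, f x ≤ M) → (∃ M, ∀ x, g x ≤ M) →
    HasCompactSupport f → HasCompactSupport g →
    ENNReal.ofReal (∫ x, T f x * g x) ≤ ENNReal.ofReal C * supSparseFormM n r s f g

/-- The closed triangle `L_n` with vertices `(0,1)`, `(1,0)`, `(n/(n+1), n/(n+1))`. -/
def Lregion (n : ℕ) : Set (ℝ × ℝ) :=
  convexHull ℝ {((0 : ℝ), (1 : ℝ)), (1, 0), ((n : ℝ)/(n+1), (n : ℝ)/(n+1))}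

/-- The closed triangle `L'_n` with vertices `(0,0)`, `(1,1)`, `(n/(n+1), 1/(n+1))`. -/
def Lregion' (n : ℕ) : Set (ℝ × ℝ) :=
  convexHull ℝ {((0 : ℝ), (0 : ℝ)), (1, 1), ((n : ℝ)/(n+1), 1/((n : ℝ)+1))}

/-- The closed trapezium `F_n`. -/
def Fregion (n : ℕ) : Set (ℝ × ℝ) :=
  convexHull ℝ {((0 : ℝ), (1 : ℝ)), (((n : ℝ)-1)/n, 1/(n : ℝ)),
    (((n : ℝ)-1)/n, ((n : ℝ)-1)/n),
    (((n : ℝ)^2 - n)/((n : ℝ)^2 + 1), ((n : ℝ)^2 - n + 2)/((n : ℝ)^2 + 1))}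

/-- The closed trapezium `F'_n`. -/
def Fregion' (n : ℕ) : Set (ℝ × ℝ) :=
  convexHull ℝ {((0 : ℝ), (0 : ℝ)), (((n : ℝ)-1)/n, ((n : ℝ)-1)/n),
    (((n : ℝ)-1)/n, 1/(n : ℝ)),
    (((n : ℝ)^2 - n)/((n : ℝ)^2 + 1), ((n : ℝ)-1)/((n : ℝ)^2 + 1))}

/-- A dyadic cube `2^q([0,1)^n + m)`. -/
def IsDyadic {n : ℕ} (Q : Cube n) : Prop :=
  ∃ (q : ℤ) (m : Fin n → ℤ), Q.side = (2 : ℝ) ^ q ∧ ∀ i, Q.corner i = (2 : ℝ) ^ q * m i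

/-- The concentric cube `(1/3)Q` of one third the side length. -/
def Cube.third {n : ℕ} (Q : Cube n) : Cube n :=
  ⟨fun i => Q.corner i + Q.side / 3, Q.side / 3, by have := Q.side_pos; linarith⟩

/-- `A_Q f = A_{ℓQ/4}(f · 1_{(1/3)Q})`. -/
def AQ {n : ℕ} (Q : Cube n) (f : Rn n → ℝ) (x : Rn n) : ℝ :=
  sphereAvg n (Q.side / 4) (Q.third.toSet.indicator f) x

/-- `M̃_Q f = sup_{ℓQ/8 ≤ t < ℓQ/4} A_t (f · 1_{(1/3)Q})`. -/
def MtildeQ {n : ℕ} (Q : Cube n) (f : Rn n → ℝ) (x : Rn n) : ℝ :=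
  ⨆ t : {t : ℝ // Q.side / 8 ≤ t ∧ t < Q.side / 4},
    sphereAvg n (t : ℝ) (Q.third.toSet.indicator f) x

/-- A weight: a positive locally integrable function. -/
def IsWeight {n : ℕ} (w : Rn n → ℝ) : Prop :=
  (∀ x, 0 < w x) ∧ LocallyIntegrable w volume

/-- The Muckenhoupt class `A₁`. -/
def MemA1 {n : ℕ} (w : Rn n → ℝ) : Prop :=
  IsWeight w ∧ ∃ C : ℝ, ∀ Q : Cube n, ∀ᵐ x ∂volume, x ∈ Q.toSet → avgCube Q w ≤ C * w x

/-- The Muckenhoupt class `A_p`, `1 < p < ∞`. -/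
def MemAp {n : ℕ} (p : ℝ) (w : Rn n → ℝ) : Prop :=
  IsWeight w ∧ ∃ C : ℝ, ∀ Q : Cube n,
    avgCube Q w * (avgCube Q fun x => w x ^ (1 - p/(p-1))) ^ (p - 1) ≤ C

/-- The reverse Hölder class `RH_ρ`. -/
def MemRH {n : ℕ} (ρ : ℝ) (w : Rn n → ℝ) : Prop :=
  IsWeight w ∧ ∃ C : ℝ, ∀ Q : Cube n, cubeAvg Q ρ w ≤ C * avgCube Q w

/-- The measure `w dx` associated to a weight. -/
def wMeasure {n : ℕ} (w : Rn n → ℝ) : Measure (Rn n) :=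
  volume.withDensity fun x => ENNReal.ofReal (w x)

/-- The dual exponent `x' = x/(x-1)`. -/
def dualExp (x : ℝ) : ℝ := x / (x - 1)

/-- `φ_lac(r)`, defined through `1/φ_lac(1/r)` as in Corollary 5.4(1). -/
def phiLac (n : ℕ) (r : ℝ) : ℝ :=
  if 1/r ≤ (n : ℝ)/(n+1) then (1 - 1/(r*n))⁻¹ else ((n : ℝ)*(1 - 1/r))⁻¹

/-- `φ_full(r)`, the piecewise linear function of Statement 16. -/
def phiFull (n : ℕ) (r : ℝ) : ℝ :=
  if 1/r ≤ ((n : ℝ)^2 - n)/((n : ℝ)^2 + 1) then (1 - 1/(r*n))⁻¹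
  else (((n : ℝ)-1)/n + (((n : ℝ)+1)/((n : ℝ)-1)) * ((((n : ℝ)-1))/n - 1/r))⁻¹

end

open MeasureTheory Metric Set
open scoped ENNReal NNReal

section

open FourierTransform SchwartzMap in
theorem lm_plancherel {n : ℕ} (f : Rn n → ℂ) (h1 : Integrable f) (h2 : MemLp f 2 volume) :
    eLpNorm (𝓕 f) 2 volume = eLpNorm f 2 volume := by
  have key : (𝓕 (h2.toLp f) : Lp ℂ 2 (volume : Measure (Rn n))) =ᵐ[volume] 𝓕 f := by
    have hcont : Continuous (𝓕 f) := by
      exact VectorFourier.fourierIntegral_continuous Real.continuous_fourierChar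
        (by exact continuous_inner) h1
    apply ae_eq_of_integral_contDiff_smul_eq
    · exact (Lp.memLp _).locallyIntegrable (by norm_num)
    · exact hcont.locallyIntegrable
    · intro g hg hgs
      have hgs' : HasCompactSupport (fun x => (g x : ℂ)) := hgs.comp_left (g := fun x : ℝ => (x:ℂ)) (by simp)
      set φ : 𝓢(Rn n, ℂ) := hgs'.toSchwartzMap (Complex.ofRealCLM.contDiff.comp hg) with hφ
      have e1 := congrArg (fun T => T φ) (Lp.fourier_toTemperedDistribution_eq (h2.toLp f))
      simp only [TemperedDistribution.fourier_apply, Lp.toTemperedDistribution_apply] at e1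
      have e2 : ∫ x, g x • (𝓕 (h2.toLp f) : Lp ℂ 2 (volume : Measure (Rn n))) x
          = ∫ x, φ x • (𝓕 (h2.toLp f) : Lp ℂ 2 (volume : Measure (Rn n))) x := by
        apply integral_congr_ae
        filter_upwards with x
        simp only [hφ, Complex.real_smul, smul_eq_mul]
        rfl
      have e3 : ∫ x, g x • (𝓕 f) x = ∫ x, φ x • (𝓕 f) x := by
        apply integral_congr_ae
        filter_upwards with x
        simp only [hφ, Complex.real_smul, smul_eq_mul]
        rfl
      rw [e2, e3, ← e1]
      have e4 : ∫ x, (𝓕 φ) x • (h2.toLp f) x = ∫ x, (𝓕 φ) x • f x := by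
        apply integral_congr_ae
        filter_upwards [h2.coeFn_toLp] with x hx
        rw [hx]
      rw [e4]
      have := VectorFourier.integral_fourierIntegral_smul_eq_flip (μ := (volume : Measure (Rn n))) (ν := (volume : Measure (Rn n))) (L := innerₗ (Rn n)) Real.continuous_fourierChar
        (by exact continuous_inner) (φ.integrable (μ := volume)) h1
      rw [flip_innerₗ] at this
      exact this
  rw [← eLpNorm_congr_ae key, ← eLpNorm_congr_ae h2.coeFn_toLp]
  have := Lp.norm_fourier_eq (h2.toLp f)
  rw [Lp.norm_def, Lp.norm_def] at this
  exact (ENNReal.toReal_eq_toReal_iff' (Lp.eLpNorm_ne_top _) (Lp.eLpNorm_ne_top _)).1 this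

structure LNice {n : ℕ} (f : Rn n → ℝ) : Prop where
  meas : Measurable f
  bdd : ∃ M, ∀ x, |f x| ≤ M
  int : Integrable f

theorem LNice.sq_int {n : ℕ} {f : Rn n → ℝ} (h : LNice f) : Integrable (fun x => f x ^ 2) := by
  obtain ⟨M, hM⟩ := h.bdd
  have := h.int.bdd_mul (c := M) h.meas.aestronglyMeasurable (Filter.Eventually.of_forall hM)
  simpa [sq] using this

theorem LNice.mul_int {n : ℕ} {f g : Rn n → ℝ} (h : LNice f) (hg : LNice g) :
    Integrable (fun x => f x * g x) := by
  obtain ⟨M, hM⟩ := h.bdd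
  exact hg.int.bdd_mul (c := M) h.meas.aestronglyMeasurable (Filter.Eventually.of_forall hM)

theorem LNice.memLp {n : ℕ} {f : Rn n → ℝ} (h : LNice f) : MemLp f 2 volume :=
  (memLp_two_iff_integrable_sq h.meas.aestronglyMeasurable).2 h.sq_int

theorem LNice.sub {n : ℕ} {f g : Rn n → ℝ} (h : LNice f) (hg : LNice g) :
    LNice (fun x => f x - g x) := by
  obtain ⟨M, hM⟩ := h.bdd
  obtain ⟨N, hN⟩ := hg.bdd
  exact ⟨h.meas.sub hg.meas, ⟨M + N, fun x => (abs_sub _ _).trans (add_le_add (hM x) (hN x))⟩,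
    h.int.sub hg.int⟩

theorem LNice.indicator {n : ℕ} {f : Rn n → ℝ} (h : LNice f) {S : Set (Rn n)}
    (hS : MeasurableSet S) : LNice (S.indicator f) := by
  obtain ⟨M, hM⟩ := h.bdd
  refine ⟨h.meas.indicator hS, ⟨M, fun x => ?_⟩, h.int.indicator hS⟩
  by_cases hx : x ∈ S
  · simpa [hx] using hM x
  · simpa [hx] using (abs_nonneg _).trans (hM x)

theorem lm_cs {n : ℕ} {f g : Rn n → ℝ} (hf : LNice f) (hg : LNice g) :
    |∫ x, f x * g x| ≤ √(∫ x, f x ^ 2) * √(∫ x, g x ^ 2) := by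
  have h := integral_mul_norm_le_Lp_mul_Lq (μ := (volume : Measure (Rn n))) (f := f) (g := g)
    (p := 2) (q := 2) Real.HolderConjugate.two_two (by simpa using hf.memLp) (by simpa using hg.memLp)
  calc |∫ x, f x * g x| ≤ ∫ x, ‖f x‖ * ‖g x‖ := by
        rw [← Real.norm_eq_abs]
        refine (norm_integral_le_integral_norm _).trans (le_of_eq ?_)
        simp
    _ ≤ _ := by
        refine h.trans (le_of_eq ?_)
        simp [Real.sqrt_eq_rpow]

open FourierTransform in
theorem lm_l2_compare {n : ℕ} {u f : Rn n → ℝ} (hu : LNice u) (hf : LNice f) (K : ℝ) (hK : 0 ≤ K)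
    (h : ∀ ξ, ‖𝓕 (fun x => (u x : ℂ)) ξ‖ ≤ K * ‖𝓕 (fun x => (f x : ℂ)) ξ‖) :
    √(∫ x, u x ^ 2) ≤ K * √(∫ x, f x ^ 2) := by
  have aux : ∀ g : Rn n → ℝ, LNice g →
      eLpNorm (𝓕 (fun x => (g x : ℂ))) 2 volume = ENNReal.ofReal √(∫ x, g x ^ 2) := by
    intro g hg
    rw [lm_plancherel (fun x => (g x : ℂ)) hg.int.ofReal hg.memLp.ofReal]
    have : eLpNorm (fun x => (g x : ℂ)) 2 volume = eLpNorm g 2 volume := by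
      apply eLpNorm_congr_norm_ae
      filter_upwards with x
      simp
    rw [this, hg.memLp.eLpNorm_eq_integral_rpow_norm (by norm_num) (by norm_num)]
    congr 1
    simp [Real.sqrt_eq_rpow]
  have h1 := eLpNorm_le_mul_eLpNorm_of_ae_le_mul (μ := (volume : Measure (Rn n)))
    (Filter.Eventually.of_forall h) 2
  rw [aux u hu, aux f hf, ← ENNReal.ofReal_mul hK] at h1
  exact (ENNReal.ofReal_le_ofReal_iff (by positivity)).1 h1

noncomputable def lconv {n : ℕ} (μ : Measure (Rn n)) (f : Rn n → ℝ) (x : Rn n) : ℝ :=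
  ∫ y, f (x - y) ∂μ

noncomputable def lmhat {n : ℕ} (μ : Measure (Rn n)) (ξ : Rn n) : ℂ :=
  ∫ y, (Real.fourierChar (-inner ℝ y ξ) : ℂ) ∂μ

theorem lconv_meas {n : ℕ} (μ : Measure (Rn n)) [IsProbabilityMeasure μ] {f : Rn n → ℝ}
    (hf : Measurable f) : Measurable (lconv μ f) := by
  have : StronglyMeasurable (fun p : Rn n × Rn n => f (p.1 - p.2)) :=
    (hf.comp (measurable_fst.sub measurable_snd)).stronglyMeasurable
  exact this.integral_prod_right.measurable

theorem lconv_bdd {n : ℕ} (μ : Measure (Rn n)) [IsProbabilityMeasure μ] {f : Rn n → ℝ} {M : ℝ}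
    (hM : ∀ x, |f x| ≤ M) (x : Rn n) : |lconv μ f x| ≤ M := by
  have := norm_integral_le_of_norm_le_const (μ := μ) (f := fun y => f (x - y)) (C := M)
    (Filter.Eventually.of_forall fun y => hM _)
  simpa [lconv] using this

theorem lconv_int_prod {n : ℕ} (μ : Measure (Rn n)) [IsProbabilityMeasure μ] {f : Rn n → ℝ}
    (hf : LNice f) : Integrable (fun p : Rn n × Rn n => f (p.1 - p.2)) (volume.prod μ) := by
  have hm : AEStronglyMeasurable (fun p : Rn n × Rn n => f (p.1 - p.2)) (volume.prod μ) :=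
    (hf.meas.comp (measurable_fst.sub measurable_snd)).aestronglyMeasurable
  rw [integrable_prod_iff' hm]
  refine ⟨Filter.Eventually.of_forall fun y => hf.int.comp_sub_right y, ?_⟩
  have : ∀ y : Rn n, ∫ x, ‖f (x - y)‖ = ∫ x, ‖f x‖ := fun y =>
    integral_sub_right_eq_self (fun x => ‖f x‖) y
  simp only [this]
  exact integrable_const _

theorem lconv_nice {n : ℕ} (μ : Measure (Rn n)) [IsProbabilityMeasure μ] {f : Rn n → ℝ}
    (hf : LNice f) : LNice (lconv μ f) := by
  obtain ⟨M, hM⟩ := hf.bdd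
  exact ⟨lconv_meas μ hf.meas, ⟨M, lconv_bdd μ hM⟩, (lconv_int_prod μ hf).integral_prod_left⟩

theorem lslice_int {n : ℕ} (μ : Measure (Rn n)) [IsProbabilityMeasure μ] {f : Rn n → ℝ}
    (hf : LNice f) (x : Rn n) : Integrable (fun y => f (x - y)) μ := by
  obtain ⟨M, hM⟩ := hf.bdd
  exact Integrable.of_bound (hf.meas.comp (measurable_const.sub measurable_id)).aestronglyMeasurable M
    (Filter.Eventually.of_forall fun y => hM _)

theorem lconv_sub {n : ℕ} (μ : Measure (Rn n)) [IsProbabilityMeasure μ] {f g : Rn n → ℝ}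
    (hf : LNice f) (hg : LNice g) (x : Rn n) :
    lconv μ (fun z => f z - g z) x = lconv μ f x - lconv μ g x :=
  integral_sub (lslice_int μ hf x) (lslice_int μ hg x)

theorem lconv_l1 {n : ℕ} (μ : Measure (Rn n)) [IsProbabilityMeasure μ] {f : Rn n → ℝ}
    (hf : LNice f) : ∫ x, |lconv μ f x| ≤ ∫ x, |f x| := by
  have h1 := (lconv_int_prod μ hf).norm
  calc ∫ x, |lconv μ f x| ≤ ∫ x, ∫ y, ‖f (x - y)‖ ∂μ := by
        apply integral_mono (lconv_nice μ hf).int.norm h1.integral_prod_left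
        intro x
        exact norm_integral_le_integral_norm _
    _ = ∫ y, ∫ x, ‖f (x - y)‖ ∂volume ∂μ := integral_integral_swap h1
    _ = ∫ y, ∫ x, ‖f x‖ ∂volume ∂μ := by
        congr 1
        ext y
        exact integral_sub_right_eq_self (fun x => ‖f x‖) y
    _ = _ := by simp

theorem lconv_adj {n : ℕ} (μ : Measure (Rn n)) [IsProbabilityMeasure μ]
    (hμ : μ.map (fun y => -y) = μ) {f g : Rn n → ℝ}
    (hf : LNice f) (hg : LNice g) : ∫ x, lconv μ f x * g x = ∫ x, f x * lconv μ g x := by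
  have h1 : Integrable (fun p : Rn n × Rn n => f (p.1 - p.2) * g p.1) (volume.prod μ) := by
    obtain ⟨M, hM⟩ := hg.bdd
    exact (lconv_int_prod μ hf).mul_bdd (c := M) (hg.meas.comp measurable_fst).aestronglyMeasurable
      (Filter.Eventually.of_forall fun p => hM _)
  have h2 : Integrable (fun p : Rn n × Rn n => f p.1 * g (p.1 - p.2)) (volume.prod μ) := by
    obtain ⟨M, hM⟩ := hf.bdd
    exact (lconv_int_prod μ hg).bdd_mul (c := M) (hf.meas.comp measurable_fst).aestronglyMeasurable
      (Filter.Eventually.of_forall fun p => hM _)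
  calc ∫ x, lconv μ f x * g x = ∫ x, ∫ y, f (x - y) * g x ∂μ := by
        simp only [lconv, integral_mul_const]
    _ = ∫ y, ∫ x, f (x - y) * g x ∂volume ∂μ := integral_integral_swap h1
    _ = ∫ y, ∫ x, f x * g (x + y) ∂volume ∂μ := by
        congr 1
        ext y
        rw [← integral_sub_right_eq_self (fun x => f x * g (x + y)) y]
        simp
    _ = ∫ y, ∫ x, f x * g (x - y) ∂volume ∂μ := by
        have := integral_map_equiv (μ := μ) (MeasurableEquiv.neg (Rn n)) (fun y => ∫ x, f x * g (x - y))
        have hμ' : μ.map (MeasurableEquiv.neg (Rn n)) = μ := hμ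
        rw [hμ'] at this
        rw [this]
        simp [MeasurableEquiv.neg]
    _ = ∫ x, ∫ y, f x * g (x - y) ∂μ := (integral_integral_swap h2).symm
    _ = _ := by simp only [lconv, integral_const_mul]

open FourierTransform in
theorem lconv_fourier {n : ℕ} (μ : Measure (Rn n)) [IsProbabilityMeasure μ] {f : Rn n → ℝ}
    (hf : LNice f) (ξ : Rn n) :
    𝓕 (fun x => (lconv μ f x : ℂ)) ξ = lmhat μ ξ * 𝓕 (fun x => (f x : ℂ)) ξ := by
  have h1 : Integrable (fun p : Rn n × Rn n =>
      (Real.fourierChar (-inner ℝ p.1 ξ) : ℂ) * (f (p.1 - p.2) : ℂ)) (volume.prod μ) := by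
    refine (lconv_int_prod μ hf).ofReal.bdd_mul (c := 1) ?_ ?_
    · apply Continuous.aestronglyMeasurable
      fun_prop
    · exact Filter.Eventually.of_forall fun p => (Circle.norm_coe _).le
  have e : ∀ g : Rn n → ℝ, 𝓕 (fun x => (g x : ℂ)) ξ =
      ∫ x, (Real.fourierChar (-inner ℝ x ξ) : ℂ) * (g x : ℂ) := by
    intro g
    rw [Real.fourier_eq]
    rfl
  rw [e, e]
  calc ∫ x, (Real.fourierChar (-inner ℝ x ξ) : ℂ) * (lconv μ f x : ℂ)
      = ∫ x, ∫ y, (Real.fourierChar (-inner ℝ x ξ) : ℂ) * (f (x - y) : ℂ) ∂μ := by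
        congr 1
        ext x
        rw [integral_const_mul, lconv, integral_complex_ofReal]
    _ = ∫ y, ∫ x, (Real.fourierChar (-inner ℝ x ξ) : ℂ) * (f (x - y) : ℂ) ∂volume ∂μ :=
        integral_integral_swap h1
    _ = ∫ y, (Real.fourierChar (-inner ℝ y ξ) : ℂ) *
          ∫ x, (Real.fourierChar (-inner ℝ x ξ) : ℂ) * (f x : ℂ) ∂volume ∂μ := by
        congr 1
        ext y
        rw [← integral_const_mul, ← integral_sub_right_eq_self (fun x =>
          (Real.fourierChar (-inner ℝ y ξ) : ℂ) * ((Real.fourierChar (-inner ℝ x ξ) : ℂ) * (f x : ℂ))) y]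
        congr 1
        ext x
        rw [← mul_assoc]
        congr 1
        rw [← Circle.coe_mul, ← AddChar.map_add_eq_mul, inner_sub_left]
        congr 3
        ring
    _ = _ := by rw [integral_mul_const, lmhat]

structure LRot {n : ℕ} (σ : Measure (Rn n)) : Prop where
  prob : IsProbabilityMeasure σ
  supp : ∀ᵐ y ∂σ, ‖y‖ = 1
  inv : ∀ e : Rn n ≃ₗᵢ[ℝ] Rn n, σ.map e = σ

theorem lm_sph (n : ℕ) : sphMeasure n = 0 ∨ LRot (sphMeasure n) := by
  set c := (μH[(n : ℝ) - 1]) (sphere (0 : Rn n) 1) with hc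
  have hdef : sphMeasure n = c⁻¹ • (μH[(n : ℝ) - 1]).restrict (sphere (0 : Rn n) 1) := rfl
  by_cases h0 : c = 0
  · left
    rw [hdef, Measure.restrict_eq_zero.2 h0]
    simp
  by_cases ht : c = ∞
  · left
    rw [hdef, ht]
    simp
  right
  refine ⟨⟨?_⟩, ?_, ?_⟩
  · rw [hdef]
    simp only [Measure.smul_apply, Measure.restrict_apply_univ, smul_eq_mul]
    exact ENNReal.inv_mul_cancel h0 ht
  · rw [hdef]
    apply Measure.ae_smul_measure
    filter_upwards [ae_restrict_mem isClosed_sphere.measurableSet] with y hy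
    simpa using hy
  · intro e
    rw [hdef, Measure.map_smul]
    congr 1
    have h1 := (e.toIsometryEquiv.measurePreserving_hausdorffMeasure ((n : ℝ) - 1))
    have h2 := h1.restrict_preimage (s := sphere (0 : Rn n) 1) isClosed_sphere.measurableSet
    have h3 : (e.toIsometryEquiv) ⁻¹' (sphere (0 : Rn n) 1) = sphere (0 : Rn n) 1 := by
      ext y
      simp
    rw [h3] at h2
    exact h2.map_eq

theorem lm_ode (m : ℕ) (hm : 1 ≤ m) (φ ψ : ℝ → ℝ) (hφ1 : ∀ R, |φ R| ≤ 1) (hψ1 : ∀ R, |ψ R| ≤ 1)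
    (hφ : ∀ R, HasDerivAt φ (ψ R) R)
    (hψ : ∀ R, 0 < R → HasDerivAt ψ (- φ R - m / R * ψ R) R) (R : ℝ) (hR : 0 < R) :
    φ R ^ 2 ≤ 6 * Real.exp 1 * m ^ m / R ^ m := by
  have hm0 : (0 : ℝ) < m := by exact_mod_cast hm
  have he : 1 ≤ Real.exp 1 := Real.one_le_exp (by norm_num)
  have hsq : ∀ R, φ R ^ 2 ≤ 1 := fun R => by
    rw [sq_le_one_iff_abs_le_one]; exact hφ1 R
  have hsq' : ∀ R, ψ R ^ 2 ≤ 1 := fun R => by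
    rw [sq_le_one_iff_abs_le_one]; exact hψ1 R
  rcases lt_or_ge R m with h | h
  · refine (hsq R).trans ?_
    rw [le_div_iff₀ (by positivity), one_mul]
    calc R ^ m ≤ (m : ℝ) ^ m := by gcongr
      _ = 1 * (m : ℝ) ^ m := by ring
      _ ≤ _ := by gcongr; linarith
  obtain ⟨k, rfl⟩ : ∃ k, m = k + 1 := ⟨m - 1, by omega⟩
  set M : ℝ := ((k + 1 : ℕ) : ℝ) with hM
  set E : ℝ → ℝ := fun R => R ^ (k + 1) * (φ R ^ 2 + ψ R ^ 2) + M * R ^ k * (φ R * ψ R) with hE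
  have hEd : ∀ R, 0 < R → HasDerivAt E (- M * R ^ k / R * (φ R * ψ R)) R := by
    intro R hR
    have h1 := ((hasDerivAt_pow (k + 1) R).mul (((hφ R).pow 2).add ((hψ R hR).pow 2))).add
      (((hasDerivAt_pow k R).const_mul M).mul ((hφ R).mul (hψ R hR)))
    refine h1.congr_deriv ?_
    simp only [Pi.add_apply, Pi.pow_apply, Pi.mul_apply]
    rcases Nat.eq_zero_or_pos k with rfl | hk
    · simp [hM]
      field_simp
      ring
    · obtain ⟨j, rfl⟩ : ∃ j, k = j + 1 := ⟨k - 1, by omega⟩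
      simp only [Nat.add_sub_cancel, hM]
      push_cast
      field_simp
      ring
  have hElow : ∀ R, M ≤ R → R ^ (k + 1) * (φ R ^ 2 + ψ R ^ 2) / 2 ≤ E R := by
    intro R hR
    have hR0 : 0 < R := hm0.trans_le hR
    have h2 : 0 ≤ R ^ k * ((φ R + ψ R) ^ 2) := by positivity
    have h3 : 0 ≤ R ^ k * (R - M) * (φ R ^ 2 + ψ R ^ 2) := by
      have := sub_nonneg.2 hR
      positivity
    simp only [hE]
    have h4 : 0 ≤ M * (R ^ k * ((φ R + ψ R) ^ 2)) := by positivity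
    have : R ^ (k + 1) = R ^ k * R := pow_succ _ _
    rw [this]
    nlinarith
  set G : ℝ → ℝ := fun R => E R * Real.exp (M / R) with hG
  have hGd : ∀ R, 0 < R → HasDerivAt G ((- M * R ^ k / R * (φ R * ψ R)) * Real.exp (M / R)
      + E R * (Real.exp (M / R) * (- M / R ^ 2))) R := by
    intro R hR
    have h1 : HasDerivAt (fun R => M / R) (- M / R ^ 2) R := by
      have := (hasDerivAt_inv hR.ne').const_mul M
      refine (this.congr_deriv ?_)
      field_simp
    exact (hEd R hR).mul h1.exp
  have hanti : AntitoneOn G (Ici M) := by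
    apply antitoneOn_of_deriv_nonpos (convex_Ici M)
    · intro R hR
      exact (hGd R (hm0.trans_le hR)).continuousAt.continuousWithinAt
    · intro R hR
      rw [interior_Ici] at hR
      exact (hGd R (hm0.trans hR)).differentiableAt.differentiableWithinAt
    · intro R hR
      rw [interior_Ici] at hR
      have hR0 : 0 < R := hm0.trans hR
      rw [(hGd R hR0).deriv]
      have h5 := hElow R hR.le
      have h6 : (- M * R ^ k / R * (φ R * ψ R)) ≤ E R * (M / R ^ 2) := by
        have h7 : - M * R ^ k / R * (φ R * ψ R) ≤ R ^ (k + 1) * (φ R ^ 2 + ψ R ^ 2) / 2 * (M / R ^ 2) := by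
          have : R ^ (k + 1) * (φ R ^ 2 + ψ R ^ 2) / 2 * (M / R ^ 2) - (- M * R ^ k / R * (φ R * ψ R))
            = M * R ^ k / R / 2 * (φ R + ψ R) ^ 2 := by
            field_simp
            ring
          have h8 : 0 ≤ M * R ^ k / R / 2 * (φ R + ψ R) ^ 2 := by positivity
          linarith
        refine h7.trans ?_
        gcongr
      have h9 := Real.exp_pos (M / R)
      have : (- M * R ^ k / R * (φ R * ψ R)) * Real.exp (M / R)
        + E R * (Real.exp (M / R) * (- M / R ^ 2)) =
        Real.exp (M / R) * ((- M * R ^ k / R * (φ R * ψ R)) - E R * (M / R ^ 2)) := by ring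
      rw [this]
      exact mul_nonpos_of_nonneg_of_nonpos h9.le (by linarith)
  have h10 : G R ≤ G M := hanti (by simp) h h
  have hER : E R ≤ G R := by
    have hE0 : 0 ≤ E R := le_trans (by positivity) (hElow R h)
    calc E R = E R * 1 := by ring
      _ ≤ E R * Real.exp (M / R) := by
        gcongr
        exact Real.one_le_exp (by positivity)
  have hGM : G M ≤ 3 * M ^ (k + 1) * Real.exp 1 := by
    simp only [hG]
    rw [div_self hm0.ne']
    gcongr
    simp only [hE]
    have h11 : φ M * ψ M ≤ 1 := by nlinarith [hsq M, hsq' M, sq_nonneg (φ M - ψ M)]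
    have h12 : M * M ^ k * (φ M * ψ M) ≤ M * M ^ k * 1 := by gcongr
    have h13 : M ^ (k + 1) * (φ M ^ 2 + ψ M ^ 2) ≤ M ^ (k + 1) * 2 := by
      gcongr
      linarith [hsq M, hsq' M]
    have h14 : M * M ^ k = M ^ (k + 1) := by ring
    rw [h14] at h12 ⊢
    linarith
  have h15 := hElow R h
  rw [le_div_iff₀ (by positivity)]
  have h16 : R ^ (k + 1) * φ R ^ 2 ≤ R ^ (k + 1) * (φ R ^ 2 + ψ R ^ 2) := by
    gcongr
    linarith [sq_nonneg (ψ R)]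
  linarith

theorem lrot_p_bound {n : ℕ} {σ : Measure (Rn n)} (h : LRot σ) {u : Rn n} (hu : ‖u‖ = 1) :
    ∀ᵐ y ∂σ, |inner ℝ u y| ≤ 1 := by
  filter_upwards [h.supp] with y hy
  have := abs_real_inner_le_norm u y
  rwa [hu, hy, one_mul] at this

theorem lrot_neg {n : ℕ} {σ : Measure (Rn n)} (h : LRot σ) : σ.map (fun y => -y) = σ := by
  have := h.inv (LinearIsometryEquiv.neg ℝ)
  simpa using this

theorem lrot_int_comp {n : ℕ} {σ : Measure (Rn n)} (h : LRot σ) (e : Rn n ≃ₗᵢ[ℝ] Rn n)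
    (g : Rn n → ℝ) : ∫ y, g (e y) ∂σ = ∫ y, g y ∂σ := by
  conv_rhs => rw [← h.inv e]
  exact (MeasurableEmbedding.integral_map (μ := σ) (f := e)
    e.toHomeomorph.measurableEmbedding g).symm

theorem lrot_cint {n : ℕ} {σ : Measure (Rn n)} (h : LRot σ) {g : Rn n → ℝ} (hg : Continuous g)
    (C : ℝ) (hC : ∀ᵐ y ∂σ, |g y| ≤ C) : Integrable g σ := by
  have := h.prob
  exact Integrable.of_bound hg.aestronglyMeasurable C hC

theorem lrot_refl {n : ℕ} {u v : Rn n} (hu : ‖u‖ = 1) (hv : ‖v‖ = 1) (huv : inner ℝ u v = 0)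
    (φ : ℝ) : ∃ e : Rn n ≃ₗᵢ[ℝ] Rn n, ∀ y,
      inner ℝ u (e y) = inner ℝ u y * Real.cos φ + inner ℝ v y * Real.sin φ ∧
      inner ℝ v (e y) = inner ℝ u y * Real.sin φ - inner ℝ v y * Real.cos φ := by
  set θ := φ / 2 with hθ
  have hφ : φ = 2 * θ := by rw [hθ]; ring
  set w : Rn n := Real.cos θ • u + Real.sin θ • v with hw
  have huu : inner ℝ u u = (1:ℝ) := by rw [real_inner_self_eq_norm_sq, hu]; norm_num
  have hvv : inner ℝ v v = (1:ℝ) := by rw [real_inner_self_eq_norm_sq, hv]; norm_num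
  have hvu : inner ℝ v u = (0:ℝ) := by rw [real_inner_comm]; exact huv
  have hsc := Real.sin_sq_add_cos_sq θ
  have hww : ‖w‖ ^ 2 = 1 := by
    rw [← real_inner_self_eq_norm_sq, hw]
    simp only [inner_add_left, inner_add_right, real_inner_smul_left, real_inner_smul_right, huu, hvv, huv, hvu]
    nlinarith
  refine ⟨(ℝ ∙ w).reflection, fun y => ?_⟩
  rw [Submodule.reflection_singleton_apply]
  have hs2 : Real.sin φ = 2 * Real.sin θ * Real.cos θ := by rw [hφ, Real.sin_two_mul]
  have hc2 : Real.cos φ = 2 * Real.cos θ ^ 2 - 1 := by rw [hφ, Real.cos_two_mul]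
  have hs : Real.sin θ ^ 2 = 1 - Real.cos θ ^ 2 := by linarith
  rw [hs2, hc2]
  have h1 : inner ℝ w y = Real.cos θ * inner ℝ u y + Real.sin θ * inner ℝ v y := by
    rw [hw]; simp only [inner_add_left, real_inner_smul_left]
  have h2 : inner ℝ u w = Real.cos θ := by
    rw [hw]; simp only [inner_add_right, real_inner_smul_right, huu, huv]; ring
  have h3 : inner ℝ v w = Real.sin θ := by
    rw [hw]; simp only [inner_add_right, real_inner_smul_right, hvv, hvu]; ring
  have hn : ((‖w‖ : ℝ) : ℝ) ^ 2 = 1 := hww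
  constructor
  · simp only [inner_sub_right, real_inner_smul_right, two_smul, inner_add_right, h1, h2]
    simp only [RCLike.ofReal_real_eq_id, id, hww]
    ring
  · simp only [inner_sub_right, real_inner_smul_right, two_smul, inner_add_right, h1, h3]
    simp only [RCLike.ofReal_real_eq_id, id, hww]
    linear_combination (2 * inner ℝ v y) * hs

theorem lrot_id {n : ℕ} {σ : Measure (Rn n)} (h : LRot σ) {u v : Rn n} (hu : ‖u‖ = 1)
    (hv : ‖v‖ = 1) (huv : inner ℝ u v = 0) (R : ℝ) :
    ∫ y, inner ℝ u y * Real.sin (R * inner ℝ u y) ∂σ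
      = R * ∫ y, (inner ℝ v y) ^ 2 * Real.cos (R * inner ℝ u y) ∂σ := by
  have := h.prob
  have hpu := lrot_p_bound h hu
  have hpv := lrot_p_bound h hv
  have hcu : Continuous (fun y : Rn n => inner ℝ u y) := by fun_prop
  have hcv : Continuous (fun y : Rn n => inner ℝ v y) := by fun_prop
  set G : ℝ → Rn n → ℝ := fun φ y => (inner ℝ u y * Real.sin φ - inner ℝ v y * Real.cos φ) *
    Real.sin (R * (inner ℝ u y * Real.cos φ + inner ℝ v y * Real.sin φ)) with hG
  set G' : ℝ → Rn n → ℝ := fun φ y => (inner ℝ u y * Real.cos φ + inner ℝ v y * Real.sin φ) *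
    Real.sin (R * (inner ℝ u y * Real.cos φ + inner ℝ v y * Real.sin φ)) +
    (inner ℝ u y * Real.sin φ - inner ℝ v y * Real.cos φ) *
    (Real.cos (R * (inner ℝ u y * Real.cos φ + inner ℝ v y * Real.sin φ)) *
      (R * (-(inner ℝ u y * Real.sin φ) + inner ℝ v y * Real.cos φ))) with hG'
  have hconst : ∀ φ, ∫ y, G φ y ∂σ = ∫ y, inner ℝ v y * Real.sin (R * inner ℝ u y) ∂σ := by
    intro φ
    obtain ⟨e, he⟩ := lrot_refl hu hv huv φ
    rw [← lrot_int_comp h e]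
    apply integral_congr_ae
    filter_upwards with y
    have hcs := Real.sin_sq_add_cos_sq φ
    simp only [hG]
    rw [(he y).1, (he y).2]
    have e1 : (inner ℝ u y * Real.cos φ + inner ℝ v y * Real.sin φ) * Real.sin φ
      - (inner ℝ u y * Real.sin φ - inner ℝ v y * Real.cos φ) * Real.cos φ = inner ℝ v y := by
      linear_combination (inner ℝ v y) * hcs
    have e2 : (inner ℝ u y * Real.cos φ + inner ℝ v y * Real.sin φ) * Real.cos φ
      + (inner ℝ u y * Real.sin φ - inner ℝ v y * Real.cos φ) * Real.sin φ = inner ℝ u y := by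
      linear_combination (inner ℝ u y) * hcs
    rw [e1, e2]
  have lin : ∀ p q φ : ℝ, |p| ≤ 1 → |q| ≤ 1 →
      |p * Real.sin φ| ≤ 1 ∧ |p * Real.cos φ| ≤ 1 := by
    intro p q φ hp hq
    constructor
    · rw [abs_mul]; exact mul_le_one₀ hp (abs_nonneg _) (Real.abs_sin_le_one _)
    · rw [abs_mul]; exact mul_le_one₀ hp (abs_nonneg _) (Real.abs_cos_le_one _)
  have hder := hasDerivAt_integral_of_dominated_loc_of_deriv_le (μ := σ) (F := G) (F' := G')
    (x₀ := 0) (s := Set.univ) (bound := fun _ => 2 + 2 * (|R| * 2)) Filter.univ_mem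
    (Filter.Eventually.of_forall fun φ => by
      apply Continuous.aestronglyMeasurable; rw [hG]; fun_prop)
    (by
      apply lrot_cint h (by rw [hG]; fun_prop) 1
      filter_upwards [hpv] with y hy
      simp only [hG, Real.sin_zero, Real.cos_zero, mul_zero, mul_one, add_zero, zero_sub, abs_mul, abs_neg]
      exact mul_le_one₀ hy (abs_nonneg _) (Real.abs_sin_le_one _))
    (by apply Continuous.aestronglyMeasurable; rw [hG']; fun_prop)
    (by
      filter_upwards [hpu, hpv] with y hy1 hy2 φ _
      obtain ⟨a1, a2⟩ := lin _ _ φ hy1 hy2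
      obtain ⟨a3, a4⟩ := lin _ _ φ hy2 hy1
      simp only [hG', Real.norm_eq_abs]
      refine (abs_add_le _ _).trans ?_
      have b1 : |inner ℝ u y * Real.cos φ + inner ℝ v y * Real.sin φ| ≤ 2 :=
        (abs_add_le _ _).trans (by linarith)
      have b2 : |inner ℝ u y * Real.sin φ - inner ℝ v y * Real.cos φ| ≤ 2 :=
        (abs_sub _ _).trans (by linarith)
      have b3 : |-(inner ℝ u y * Real.sin φ) + inner ℝ v y * Real.cos φ| ≤ 2 :=
        (abs_add_le _ _).trans (by rw [abs_neg]; linarith)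
      generalize R * (inner ℝ u y * Real.cos φ + inner ℝ v y * Real.sin φ) = z
      have c1 := Real.abs_sin_le_one z
      have c2 := Real.abs_cos_le_one z
      rw [abs_mul, abs_mul, abs_mul, abs_mul]
      apply add_le_add
      · have := mul_le_mul b1 c1 (abs_nonneg _) (by norm_num)
        linarith
      · refine mul_le_mul b2 ?_ (by positivity) (by norm_num)
        have := mul_le_mul c2 (mul_le_mul_of_nonneg_left b3 (abs_nonneg R)) (by positivity) (by norm_num)
        linarith)
    (integrable_const _)
    (by
      filter_upwards with y φ _
      have hs := Real.hasDerivAt_sin φ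
      have hc := Real.hasDerivAt_cos φ
      have h1 := (hs.const_mul (inner ℝ u y)).sub (hc.const_mul (inner ℝ v y))
      have h2 := (((hc.const_mul (inner ℝ u y)).add (hs.const_mul (inner ℝ v y))).const_mul R).sin
      refine (h1.mul h2).congr_deriv ?_
      simp only [hG', Pi.add_apply, Pi.sub_apply, Pi.mul_apply]
      ring)
  have h0 : HasDerivAt (fun φ => ∫ y, G φ y ∂σ) 0 0 := by
    have : (fun φ => ∫ y, G φ y ∂σ) = fun _ => ∫ y, inner ℝ v y * Real.sin (R * inner ℝ u y) ∂σ := by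
      funext φ; exact hconst φ
    rw [this]; exact hasDerivAt_const _ _
  have h1 := hder.2.unique h0
  have h2 : ∫ y, G' 0 y ∂σ = ∫ y, inner ℝ u y * Real.sin (R * inner ℝ u y) ∂σ
      - ∫ y, R * ((inner ℝ v y) ^ 2 * Real.cos (R * inner ℝ u y)) ∂σ := by
    rw [← integral_sub]
    · apply integral_congr_ae
      filter_upwards with y
      simp only [hG', Real.sin_zero, Real.cos_zero]
      ring_nf
    · apply lrot_cint h (by fun_prop) 1
      filter_upwards [hpu] with y hy
      rw [abs_mul]
      exact mul_le_one₀ hy (abs_nonneg _) (Real.abs_sin_le_one _)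
    · apply Integrable.const_mul
      apply lrot_cint h (by fun_prop) 1
      filter_upwards [hpv] with y hy
      rw [abs_mul, abs_pow]
      exact mul_le_one₀ (pow_le_one₀ (abs_nonneg _) hy) (abs_nonneg _) (Real.abs_cos_le_one _)
  rw [integral_const_mul] at h2
  linarith

theorem lrot_basis {n : ℕ} (hn : 2 ≤ n) {u : Rn n} (hu : ‖u‖ = 1) :
    ∃ (b : OrthonormalBasis (Fin n) ℝ (Rn n)) (i : Fin n), b i = u := by
  have : Fintype.card (Fin n) = Module.finrank ℝ (Rn n) := by simp
  have : NeZero n := ⟨by omega⟩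
  obtain ⟨b, hb⟩ := Orthonormal.exists_orthonormalBasis_extension_of_card_eq (𝕜 := ℝ) (E := Rn n) (ι := Fin n)
    (by simp) (v := fun _ => u) (s := {0}) (by
      constructor
      · intro i; simpa using hu
      · intro i j hij
        exact absurd (Subsingleton.elim i j) hij)
  exact ⟨b, 0, hb 0 rfl⟩

theorem lrot_cos_decay {n : ℕ} (hn : 2 ≤ n) {σ : Measure (Rn n)} (h : LRot σ) {u : Rn n}
    (hu : ‖u‖ = 1) (R : ℝ) (hR : 0 < R) :
    (∫ y, Real.cos (R * inner ℝ u y) ∂σ) ^ 2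
      ≤ 6 * Real.exp 1 * ((n - 1 : ℕ) : ℝ) ^ (n - 1) / R ^ (n - 1) := by
  have := h.prob
  have hpu := lrot_p_bound h hu
  have abs_le : ∀ g : Rn n → ℝ, (∀ᵐ y ∂σ, |g y| ≤ 1) → |∫ y, g y ∂σ| ≤ 1 := by
    intro g hg
    have := norm_integral_le_of_norm_le_const (μ := σ) (f := g) (C := 1) hg
    simpa using this
  have hsin : ∀ R : ℝ, ∀ᵐ y ∂σ, |inner ℝ u y * Real.sin (R * inner ℝ u y)| ≤ 1 := by
    intro R
    filter_upwards [hpu] with y hy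
    rw [abs_mul]
    exact mul_le_one₀ hy (abs_nonneg _) (Real.abs_sin_le_one _)
  have hcos2 : ∀ v : Rn n, ‖v‖ = 1 → ∀ R : ℝ,
      ∀ᵐ y ∂σ, |(inner ℝ v y) ^ 2 * Real.cos (R * inner ℝ u y)| ≤ 1 := by
    intro v hv R
    filter_upwards [lrot_p_bound h hv] with y hy
    rw [abs_mul, abs_pow]
    exact mul_le_one₀ (pow_le_one₀ (abs_nonneg _) hy) (abs_nonneg _) (Real.abs_cos_le_one _)
  have hcos : ∀ R : ℝ, ∀ᵐ y ∂σ, |Real.cos (R * inner ℝ u y)| ≤ 1 := fun R =>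
    Filter.Eventually.of_forall fun y => Real.abs_cos_le_one _
  refine lm_ode (n - 1) (by omega) (fun R => ∫ y, Real.cos (R * inner ℝ u y) ∂σ)
    (fun R => - ∫ y, inner ℝ u y * Real.sin (R * inner ℝ u y) ∂σ) (fun R => abs_le _ (hcos R))
    (fun R => by rw [abs_neg]; exact abs_le _ (hsin R)) ?_ ?_ R hR
  · intro R
    have hder := hasDerivAt_integral_of_dominated_loc_of_deriv_le (μ := σ)
      (F := fun R y => Real.cos (R * inner ℝ u y))
      (F' := fun R y => - (inner ℝ u y * Real.sin (R * inner ℝ u y)))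
      (x₀ := R) (s := Set.univ) (bound := fun _ => 1) Filter.univ_mem
      (Filter.Eventually.of_forall fun φ => by
        apply Continuous.aestronglyMeasurable; fun_prop)
      (lrot_cint h (by fun_prop) 1 (hcos R))
      (by apply Continuous.aestronglyMeasurable; fun_prop)
      (by
        filter_upwards [hpu] with y hy R' _
        rw [norm_neg, Real.norm_eq_abs, abs_mul]
        exact mul_le_one₀ hy (abs_nonneg _) (Real.abs_sin_le_one _))
      (integrable_const _)
      (by
        filter_upwards with y R' _
        refine (((hasDerivAt_id R').mul_const (inner ℝ u y)).cos).congr_deriv ?_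
        simp; ring)
    have := hder.2
    rwa [integral_neg] at this
  · intro R hR
    have hder := hasDerivAt_integral_of_dominated_loc_of_deriv_le (μ := σ)
      (F := fun R y => inner ℝ u y * Real.sin (R * inner ℝ u y))
      (F' := fun R y => (inner ℝ u y) ^ 2 * Real.cos (R * inner ℝ u y))
      (x₀ := R) (s := Set.univ) (bound := fun _ => 1) Filter.univ_mem
      (Filter.Eventually.of_forall fun φ => by
        apply Continuous.aestronglyMeasurable; fun_prop)
      (lrot_cint h (by fun_prop) 1 (hsin R))
      (by apply Continuous.aestronglyMeasurable; fun_prop)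
      (by
        filter_upwards [hpu] with y hy R' _
        rw [Real.norm_eq_abs, abs_mul, abs_pow]
        exact mul_le_one₀ (pow_le_one₀ (abs_nonneg _) hy) (abs_nonneg _) (Real.abs_cos_le_one _))
      (integrable_const _)
      (by
        filter_upwards with y R' _
        refine ((((hasDerivAt_id R').mul_const (inner ℝ u y)).sin).const_mul (inner ℝ u y)).congr_deriv ?_
        simp; ring)
    refine hder.2.neg.congr_deriv ?_
    obtain ⟨b, i, hb⟩ := lrot_basis hn hu
    have hsum : ∫ y, Real.cos (R * inner ℝ u y) ∂σ
        = ∑ j, ∫ y, (inner ℝ (b j) y) ^ 2 * Real.cos (R * inner ℝ u y) ∂σ := by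
      rw [← integral_finsetSum]
      · apply integral_congr_ae
        filter_upwards [h.supp] with y hy
        rw [← Finset.sum_mul]
        have := b.sum_sq_norm_inner_right y
        rw [hy] at this
        simp only [Real.norm_eq_abs, sq_abs] at this
        rw [this]; ring
      · intro j _
        exact lrot_cint h (by fun_prop) 1 (hcos2 _ (b.norm_eq_one j) R)
    have hj : ∀ j ∈ Finset.univ.erase i, ∫ y, (inner ℝ (b j) y) ^ 2 * Real.cos (R * inner ℝ u y) ∂σ
        = R⁻¹ * ∫ y, inner ℝ u y * Real.sin (R * inner ℝ u y) ∂σ := by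
      intro j hj
      have hji : i ≠ j := (Finset.ne_of_mem_erase hj).symm
      have := lrot_id h hu (b.norm_eq_one j) (by rw [← hb]; exact b.inner_eq_zero hji) R
      rw [this]
      field_simp
    rw [← Finset.add_sum_erase _ _ (Finset.mem_univ i), Finset.sum_congr rfl hj, hb] at hsum
    rw [Finset.sum_const, Finset.card_erase_of_mem (Finset.mem_univ i), Finset.card_univ,
      Fintype.card_fin, nsmul_eq_mul] at hsum
    rw [hsum]
    field_simp
    ring

theorem lrot_hat {n : ℕ} {σ : Measure (Rn n)} (h : LRot σ) (ξ : Rn n) :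
    lmhat σ ξ = ((∫ y, Real.cos (2 * Real.pi * inner ℝ ξ y) ∂σ : ℝ) : ℂ) := by
  have := h.prob
  have hs : ∫ y, Real.sin (2 * Real.pi * inner ℝ ξ y) ∂σ = 0 := by
    have := lrot_int_comp h (LinearIsometryEquiv.neg ℝ) (fun y => Real.sin (2 * Real.pi * inner ℝ ξ y))
    simp only [LinearIsometryEquiv.coe_neg, inner_neg_right, mul_neg, Real.sin_neg, integral_neg] at this
    linarith
  have e1 : ∀ y : Rn n, (Real.fourierChar (-inner ℝ y ξ) : ℂ)
      = ((Real.cos (2 * Real.pi * inner ℝ ξ y) : ℝ) : ℂ)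
        - ((Real.sin (2 * Real.pi * inner ℝ ξ y) : ℝ) : ℂ) * Complex.I := by
    intro y
    rw [Real.fourierChar_apply, real_inner_comm, mul_neg, Complex.exp_mul_I]
    rw [← Complex.ofReal_cos, ← Complex.ofReal_sin, Real.cos_neg, Real.sin_neg]
    push_cast
    ring
  unfold lmhat
  simp_rw [e1]
  rw [integral_sub, integral_mul_const, integral_complex_ofReal, integral_complex_ofReal, hs]
  · simp
  · exact (lrot_cint h (by fun_prop) 1 (Filter.Eventually.of_forall fun y => Real.abs_cos_le_one _)).ofReal
  · exact (lrot_cint h (by fun_prop) 1 (Filter.Eventually.of_forall fun y => Real.abs_sin_le_one _)).ofReal.mul_const _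

theorem lmhat_le_one {n : ℕ} (μ : Measure (Rn n)) [IsProbabilityMeasure μ] (ξ : Rn n) :
    ‖lmhat μ ξ‖ ≤ 1 := by
  have := norm_integral_le_of_norm_le_const (μ := μ)
    (f := fun y => (Real.fourierChar (-inner ℝ y ξ) : ℂ)) (C := 1)
    (Filter.Eventually.of_forall fun y => (Circle.norm_coe _).le)
  simpa [lmhat] using this

/-- Fourier decay of the sphere measure, in squared form. -/
theorem lrot_decay {n : ℕ} (hn : 2 ≤ n) :
    ∃ C : ℝ, 1 ≤ C ∧ ∀ σ : Measure (Rn n), LRot σ → ∀ ξ : Rn n,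
      ‖lmhat σ ξ‖ ^ 2 * ‖ξ‖ ^ (n - 1) ≤ C := by
  refine ⟨max 1 (6 * Real.exp 1 * ((n - 1 : ℕ) : ℝ) ^ (n - 1)), le_max_left _ _, fun σ h ξ => ?_⟩
  rcases eq_or_ne ξ 0 with rfl | hξ
  · rw [norm_zero, zero_pow (by omega)]; simp
  refine le_trans ?_ (le_max_right _ _)
  have hp : 0 < ‖ξ‖ := norm_pos_iff.2 hξ
  set u : Rn n := ‖ξ‖⁻¹ • ξ with hu
  have hu1 : ‖u‖ = 1 := by rw [hu, norm_smul, norm_inv, norm_norm]; field_simp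
  have hR : 0 < 2 * Real.pi * ‖ξ‖ := by positivity
  have h1 := lrot_cos_decay hn h hu1 _ hR
  have h2 : ∀ y, 2 * Real.pi * ‖ξ‖ * inner ℝ u y = 2 * Real.pi * inner ℝ ξ y := by
    intro y
    rw [hu, real_inner_smul_left]; field_simp
  simp_rw [h2] at h1
  rw [lrot_hat h, Complex.norm_real, Real.norm_eq_abs, sq_abs]
  rw [le_div_iff₀ (by positivity)] at h1
  refine le_trans ?_ h1
  gcongr
  have : 3 < Real.pi := Real.pi_gt_three
  nlinarith

theorem lrot_ball_eq {n : ℕ} {σ : Measure (Rn n)} (h : LRot σ) {u v : Rn n} (hu : ‖u‖ = 1)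
    (hv : ‖v‖ = 1) (δ : ℝ) : σ (closedBall u δ) = σ (closedBall v δ) := by
  set e := ((ℝ ∙ (u - v))ᗮ).reflection with he
  have h1 : e u = v := Submodule.reflection_sub (hu.trans hv.symm)
  conv_rhs => rw [← h.inv e]
  rw [Measure.map_apply e.continuous.measurable isClosed_closedBall.measurableSet]
  congr 1
  ext y
  rw [mem_preimage, mem_closedBall, mem_closedBall, ← h1, e.dist_map]

theorem lrot_ball_unit {n : ℕ} (hn : 2 ≤ n) {σ : Measure (Rn n)} (h : LRot σ) {u : Rn n}
    (hu : ‖u‖ = 1) {δ : ℝ} (hδ : 0 < δ) :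
    σ (closedBall u δ) ≤ ENNReal.ofReal (2 ^ n * δ ^ (n - 1)) := by
  have := h.prob
  have : Nonempty (Fin n) := ⟨⟨0, by omega⟩⟩
  set c := (volume : Measure (Rn n)) (ball 0 1) with hc
  have hc0 : c ≠ 0 := (measure_ball_pos _ _ one_pos).ne'
  have hct : c ≠ ∞ := measure_ball_lt_top.ne
  have hfr : Module.finrank ℝ (Rn n) = n := by simp
  set An : Set (Rn n) := closedBall 0 (1 + δ) \ closedBall 0 1 with hAn
  have hAnv : ENNReal.ofReal δ * c ≤ volume An := by
    rw [hAn, measure_sdiff (closedBall_subset_closedBall (by linarith))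
      isClosed_closedBall.measurableSet.nullMeasurableSet (isCompact_closedBall _ _).measure_lt_top.ne,
      Measure.addHaar_closedBall _ _ (by positivity), Measure.addHaar_closedBall _ _ (by positivity),
      hfr, ← hc, ← ENNReal.sub_mul (fun _ _ => hct), ← ENNReal.ofReal_sub _ (by positivity)]
    gcongr
    have h1 := one_add_mul_le_pow (a := δ) (by linarith) n
    have h2 : (2:ℝ) ≤ n := by exact_mod_cast hn
    rw [one_pow]
    nlinarith
  set K : Set (Rn n × Rn n) := {p | dist p.2 p.1 ≤ 2 * δ} with hK
  have hKm : MeasurableSet K :=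
    (isClosed_le (continuous_snd.dist continuous_fst) continuous_const).measurableSet
  have h1 : (volume.prod σ) K = ∫⁻ x : Rn n, σ (closedBall x (2 * δ)) := by
    rw [Measure.prod_apply hKm]; rfl
  have h2 : (volume.prod σ) K = ENNReal.ofReal ((2 * δ) ^ n) * c := by
    rw [Measure.prod_apply_symm hKm]
    have : ∀ y : Rn n, volume ((fun x => (x, y)) ⁻¹' K) = ENNReal.ofReal ((2 * δ) ^ n) * c := by
      intro y
      have : (fun x => (x, y)) ⁻¹' K = closedBall y (2 * δ) := by
        ext x; simp [hK, dist_comm]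
      rw [this, Measure.addHaar_closedBall _ _ (by positivity), hfr]
    simp_rw [this]
    simp
  have h3 : σ (closedBall u δ) * (ENNReal.ofReal δ * c) ≤ ENNReal.ofReal ((2 * δ) ^ n) * c := by
    calc σ (closedBall u δ) * (ENNReal.ofReal δ * c) ≤ σ (closedBall u δ) * volume An := by gcongr
      _ = ∫⁻ x in An, σ (closedBall u δ) := by simp
      _ ≤ ∫⁻ x in An, σ (closedBall x (2 * δ)) := by
          apply setLIntegral_mono' (MeasurableSet.diff isClosed_closedBall.measurableSet isClosed_closedBall.measurableSet)
          intro x hx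
          have hx1 : 1 < ‖x‖ := by have := hx.2; simpa using this
          have hx2 : ‖x‖ ≤ 1 + δ := by have := hx.1; simpa using this
          have hp : 0 < ‖x‖ := by linarith
          rw [lrot_ball_eq h hu (v := ‖x‖⁻¹ • x) (by rw [norm_smul, norm_inv, norm_norm]; field_simp) δ]
          apply measure_mono
          apply closedBall_subset_closedBall'
          have : dist (‖x‖⁻¹ • x) x ≤ δ := by
            rw [dist_eq_norm]
            have : ‖x‖⁻¹ • x - x = (‖x‖⁻¹ - 1) • x := by rw [sub_smul, one_smul]
            rw [this, norm_smul, Real.norm_eq_abs, abs_of_nonpos (by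
              rw [sub_nonpos]; exact inv_le_one_of_one_le₀ hx1.le)]
            have : -(‖x‖⁻¹ - 1) * ‖x‖ = ‖x‖ - 1 := by field_simp; ring
            linarith
          linarith
      _ ≤ ∫⁻ x, σ (closedBall x (2 * δ)) := setLIntegral_le_lintegral _ _
      _ = _ := by rw [← h1, h2]
  rw [← mul_assoc] at h3
  have h4 := (ENNReal.mul_le_mul_iff_left hc0 hct).1 h3
  have h5 : ENNReal.ofReal ((2 * δ) ^ n) = ENNReal.ofReal (2 ^ n * δ ^ (n - 1)) * ENNReal.ofReal δ := by
    rw [← ENNReal.ofReal_mul (by positivity), mul_pow, mul_assoc, ← pow_succ]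
    congr 4; omega
  rw [h5] at h4
  exact (ENNReal.mul_le_mul_iff_left (by simpa using hδ) ENNReal.ofReal_ne_top).1 h4

theorem lrot_ball {n : ℕ} (hn : 2 ≤ n) {σ : Measure (Rn n)} (h : LRot σ) (x : Rn n)
    {δ : ℝ} (hδ : 0 < δ) :
    σ.real (closedBall x δ) ≤ 4 ^ n * δ ^ (n - 1) := by
  have := h.prob
  rw [measureReal_def]
  apply ENNReal.toReal_le_of_le_ofReal (by positivity)
  by_cases hx : ∃ u ∈ closedBall x δ, ‖u‖ = 1
  · obtain ⟨u, hu, hu1⟩ := hx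
    calc σ (closedBall x δ) ≤ σ (closedBall u (2 * δ)) := by
          apply measure_mono
          apply closedBall_subset_closedBall'
          rw [mem_closedBall, dist_comm] at hu
          linarith
      _ ≤ ENNReal.ofReal (2 ^ n * (2 * δ) ^ (n - 1)) := lrot_ball_unit hn h hu1 (by positivity)
      _ ≤ _ := by
          apply ENNReal.ofReal_le_ofReal
          rw [mul_pow, ← mul_assoc]
          gcongr
          calc (2:ℝ) ^ n * 2 ^ (n - 1) ≤ 2 ^ n * 2 ^ n := by
                gcongr
                · norm_num
                · omega
            _ = 4 ^ n := by rw [← mul_pow]; norm_num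
  · push Not at hx
    have : σ (closedBall x δ) = 0 := by
      rw [measure_eq_zero_iff_ae_notMem]
      filter_upwards [h.supp] with y hy hy2
      exact hx y hy2 hy
    rw [this]; simp

noncomputable def lunif (n : ℕ) (δ : ℝ) : Measure (Rn n) :=
  (volume (closedBall (0 : Rn n) δ))⁻¹ • volume.restrict (closedBall (0 : Rn n) δ)

theorem lunif_prob (n : ℕ) {δ : ℝ} (hδ : 0 < δ) : IsProbabilityMeasure (lunif n δ) := by
  constructor
  rw [lunif]
  simp only [Measure.smul_apply, Measure.restrict_apply_univ, smul_eq_mul]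
  exact ENNReal.inv_mul_cancel (measure_closedBall_pos _ _ hδ).ne'
    (isCompact_closedBall _ _).measure_lt_top.ne

theorem lunif_supp (n : ℕ) (δ : ℝ) : ∀ᵐ y ∂(lunif n δ), ‖y‖ ≤ δ := by
  rw [lunif]
  apply Measure.ae_smul_measure
  filter_upwards [ae_restrict_mem isClosed_closedBall.measurableSet] with y hy
  simpa using hy

theorem lmhat_near {n : ℕ} (μ : Measure (Rn n)) [IsProbabilityMeasure μ] {δ : ℝ}
    (hs : ∀ᵐ y ∂μ, ‖y‖ ≤ δ) (ξ : Rn n) :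
    ‖1 - lmhat μ ξ‖ ≤ 2 * Real.pi * δ * ‖ξ‖ := by
  have hc : Continuous (fun y : Rn n => (Real.fourierChar (-inner ℝ y ξ) : ℂ)) := by
    exact continuous_subtype_val.comp (Real.continuous_fourierChar.comp
      (continuous_id.inner continuous_const).neg)
  have hi : Integrable (fun y : Rn n => (Real.fourierChar (-inner ℝ y ξ) : ℂ)) μ :=
    Integrable.of_bound hc.aestronglyMeasurable 1
      (Filter.Eventually.of_forall fun y => (Circle.norm_coe _).le)
  have h1 : (1 : ℂ) - lmhat μ ξ = ∫ y, ((1 : ℂ) - (Real.fourierChar (-inner ℝ y ξ) : ℂ)) ∂μ := by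
    rw [integral_sub (integrable_const _) hi]; simp [lmhat]
  rw [h1]
  have := norm_integral_le_of_norm_le_const (μ := μ) (C := 2 * Real.pi * δ * ‖ξ‖)
    (f := fun y => ((1 : ℂ) - (Real.fourierChar (-inner ℝ y ξ) : ℂ))) (by
      filter_upwards [hs] with y hy
      rw [norm_sub_rev, Real.fourierChar_apply, mul_comm _ Complex.I]
      refine (Real.norm_exp_I_mul_ofReal_sub_one_le).trans ?_
      rw [norm_mul, norm_neg, Real.norm_eq_abs (2 * Real.pi), abs_of_pos (by positivity), mul_assoc (2 * Real.pi)]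
      refine mul_le_mul_of_nonneg_left ?_ (by positivity)
      refine (abs_real_inner_le_norm y ξ).trans ?_
      gcongr)
  simpa using this

theorem lmhat_two {n : ℕ} (μ : Measure (Rn n)) [IsProbabilityMeasure μ] (ξ : Rn n) :
    ‖1 - lmhat μ ξ‖ ≤ 2 := by
  refine (norm_sub_le _ _).trans ?_
  have := lmhat_le_one μ ξ
  simp only [norm_one]
  linarith

theorem lprod_int {n : ℕ} {μ : Measure (Rn n)} [SFinite μ] {F k : Rn n × Rn n → ℝ} {b : Rn n → ℝ} {M : ℝ}
    (hF : Measurable F) (hk : ∀ z, Integrable (fun w => k (z, w)) μ) (hb : Integrable b)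
    (hM : ∀ z, ∫ w, k (z, w) ∂μ ≤ M) (h : ∀ z w, |F (z, w)| ≤ |b z| * k (z, w)) :
    Integrable F (volume.prod μ) := by
  rw [integrable_prod_iff hF.aestronglyMeasurable]
  have h1 : ∀ z, Integrable (fun w => F (z, w)) μ := fun z =>
    ((hk z).const_mul |b z|).mono' (hF.comp measurable_prodMk_left).aestronglyMeasurable
      (Filter.Eventually.of_forall fun w => h z w)
  refine ⟨Filter.Eventually.of_forall h1, ?_⟩
  refine (hb.norm.mul_const M).mono' ?_ (Filter.Eventually.of_forall fun z => ?_)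
  · exact hF.norm.stronglyMeasurable.integral_prod_right.aestronglyMeasurable
  · rw [Real.norm_eq_abs, abs_of_nonneg (integral_nonneg fun w => norm_nonneg _)]
    calc ∫ w, ‖F (z, w)‖ ∂μ ≤ ∫ w, |b z| * k (z, w) ∂μ :=
          integral_mono (h1 z).norm ((hk z).const_mul _) (h z)
      _ = |b z| * ∫ w, k (z, w) ∂μ := integral_const_mul _ _
      _ ≤ _ := by rw [Real.norm_eq_abs]; gcongr; exact hM z

theorem lunif_conv {n : ℕ} (δ : ℝ) (f : Rn n → ℝ) (u : Rn n) :
    lconv (lunif n δ) f u = (volume.real (closedBall (0 : Rn n) δ))⁻¹ *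
      ∫ w, f w * (closedBall u δ).indicator 1 w := by
  rw [lconv, lunif, integral_smul_measure, ENNReal.toReal_inv]
  rw [smul_eq_mul]
  congr 1
  rw [← integral_indicator isClosed_closedBall.measurableSet]
  rw [← integral_sub_left_eq_self (fun w => f w * (closedBall u δ).indicator 1 w) volume u]
  congr 1
  funext z
  by_cases hz : ‖z‖ ≤ δ
  · have h1 : z ∈ closedBall (0 : Rn n) δ := by simpa using hz
    have h2 : u - z ∈ closedBall u δ := by simpa using hz
    simp [indicator_of_mem h1, indicator_of_mem h2]
  · have h1 : z ∉ closedBall (0 : Rn n) δ := by simpa using hz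
    have h2 : u - z ∉ closedBall u δ := by simpa using hz
    simp [indicator_of_notMem h1, indicator_of_notMem h2]

/-- pointwise bound for the smoothed average -/
theorem lconv_smooth {n : ℕ} (hn : 2 ≤ n) : ∃ C : ℝ, 0 < C ∧ ∀ σ : Measure (Rn n), LRot σ →
    ∀ f : Rn n → ℝ, LNice f → ∀ δ : ℝ, 0 < δ → ∀ x,
      |lconv σ (lconv (lunif n δ) f) x| ≤ C * δ⁻¹ * ∫ w, |f w| := by
  have hne : Nonempty (Fin n) := ⟨⟨0, by omega⟩⟩
  set c := volume.real (ball (0 : Rn n) 1) with hc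
  have hc0 : 0 < c := ENNReal.toReal_pos (measure_ball_pos _ _ one_pos).ne' measure_ball_lt_top.ne
  refine ⟨4 ^ n / c, by positivity, fun σ hσ f hf δ hδ x => ?_⟩
  have := hσ.prob
  have := lunif_prob n hδ
  set V := volume.real (closedBall (0 : Rn n) δ) with hV
  have hVe : V = δ ^ n * c := by
    rw [hV, measureReal_def, Measure.addHaar_closedBall _ _ hδ.le, ENNReal.toReal_mul,
      ENNReal.toReal_ofReal (by positivity)]
    simp [hc, measureReal_def]
  have hV0 : 0 < V := by rw [hVe]; positivity
  set F : Rn n × Rn n → ℝ := fun p => |f p.1| * {q : Rn n × Rn n | dist q.1 (x - q.2) ≤ δ}.indicator 1 p with hF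
  have hSm : MeasurableSet {q : Rn n × Rn n | dist q.1 (x - q.2) ≤ δ} :=
    (isClosed_le (by fun_prop) continuous_const).measurableSet
  have hFm : Measurable F := (hf.meas.comp measurable_fst).norm.mul (measurable_one.indicator hSm)
  have hind : ∀ p : Rn n × Rn n, {q : Rn n × Rn n | dist q.1 (x - q.2) ≤ δ}.indicator (1 : Rn n × Rn n → ℝ) p
      = (closedBall (x - p.2) δ).indicator (1 : Rn n → ℝ) p.1 := by
    intro p
    by_cases h : dist p.1 (x - p.2) ≤ δ
    · rw [indicator_of_mem (by exact h), indicator_of_mem (by simpa using h)]; rfl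
    · rw [indicator_of_notMem (by exact h), indicator_of_notMem (by simpa using h)]
  have hind1 : ∀ p : Rn n × Rn n, {q : Rn n × Rn n | dist q.1 (x - q.2) ≤ δ}.indicator (1 : Rn n × Rn n → ℝ) p
      = (closedBall (x - p.1) δ).indicator (1 : Rn n → ℝ) p.2 := by
    intro p
    rw [hind]
    have : dist p.1 (x - p.2) = dist p.2 (x - p.1) := by
      rw [dist_eq_norm, dist_eq_norm]; congr 1; abel
    by_cases h : dist p.1 (x - p.2) ≤ δ
    · rw [indicator_of_mem (by exact h), indicator_of_mem (by rw [mem_closedBall, ← this]; exact h)]; rfl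
    · rw [indicator_of_notMem (by exact h), indicator_of_notMem (by rw [mem_closedBall, ← this]; exact h)]
  have hFi : Integrable F (volume.prod σ) := by
    refine lprod_int (k := fun _ => 1) (b := f) (M := 1) hFm (fun z => integrable_const _) hf.int
      (fun z => by simp) (fun z w => ?_)
    simp only [hF, abs_mul, abs_abs]
    gcongr
    by_cases h : dist z (x - w) ≤ δ
    · rw [indicator_of_mem (by exact h)]; simp
    · rw [indicator_of_notMem (by exact h)]; simp
  have hb : ∀ y, |lconv (lunif n δ) f (x - y)| ≤ V⁻¹ * ∫ w, F (w, y) := by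
    intro y
    rw [lunif_conv, abs_mul, abs_of_pos (inv_pos.2 hV0)]
    gcongr
    refine (abs_integral_le_integral_abs).trans (le_of_eq ?_)
    congr 1
    funext w
    simp only [hF]
    rw [hind, abs_mul]
    congr 1
    apply abs_of_nonneg
    exact indicator_nonneg (fun _ _ => zero_le_one) _
  calc |lconv σ (lconv (lunif n δ) f) x| ≤ ∫ y, |lconv (lunif n δ) f (x - y)| ∂σ :=
        abs_integral_le_integral_abs
    _ ≤ ∫ y, V⁻¹ * (∫ w, F (w, y)) ∂σ := by
        apply integral_mono (lslice_int σ (lconv_nice _ hf) x).norm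
          (hFi.integral_prod_right.const_mul _)
        exact hb
    _ = V⁻¹ * ∫ w, ∫ y, F (w, y) ∂σ := by
        rw [integral_const_mul]
        congr 1
        exact (integral_integral_swap (f := fun w y => F (w, y)) hFi).symm
    _ ≤ V⁻¹ * ∫ w, |f w| * (4 ^ n * δ ^ (n - 1)) := by
        refine mul_le_mul_of_nonneg_left ?_ (inv_pos.2 hV0).le
        apply integral_mono hFi.integral_prod_left (hf.int.norm.mul_const _)
        intro w
        simp only [hF, hind1]
        rw [integral_const_mul]
        simp only [Real.norm_eq_abs]
        gcongr
        rw [integral_indicator_one isClosed_closedBall.measurableSet]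
        exact lrot_ball hn hσ _ hδ
    _ = _ := by
        rw [integral_mul_const, hVe]
        have : δ ^ n = δ ^ (n - 1) * δ := by rw [← pow_succ]; congr 1; omega
        rw [this]
        field_simp

open scoped FourierTransform

noncomputable def lD {n : ℕ} (μ : Measure (Rn n)) (f : Rn n → ℝ) : Rn n → ℝ :=
  fun x => f x - lconv μ f x

theorem lD_nice {n : ℕ} (μ : Measure (Rn n)) [IsProbabilityMeasure μ] {f : Rn n → ℝ}
    (hf : LNice f) : LNice (lD μ f) := hf.sub (lconv_nice μ hf)

theorem lfour_sub {n : ℕ} {f g : Rn n → ℝ} (hf : LNice f) (hg : LNice g) (ξ : Rn n) :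
    𝓕 (fun x => ((f x - g x : ℝ) : ℂ)) ξ = 𝓕 (fun x => (f x : ℂ)) ξ - 𝓕 (fun x => (g x : ℂ)) ξ := by
  simp only [Real.fourier_eq]
  rw [← integral_sub]
  · congr 1
    funext x
    push_cast
    rw [smul_sub]
  · exact (Real.fourierIntegral_convergent_iff ξ).2 hf.int.ofReal
  · exact (Real.fourierIntegral_convergent_iff ξ).2 hg.int.ofReal

theorem lD_four {n : ℕ} (μ : Measure (Rn n)) [IsProbabilityMeasure μ] {f : Rn n → ℝ}
    (hf : LNice f) (ξ : Rn n) :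
    𝓕 (fun x => (lD μ f x : ℂ)) ξ = (1 - lmhat μ ξ) * 𝓕 (fun x => (f x : ℂ)) ξ := by
  have := lfour_sub hf (lconv_nice μ hf) ξ
  rw [lconv_fourier μ hf] at this
  unfold lD
  rw [this]; ring

theorem lD_iter {n : ℕ} (μ : Measure (Rn n)) [IsProbabilityMeasure μ] {f : Rn n → ℝ}
    (hf : LNice f) (N : ℕ) : LNice ((lD μ)^[N] f) ∧
      (∀ ξ, 𝓕 (fun x => ((lD μ)^[N] f x : ℂ)) ξ = (1 - lmhat μ ξ) ^ N * 𝓕 (fun x => (f x : ℂ)) ξ) ∧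
      ∫ x, |(lD μ)^[N] f x| ≤ 2 ^ N * ∫ x, |f x| := by
  induction N with
  | zero => exact ⟨hf, fun ξ => by simp, by simp⟩
  | succ N ih =>
    obtain ⟨h1, h2, h3⟩ := ih
    simp only [Function.iterate_succ_apply']
    refine ⟨lD_nice μ h1, fun ξ => ?_, ?_⟩
    · rw [lD_four μ h1, h2]; ring
    · calc ∫ x, |lD μ ((lD μ)^[N] f) x|
          ≤ ∫ x, (|(lD μ)^[N] f x| + |lconv μ ((lD μ)^[N] f) x|) := by
            apply integral_mono (lD_nice μ h1).int.norm (h1.int.norm.add (lconv_nice μ h1).int.norm)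
            intro x
            exact abs_sub _ _
        _ = (∫ x, |(lD μ)^[N] f x|) + ∫ x, |lconv μ ((lD μ)^[N] f) x| :=
            integral_add h1.int.norm (lconv_nice μ h1).int.norm
        _ ≤ _ := by
            have := lconv_l1 μ h1
            rw [pow_succ]; linarith

theorem lbil_bound {n : ℕ} {u g : Rn n → ℝ} (hg : LNice g) {K : ℝ}
    (h : ∀ x, |u x| ≤ K) : |∫ x, u x * g x| ≤ K * ∫ x, |g x| := by
  rw [← integral_const_mul]
  refine norm_integral_le_of_norm_le (f := fun x => u x * g x) (g := fun x => K * |g x|)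
    (hg.int.norm.const_mul _) (Filter.Eventually.of_forall fun x => ?_)
  rw [norm_mul]
  exact mul_le_mul_of_nonneg_right (h x) (abs_nonneg _)

theorem lm_L1 {n : ℕ} (hn : 2 ≤ n) : ∃ C : ℝ, 0 < C ∧ ∀ σ : Measure (Rn n), LRot σ →
    ∀ f g : Rn n → ℝ, LNice f → LNice g → ∀ δ : ℝ, 0 < δ →
      |∫ x, lconv σ f x * g x| ≤ C * (δ⁻¹ * (∫ x, |f x|) * (∫ x, |g x|)
        + √(δ ^ (n - 1)) * (√(∫ x, f x ^ 2) * √(∫ x, g x ^ 2))) := by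
  obtain ⟨C₁, hC₁, h₁⟩ := lconv_smooth hn
  obtain ⟨C₂, hC₂, h₂⟩ := lrot_decay hn
  set K := √(C₂ * (2 * Real.pi) ^ (n - 1) * 2 ^ (n + 1)) with hK
  refine ⟨2 ^ n * C₁ + K, by positivity, fun σ hσ f g hf hg δ hδ => ?_⟩
  have := hσ.prob
  have := lunif_prob n hδ
  set ν := lunif n δ with hν
  set I1 := ∫ x, |f x| with hI1
  set G1 := ∫ x, |g x| with hG1
  have hI0 : 0 ≤ I1 := integral_nonneg fun _ => abs_nonneg _
  have hG0 : 0 ≤ G1 := integral_nonneg fun _ => abs_nonneg _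
  have step : ∀ N : ℕ, |(∫ x, lconv σ f x * g x) - (∫ x, lconv σ ((lD ν)^[N] f) x * g x)|
      ≤ (2 ^ N - 1) * (C₁ * δ⁻¹ * I1 * G1) := by
    intro N
    induction N with
    | zero => simp
    | succ N ih =>
      obtain ⟨a1, a2, a3⟩ := lD_iter ν hf N
      set fN := (lD ν)^[N] f with hfN
      have e1 : (∫ x, lconv σ ((lD ν)^[N+1] f) x * g x) = (∫ x, lconv σ fN x * g x)
          - (∫ x, lconv σ (lconv ν fN) x * g x) := by
        rw [← integral_sub ((lconv_nice σ a1).mul_int hg) ((lconv_nice σ (lconv_nice ν a1)).mul_int hg)]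
        congr 1
        funext x
        rw [Function.iterate_succ_apply', ← hfN]
        unfold lD
        rw [lconv_sub σ a1 (lconv_nice ν a1)]
        ring
      have e2 : |(∫ x, lconv σ (lconv ν fN) x * g x)| ≤ 2 ^ N * (C₁ * δ⁻¹ * I1 * G1) := by
        refine (lbil_bound hg (h₁ σ hσ fN a1 δ hδ)).trans ?_
        calc C₁ * δ⁻¹ * (∫ w, |fN w|) * G1 ≤ C₁ * δ⁻¹ * (2 ^ N * I1) * G1 := by gcongr
          _ = _ := by ring
      rw [e1]
      have : (∫ x, lconv σ f x * g x) - ((∫ x, lconv σ fN x * g x)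
          - (∫ x, lconv σ (lconv ν fN) x * g x)) = ((∫ x, lconv σ f x * g x) - (∫ x, lconv σ fN x * g x))
          + (∫ x, lconv σ (lconv ν fN) x * g x) := by ring
      rw [this]
      refine (abs_add_le _ _).trans ?_
      rw [pow_succ]
      linarith
  obtain ⟨a1, a2, a3⟩ := lD_iter ν hf n
  have hl2 : √(∫ x, lconv σ ((lD ν)^[n] f) x ^ 2) ≤ (K * √(δ ^ (n - 1))) * √(∫ x, f x ^ 2) := by
    apply lm_l2_compare (lconv_nice σ a1) hf _ (by positivity)
    intro ξ
    rw [lconv_fourier σ a1, a2, ← mul_assoc, norm_mul]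
    gcongr
    rw [hK, ← Real.sqrt_mul (by positivity)]
    apply Real.le_sqrt_of_sq_le
    rw [norm_mul, norm_pow, mul_pow, ← pow_mul]
    set d := ‖1 - lmhat ν ξ‖ with hd
    have d0 : 0 ≤ d := norm_nonneg _
    have d1 : d ≤ 2 * Real.pi * δ * ‖ξ‖ := lmhat_near ν (lunif_supp n δ) ξ
    have d2 : d ≤ 2 := lmhat_two ν ξ
    have hpow : n * 2 = (n - 1) + (n + 1) := by omega
    rw [hpow, pow_add]
    have q1 := pow_le_pow_left₀ d0 d1 (n - 1)
    have q2 := pow_le_pow_left₀ d0 d2 (n + 1)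
    have q3 := h₂ σ hσ ξ
    calc ‖lmhat σ ξ‖ ^ 2 * (d ^ (n - 1) * d ^ (n + 1))
        ≤ ‖lmhat σ ξ‖ ^ 2 * ((2 * Real.pi * δ * ‖ξ‖) ^ (n - 1) * 2 ^ (n + 1)) := by gcongr
      _ = (‖lmhat σ ξ‖ ^ 2 * ‖ξ‖ ^ (n - 1)) * ((2 * Real.pi) ^ (n - 1) * 2 ^ (n + 1) * δ ^ (n - 1)) := by
          rw [mul_pow, mul_pow]; ring
      _ ≤ C₂ * ((2 * Real.pi) ^ (n - 1) * 2 ^ (n + 1) * δ ^ (n - 1)) := by gcongr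
      _ = _ := by ring
  have e3 := lm_cs (lconv_nice σ a1) hg
  have e4 := step n
  set X := √(∫ x, f x ^ 2)
  set Y := √(∫ x, g x ^ 2)
  have hX : 0 ≤ X := Real.sqrt_nonneg _
  have hY : 0 ≤ Y := Real.sqrt_nonneg _
  have e5 : |(∫ x, lconv σ ((lD ν)^[n] f) x * g x)| ≤ K * √(δ ^ (n - 1)) * X * Y :=
    e3.trans (by gcongr)
  have e6 : |(∫ x, lconv σ f x * g x)| ≤ (2 ^ n - 1) * (C₁ * δ⁻¹ * I1 * G1) + K * √(δ ^ (n - 1)) * X * Y := by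
    have := abs_add_le ((∫ x, lconv σ f x * g x) - (∫ x, lconv σ ((lD ν)^[n] f) x * g x))
      ((∫ x, lconv σ ((lD ν)^[n] f) x * g x))
    rw [sub_add_cancel] at this
    linarith
  refine e6.trans ?_
  have p1 : 0 ≤ δ⁻¹ * I1 * G1 := by positivity
  have p2 : 0 ≤ √(δ ^ (n - 1)) * (X * Y) := by positivity
  have p3 : 0 ≤ K := by positivity
  have p4 : (0:ℝ) ≤ 2 ^ n * C₁ := by positivity
  nlinarith [mul_nonneg p3 p1, mul_nonneg p4 p2, mul_nonneg hC₁.le p1]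

theorem lbox_vol {n : ℕ} (s : Fin n → Set ℝ) (hs : ∀ i, MeasurableSet (s i)) :
    (volume : Measure (Rn n)) {x | ∀ i, x i ∈ s i} = ∏ i, volume (s i) := by
  have h := (PiLp.volume_preserving_ofLp (Fin n)).measure_preimage
    (s := Set.univ.pi s) (MeasurableSet.univ_pi hs).nullMeasurableSet
  rw [volume_pi_pi] at h
  rw [← h]
  congr 1
  ext x
  simp

theorem lbox_meas {n : ℕ} (s : Fin n → Set ℝ) (hs : ∀ i, MeasurableSet (s i)) :
    MeasurableSet {x : Rn n | ∀ i, x i ∈ s i} := by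
  have : {x : Rn n | ∀ i, x i ∈ s i} = ⋂ i, (fun x : Rn n => x i) ⁻¹' (s i) := by ext x; simp
  rw [this]
  exact MeasurableSet.iInter fun i => (by fun_prop : Measurable fun x : Rn n => x i) (hs i)

/-- index of the half open grid cell of side `l` containing `z` -/
noncomputable def lidx {n : ℕ} (l : ℝ) (z : Rn n) : Fin n → ℤ := fun i => ⌊z i / l⌋

def lcell {n : ℕ} (l : ℝ) (k : Fin n → ℤ) : Set (Rn n) := {z | lidx l z = k}

theorem lidx_meas {n : ℕ} (l : ℝ) : Measurable (lidx (n := n) l) := by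
  refine measurable_pi_lambda _ fun i => ?_
  exact Int.measurable_floor.comp (by fun_prop)

theorem lcell_meas {n : ℕ} (l : ℝ) (k : Fin n → ℤ) : MeasurableSet (lcell l k) :=
  lidx_meas l (measurableSet_singleton k)

theorem lcell_eq {n : ℕ} {l : ℝ} (hl : 0 < l) (k : Fin n → ℤ) :
    lcell l k = {z | ∀ i, z i ∈ Ico (l * k i) (l * k i + l)} := by
  ext z
  simp only [lcell, lidx, mem_setOf_eq, funext_iff, Int.floor_eq_iff, mem_Ico]
  apply forall_congr'
  intro i
  rw [le_div_iff₀ hl, div_lt_iff₀ hl]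
  constructor <;> rintro ⟨h1, h2⟩ <;> constructor <;> linarith

theorem lcell_vol {n : ℕ} {l : ℝ} (hl : 0 < l) (k : Fin n → ℤ) :
    (volume : Measure (Rn n)) (lcell l k) = ENNReal.ofReal (l ^ n) := by
  rw [lcell_eq hl, lbox_vol _ (fun i => measurableSet_Ico)]
  simp [ENNReal.ofReal_pow hl.le]

theorem lidx_close {n : ℕ} {l : ℝ} (hl : 0 < l) {z w : Rn n} (h : lidx l z = lidx l w) (i : Fin n) :
    |z i - w i| ≤ l := by
  have hz : z ∈ lcell l (lidx l z) := rfl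
  have hw : w ∈ lcell l (lidx l z) := h.symm
  rw [lcell_eq hl] at hz hw
  have h1 := hz i
  have h2 := hw i
  rw [mem_Ico] at h1 h2
  rw [abs_le]; constructor <;> linarith

theorem lidx_set_meas {n : ℕ} (l : ℝ) {α : Type*} [MeasurableSpace α] {f g : α → Rn n}
    (hf : Measurable f) (hg : Measurable g) : MeasurableSet {a | lidx l (f a) = lidx l (g a)} :=
  measurableSet_eq_fun ((lidx_meas l).comp hf) ((lidx_meas l).comp hg)

theorem lbox_norm {n : ℕ} {l : ℝ} (hl : 0 ≤ l) {h : Rn n} (hh : ∀ i, |h i| ≤ l) : ‖h‖ ≤ n * l := by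
  rw [EuclideanSpace.norm_eq]
  apply Real.sqrt_le_iff.2
  refine ⟨by positivity, ?_⟩
  calc ∑ i, ‖h i‖ ^ 2 ≤ ∑ i : Fin n, l ^ 2 := by
        apply Finset.sum_le_sum
        intro i _
        rw [Real.norm_eq_abs]
        exact pow_le_pow_left₀ (abs_nonneg _) (hh i) 2
    _ = n * l ^ 2 := by simp
    _ ≤ (n * l) ^ 2 := by
        rw [mul_pow]
        gcongr
        rcases Nat.eq_zero_or_pos n with h0 | h0
        · simp [h0]
        · have : (1:ℝ) ≤ n := by exact_mod_cast h0
          nlinarith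

/-- modulus of continuity in `L²` of the averages -/
theorem lm_trans {n : ℕ} (hn : 2 ≤ n) : ∃ C : ℝ, 0 < C ∧ ∀ σ : Measure (Rn n), LRot σ →
    ∀ g : Rn n → ℝ, LNice g → ∀ h : Rn n,
      √(∫ x, (lconv σ g x - lconv σ g (x - h)) ^ 2) ≤ C * √‖h‖ * √(∫ x, g x ^ 2) := by
  obtain ⟨C₂, hC₂, h₂⟩ := lrot_decay hn
  refine ⟨√(C₂ * (4 * Real.pi)), by positivity, fun σ hσ g hg h => ?_⟩
  have := hσ.prob
  have e1 : (fun x => lconv σ g x - lconv σ g (x - h)) = lD (Measure.dirac h) (lconv σ g) := by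
    funext x
    simp [lD, lconv]
  have e2 : ∀ x, lconv σ g x - lconv σ g (x - h) = lD (Measure.dirac h) (lconv σ g) x :=
    fun x => congrFun e1 x
  simp_rw [e2]
  have hn1 := lconv_nice σ hg
  apply lm_l2_compare (lD_nice _ hn1) hg _ (by positivity)
  intro ξ
  rw [lD_four _ hn1, lconv_fourier σ hg, ← mul_assoc, norm_mul]
  gcongr
  rw [← Real.sqrt_mul (by positivity)]
  apply Real.le_sqrt_of_sq_le
  rw [norm_mul]
  set d := ‖1 - lmhat (Measure.dirac h) ξ‖ with hd
  have d0 : 0 ≤ d := norm_nonneg _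
  have d1 : d ≤ 2 * Real.pi * ‖h‖ * ‖ξ‖ := lmhat_near _ (by
    rw [ae_dirac_iff (isClosed_le continuous_norm continuous_const).measurableSet]) ξ
  have d2 : d ≤ 2 := lmhat_two _ ξ
  have hs1 := lmhat_le_one σ ξ
  have q : ‖lmhat σ ξ‖ ^ 2 * ‖ξ‖ ≤ C₂ := by
    rcases le_total ‖ξ‖ 1 with hx | hx
    · have : ‖lmhat σ ξ‖ ^ 2 ≤ 1 := pow_le_one₀ (norm_nonneg _) hs1
      have := mul_le_one₀ this (norm_nonneg ξ) hx
      linarith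
    · refine le_trans ?_ (h₂ σ hσ ξ)
      gcongr
      exact le_self_pow₀ hx (by omega)
  calc (d * ‖lmhat σ ξ‖) ^ 2 = ‖lmhat σ ξ‖ ^ 2 * (d * d) := by ring
    _ ≤ ‖lmhat σ ξ‖ ^ 2 * (2 * (2 * Real.pi * ‖h‖ * ‖ξ‖)) := by gcongr
    _ = (‖lmhat σ ξ‖ ^ 2 * ‖ξ‖) * (4 * Real.pi * ‖h‖) := by ring
    _ ≤ C₂ * (4 * Real.pi * ‖h‖) := by gcongr
    _ = _ := by ring

theorem lm_cancel {n : ℕ} (hn : 2 ≤ n) : ∃ C : ℝ, 0 < C ∧ ∀ σ : Measure (Rn n), LRot σ →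
    ∀ b g : Rn n → ℝ, LNice b → LNice g → ∀ l : ℝ, 0 < l → (∀ k, ∫ z in lcell l k, b z = 0) →
      |∫ x, lconv σ b x * g x| ≤ C * √l * (√(∫ x, b x ^ 2) * √(∫ x, g x ^ 2)) := by
  obtain ⟨C₁, hC₁, h₁⟩ := lm_trans hn
  have hn0 : (0:ℝ) < n := by exact_mod_cast (by omega : 0 < n)
  refine ⟨2 ^ n * C₁ * √n, by positivity, fun σ hσ b g hb hg l hl hmean => ?_⟩
  have := hσ.prob
  rw [lconv_adj σ (lrot_neg hσ) hb hg]
  have hH := lconv_nice σ hg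
  have htr := h₁ σ hσ g hg
  set H := lconv σ g with hHdef
  obtain ⟨M, hM⟩ := hH.bdd
  have hM0 : 0 ≤ M := (abs_nonneg _).trans (hM 0)
  set S : Set (Rn n × Rn n) := {p | lidx l p.1 = lidx l p.2} with hS
  have hSm : MeasurableSet S := lidx_set_meas l measurable_fst measurable_snd
  set k : Rn n × Rn n → ℝ := S.indicator 1 with hk
  have hkm : Measurable k := measurable_one.indicator hSm
  have hk0 : ∀ p, 0 ≤ k p := fun p => indicator_nonneg (fun _ _ => zero_le_one) _
  have hkz : ∀ z w, k (z, w) = (lcell l (lidx l z)).indicator 1 w := by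
    intro z w
    by_cases h : lidx l z = lidx l w
    · rw [hk, indicator_of_mem (by exact h), indicator_of_mem (by exact h.symm)]; rfl
    · rw [hk, indicator_of_notMem (by exact h), indicator_of_notMem (by exact fun h' => h h'.symm)]
  have hkw : ∀ z w, k (z, w) = (lcell l (lidx l w)).indicator 1 z := by
    intro z w
    by_cases h : lidx l z = lidx l w
    · rw [hk, indicator_of_mem (by exact h), indicator_of_mem (by exact h)]; rfl
    · rw [hk, indicator_of_notMem (by exact h), indicator_of_notMem (by exact h)]
  have hki : ∀ z, Integrable (fun w => k (z, w)) := by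
    intro z
    simp_rw [hkz]
    exact (integrable_indicator_iff (lcell_meas _ _)).2 (integrableOn_const (by
      rw [lcell_vol hl]; exact ENNReal.ofReal_ne_top))
  have hkint : ∀ z, ∫ w, k (z, w) = l ^ n := by
    intro z
    simp_rw [hkz]
    rw [integral_indicator_one (lcell_meas _ _), measureReal_def, lcell_vol hl,
      ENNReal.toReal_ofReal (by positivity)]
  have hki3 : ∀ z, Integrable (fun h => k (z, z - h)) := fun z => (hki z).comp_sub_left z
  have hkint3 : ∀ z, ∫ h, k (z, z - h) = l ^ n := by
    intro z
    rw [integral_sub_left_eq_self (fun w => k (z, w)) volume z, hkint]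
  have hMb : Integrable (fun z => M * b z) := hb.int.const_mul M
  have hMb2 : Integrable (fun z => (2 * M) * b z) := hb.int.const_mul (2 * M)
  have G1i : Integrable (fun p : Rn n × Rn n => b p.1 * H p.1 * k p) (volume.prod volume) := by
    refine lprod_int (((hb.meas.comp measurable_fst).mul (hH.meas.comp measurable_fst)).mul hkm)
      hki hMb (fun z => (hkint z).le) (fun z w => ?_)
    rw [abs_mul, abs_mul, abs_of_nonneg (hk0 _), abs_mul, abs_of_nonneg hM0, mul_comm M]
    gcongr
    · exact hk0 _
    · exact hM _
  have G2i : Integrable (fun p : Rn n × Rn n => b p.1 * H p.2 * k p) (volume.prod volume) := by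
    refine lprod_int (((hb.meas.comp measurable_fst).mul (hH.meas.comp measurable_snd)).mul hkm)
      hki hMb (fun z => (hkint z).le) (fun z w => ?_)
    rw [abs_mul, abs_mul, abs_of_nonneg (hk0 _), abs_mul, abs_of_nonneg hM0, mul_comm M]
    gcongr
    · exact hk0 _
    · exact hM _
  have hk3m : Measurable (fun p : Rn n × Rn n => k (p.1, p.1 - p.2)) :=
    hkm.comp (measurable_fst.prodMk (measurable_fst.sub measurable_snd))
  have G3i : Integrable (fun p : Rn n × Rn n => b p.1 * (H p.1 - H (p.1 - p.2)) * k (p.1, p.1 - p.2))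
      (volume.prod volume) := by
    refine lprod_int (k := fun p => k (p.1, p.1 - p.2)) (((hb.meas.comp measurable_fst).mul ((hH.meas.comp measurable_fst).sub
      (hH.meas.comp (measurable_fst.sub measurable_snd)))).mul hk3m)
      hki3 hMb2 (fun z => (hkint3 z).le) (fun z w => ?_)
    simp only
    rw [abs_mul, abs_mul, abs_of_nonneg (hk0 _), abs_mul, abs_of_nonneg (by positivity : 0 ≤ 2 * M), mul_comm (2 * M)]
    gcongr
    · exact hk0 _
    · exact (abs_sub _ _).trans (by linarith [hM z, hM (z - w)])
  -- total identity
  have T1 : ∫ z, ∫ w, b z * H z * k (z, w) = l ^ n * ∫ z, b z * H z := by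
    rw [← integral_const_mul]
    congr 1
    funext z
    rw [integral_const_mul, hkint]; ring
  have T2 : ∫ z, ∫ w, b z * H w * k (z, w) = 0 := by
    rw [integral_integral_swap (f := fun z w => b z * H w * k (z, w)) G2i]
    have : ∀ w, ∫ z, b z * H w * k (z, w) = 0 := by
      intro w
      have e : ∀ z, b z * H w * k (z, w) = H w * (lcell l (lidx l w)).indicator b z := by
        intro z
        rw [hkw]
        by_cases h : z ∈ lcell l (lidx l w)
        · simp [indicator_of_mem h]; ring
        · simp [indicator_of_notMem h]
      simp_rw [e]
      rw [integral_const_mul, integral_indicator (lcell_meas _ _), hmean]; ring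
    simp_rw [this]; simp
  have T3 : l ^ n * ∫ z, b z * H z = ∫ h, ∫ z, b z * (H z - H (z - h)) * k (z, z - h) := by
    rw [← integral_integral_swap (f := fun z h => b z * (H z - H (z - h)) * k (z, z - h)) G3i]
    rw [← sub_zero (l ^ n * ∫ z, b z * H z), ← T1, ← T2]
    rw [← integral_sub G1i.integral_prod_left G2i.integral_prod_left]
    apply integral_congr_ae
    filter_upwards [G1i.prod_right_ae, G2i.prod_right_ae] with z h1 h2
    rw [← integral_sub h1 h2, ← integral_sub_left_eq_self _ volume z]
    congr 1
    funext h
    ring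
  set Bx : Set (Rn n) := {h | ∀ i, h i ∈ Icc (-l) l} with hBx
  have hBxm : MeasurableSet Bx := lbox_meas _ fun i => measurableSet_Icc
  have hBxv : (volume : Measure (Rn n)) Bx = ENNReal.ofReal ((2 * l) ^ n) := by
    rw [hBx, lbox_vol _ (fun i => measurableSet_Icc)]
    simp only [Real.volume_Icc, Finset.prod_const, Finset.card_univ, Fintype.card_fin]
    rw [ENNReal.ofReal_pow (by positivity)]
    congr 2; ring
  set X := √(∫ x, b x ^ 2)
  set Y := √(∫ x, g x ^ 2)
  have hX : 0 ≤ X := Real.sqrt_nonneg _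
  have hY : 0 ≤ Y := Real.sqrt_nonneg _
  set W := X * (C₁ * √(n * l) * Y) with hW
  have hW0 : 0 ≤ W := by positivity
  have P : ∀ h, ‖∫ z, b z * (H z - H (z - h)) * k (z, z - h)‖ ≤ Bx.indicator (fun _ => W) h := by
    intro h
    by_cases hh : h ∈ Bx
    · rw [indicator_of_mem hh]
      set Sh : Set (Rn n) := {z | lidx l z = lidx l (z - h)} with hSh
      have hShm : MeasurableSet Sh := lidx_set_meas l measurable_id (measurable_id.sub_const h)
      have e : ∀ z, b z * (H z - H (z - h)) * k (z, z - h) = Sh.indicator b z * (H z - H (z - h)) := by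
        intro z
        by_cases hz : lidx l z = lidx l (z - h)
        · rw [hk, indicator_of_mem (by exact hz), indicator_of_mem (by exact hz)]; simp
        · rw [hk, indicator_of_notMem (by exact hz), indicator_of_notMem (by exact hz)]; simp
      simp_rw [e]
      have hHs : LNice (fun z => H (z - h)) :=
        ⟨hH.meas.comp (measurable_id.sub_const h), ⟨M, fun x => hM _⟩, hH.int.comp_sub_right h⟩
      refine (lm_cs (hb.indicator hShm) (hH.sub hHs)).trans ?_
      rw [hW]
      gcongr
      · apply Real.sqrt_le_sqrt
        refine integral_mono (hb.indicator hShm).sq_int hb.sq_int fun x => ?_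
        simp only
        by_cases hx : x ∈ Sh
        · rw [indicator_of_mem hx]
        · rw [indicator_of_notMem hx]; rw [zero_pow two_ne_zero]; positivity
      · refine (htr h).trans ?_
        gcongr
        apply lbox_norm hl.le
        intro i
        rw [abs_le]; exact hh i
    · rw [indicator_of_notMem hh]
      have : ∀ z, k (z, z - h) = 0 := by
        intro z
        rw [hk, indicator_of_notMem]
        intro hz
        apply hh
        intro i
        have := lidx_close hl (show lidx l z = lidx l (z - h) from hz) i
        rw [PiLp.sub_apply, sub_sub_cancel, abs_le] at this
        exact this
      simp [this]
  have fin : |l ^ n * ∫ z, b z * H z| ≤ (2 * l) ^ n * W := by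
    rw [T3]
    refine (norm_integral_le_of_norm_le ((integrable_indicator_iff hBxm).2 (integrableOn_const (by
      rw [hBxv]; exact ENNReal.ofReal_ne_top))) (Filter.Eventually.of_forall P)).trans ?_
    rw [integral_indicator_const _ hBxm, measureReal_def, hBxv, ENNReal.toReal_ofReal (by positivity)]
    rfl
  rw [abs_mul, abs_of_pos (by positivity : 0 < l ^ n), mul_pow, mul_comm ((2:ℝ) ^ n), mul_assoc] at fin
  refine (le_of_mul_le_mul_left fin (by positivity)).trans (le_of_eq ?_)
  rw [hW, Real.sqrt_mul (by positivity)]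
  ring

theorem lm_interp {L K A G τ v x y : ℝ} (hL : 0 ≤ L) (hK : 0 < K) (hA : 0 < A) (hG : 0 < G)
    (hτ : 0 < τ) (hv : 0 < v) (hx : 0 ≤ x) (hy : 0 ≤ y) {w : ℝ} (hw : 0 ≤ w)
    (hw1 : v * w ≤ x) (hw2 : v * w ≤ y) (hs : x + y - 2 * (v * w) + w < 1)
    (a1 : L ≤ K * A) (a2 : L ≤ K * G) (a3 : L ≤ K * (A * G) ^ v) (a4 : L ≤ K * τ) :
    L ≤ K * A ^ x * G ^ y * τ ^ (1 - (x + y - 2 * (v * w) + w)) := by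
  rcases hL.eq_or_lt with h0 | h0
  · rw [← h0]; positivity
  set w4 := 1 - (x + y - 2 * (v * w) + w) with hw4
  have hL1 : L = L ^ (x - v * w) * L ^ (y - v * w) * L ^ w * L ^ w4 := by
    rw [← Real.rpow_add h0, ← Real.rpow_add h0, ← Real.rpow_add h0]
    have : x - v * w + (y - v * w) + w + w4 = 1 := by rw [hw4]; ring
    rw [this, Real.rpow_one]
  have hK1 : K = K ^ (x - v * w) * K ^ (y - v * w) * K ^ w * K ^ w4 := by
    rw [← Real.rpow_add hK, ← Real.rpow_add hK, ← Real.rpow_add hK]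
    have : x - v * w + (y - v * w) + w + w4 = 1 := by rw [hw4]; ring
    rw [this, Real.rpow_one]
  have b1 := Real.rpow_le_rpow hL a1 (sub_nonneg.2 hw1)
  have b2 := Real.rpow_le_rpow hL a2 (sub_nonneg.2 hw2)
  have b3 := Real.rpow_le_rpow hL a3 hw
  have b4 := Real.rpow_le_rpow hL a4 (by linarith : 0 ≤ w4)
  rw [Real.mul_rpow hK.le (by positivity)] at b1 b2 b3 b4
  rw [← Real.rpow_mul (by positivity), Real.mul_rpow hA.le hG.le] at b3
  have eA : A ^ x = A ^ (x - v * w) * A ^ (v * w) := by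
    rw [← Real.rpow_add hA]; congr 1; ring
  have eG : G ^ y = G ^ (y - v * w) * G ^ (v * w) := by
    rw [← Real.rpow_add hG]; congr 1; ring
  calc L = L ^ (x - v * w) * L ^ (y - v * w) * L ^ w * L ^ w4 := hL1
    _ ≤ (K ^ (x - v * w) * A ^ (x - v * w)) * (K ^ (y - v * w) * G ^ (y - v * w)) *
        (K ^ w * (A ^ (v * w) * G ^ (v * w))) * (K ^ w4 * τ ^ w4) := by gcongr
    _ = (K ^ (x - v * w) * K ^ (y - v * w) * K ^ w * K ^ w4) * A ^ x * G ^ y * τ ^ w4 := by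
        rw [eA, eG]; ring
    _ = _ := by rw [← hK1]

theorem lidx_smul {n : ℕ} {t : ℝ} (ht : 0 < t) (l : ℝ) (z : Rn n) :
    lidx (t * l) (t • z) = lidx l z := by
  funext i
  simp only [lidx, PiLp.smul_apply, smul_eq_mul]
  rw [mul_div_mul_left _ _ ht.ne']

theorem lscale {n : ℕ} (f : Rn n → ℝ) {t : ℝ} (ht : 0 < t) :
    ∫ x, f (t • x) = (t ^ n)⁻¹ * ∫ x, f x := by
  have := Measure.integral_comp_smul_of_nonneg volume f t (hR := ht.le)
  rw [this]
  simp

theorem LNice.smul {n : ℕ} {f : Rn n → ℝ} (hf : LNice f) {t : ℝ} (ht : 0 < t) :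
    LNice (fun x => f (t • x)) := by
  obtain ⟨M, hM⟩ := hf.bdd
  exact ⟨hf.meas.comp (measurable_const_smul t), ⟨M, fun x => hM _⟩,
    (integrable_comp_smul_iff volume f ht.ne').2 hf.int⟩

set_option maxHeartbeats 1600000 in
theorem lm_local1 {n : ℕ} (hn : 2 ≤ n) {x y : ℝ} (hx : 0 < x) (hy : 0 < y)
    (h1 : x + y / n < 1) (h2 : x / n + y < 1) : ∃ C ρ : ℝ, 0 < C ∧ 0 < ρ ∧ ρ < 1 ∧
    ∀ σ : Measure (Rn n), LRot σ → ∀ (b g : Rn n → ℝ) (A G : ℝ) (k : ℕ), LNice b → LNice g →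
      (∀ z, |b z| ≤ 1) → (∀ z, |g z| ≤ 1) → 0 ≤ A → A ≤ 1 → 0 ≤ G → G ≤ 1 →
      ∫ z, |b z| ≤ 2 * 4 ^ n * A → ∫ z, |g z| ≤ 2 * 4 ^ n * G →
      (∀ j, ∫ z in lcell (4 * (1 / 2) ^ k) j, b z = 0) →
      |∫ z, lconv σ b z * g z| ≤ C * ρ ^ k * A ^ x * G ^ y := by
  obtain ⟨C₁, hC₁, H₁⟩ := lm_L1 hn
  obtain ⟨C₂, hC₂, H₂⟩ := lm_cancel hn
  have hn0 : (0:ℝ) < n := by exact_mod_cast (by omega : 0 < n)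
  set v : ℝ := n / (n + 1) with hv
  have hv0 : 0 < v := by positivity
  set w : ℝ := min x y / v with hw
  have hvw : v * w = min x y := by rw [hw]; field_simp
  have hsum : x + y - 2 * (v * w) + w < 1 := by
    have e : w = min x y * (1 + 1 / n) := by rw [hw, hv]; field_simp
    rw [hvw, e]
    rcases le_total x y with h | h
    · rw [min_eq_left h]; have : x * (1 + 1 / n) = x + x / n := by ring
      rw [this]; linarith
    · rw [min_eq_right h]; have : y * (1 + 1 / n) = y + y / n := by ring
      rw [this]; linarith
  set θ := 1 - (x + y - 2 * (v * w) + w) with hθ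
  have hθ0 : 0 < θ := by rw [hθ]; linarith
  set D : ℝ := 2 * 4 ^ n with hD
  have hD1 : 1 ≤ D := by
    have : (1:ℝ) ≤ 4 ^ n := one_le_pow₀ (by norm_num)
    rw [hD]; linarith
  set K : ℝ := D + 2 * C₁ * D ^ 2 + 2 * C₂ * D with hK
  set q : ℝ := √(1 / 2) with hq
  have hq0 : 0 < q := by positivity
  have hq1 : q < 1 := by
    rw [hq, Real.sqrt_lt' one_pos]; norm_num
  refine ⟨K, q ^ θ, by positivity, by positivity, Real.rpow_lt_one hq0.le hq1 hθ0, ?_⟩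
  intro σ hσ b g A G k hb hg hb1 hg1 hA hA1 hG hG1 hbA hgG hmean
  have := hσ.prob
  set L := |∫ z, lconv σ b z * g z| with hLdef
  have hDpos : 0 < D := by positivity
  have l2 : L ≤ D * G := by
    refine (lbil_bound hg (K := 1) (lconv_bdd σ hb1)).trans ?_
    linarith
  have l1 : L ≤ D * A := by
    rw [hLdef, lconv_adj σ (lrot_neg hσ) hb hg]
    have : ∀ z, b z * lconv σ g z = lconv σ g z * b z := fun z => mul_comm _ _
    simp_rw [this]
    refine (lbil_bound hb (K := 1) (lconv_bdd σ hg1)).trans ?_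
    linarith
  have hL0 : 0 ≤ L := abs_nonneg _
  have hKD : D ≤ K := by
    rw [hK]; have : 0 ≤ 2 * C₁ * D ^ 2 := by positivity
    have : 0 ≤ 2 * C₂ * D := by positivity
    linarith
  rcases hA.eq_or_lt with hA0 | hA0
  · rw [← hA0, mul_zero] at l1
    refine l1.trans (by positivity)
  rcases hG.eq_or_lt with hG0 | hG0
  · rw [← hG0, mul_zero] at l2
    refine l2.trans (by positivity)
  have hAG : 0 < A * G := by positivity
  have sqb : ∫ z, b z ^ 2 ≤ D * A := by
    refine le_trans ?_ hbA
    refine integral_mono hb.sq_int hb.int.norm fun z => ?_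
    have := hb1 z
    simp only [Real.norm_eq_abs]
    rw [← sq_abs]
    nlinarith [abs_nonneg (b z)]
  have sqg : ∫ z, g z ^ 2 ≤ D * G := by
    refine le_trans ?_ hgG
    refine integral_mono hg.sq_int hg.int.norm fun z => ?_
    have := hg1 z
    simp only [Real.norm_eq_abs]
    rw [← sq_abs]
    nlinarith [abs_nonneg (g z)]
  have sqbg : √(∫ z, b z ^ 2) * √(∫ z, g z ^ 2) ≤ D * √(A * G) := by
    calc √(∫ z, b z ^ 2) * √(∫ z, g z ^ 2) ≤ √(D * A) * √(D * G) := by gcongr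
      _ = √(D ^ 2 * (A * G)) := by rw [← Real.sqrt_mul (by positivity)]; congr 1; ring
      _ = _ := by rw [Real.sqrt_mul (by positivity), Real.sqrt_sq (by positivity)]
  have l3 : L ≤ K * (A * G) ^ v := by
    set δ := (A * G) ^ (1 / ((n:ℝ) + 1)) with hδ
    have hδ0 : 0 < δ := by positivity
    have e1 : δ⁻¹ * (A * G) = (A * G) ^ v := by
      rw [hδ, ← Real.rpow_neg hAG.le]
      nth_rewrite 2 [← Real.rpow_one (A * G)]
      rw [← Real.rpow_add hAG]
      congr 1
      rw [hv]; field_simp; ring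
    have e2 : √(δ ^ (n - 1)) * √(A * G) = (A * G) ^ v := by
      rw [Real.sqrt_eq_rpow, Real.sqrt_eq_rpow, ← Real.rpow_natCast, hδ, ← Real.rpow_mul hAG.le,
        ← Real.rpow_mul hAG.le, ← Real.rpow_add hAG]
      congr 1
      rw [hv, Nat.cast_sub (by omega)]; field_simp; push_cast; ring
    have := H₁ σ hσ b g hb hg δ hδ0
    refine this.trans ?_
    calc C₁ * (δ⁻¹ * (∫ z, |b z|) * (∫ z, |g z|) + √(δ ^ (n - 1)) * (√(∫ z, b z ^ 2) * √(∫ z, g z ^ 2)))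
        ≤ C₁ * (δ⁻¹ * (D * A) * (D * G) + √(δ ^ (n - 1)) * (D * √(A * G))) := by gcongr
      _ = C₁ * (D ^ 2 * (δ⁻¹ * (A * G)) + D * (√(δ ^ (n - 1)) * √(A * G))) := by ring
      _ = C₁ * (D ^ 2 + D) * (A * G) ^ v := by rw [e1, e2]; ring
      _ ≤ K * (A * G) ^ v := by
          gcongr
          rw [hK]
          have : C₁ * D ≤ C₁ * D ^ 2 := by gcongr; nlinarith
          have : 0 ≤ 2 * C₂ * D := by positivity
          nlinarith
  have l4 : L ≤ K * q ^ k := by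
    have h := H₂ σ hσ b g hb hg _ (by positivity) hmean
    refine h.trans ?_
    have e : √(4 * (1 / 2) ^ k) = 2 * q ^ k := by
      rw [Real.sqrt_mul (by norm_num), show (4:ℝ) = 2 ^ 2 by norm_num, Real.sqrt_sq (by norm_num), hq]
      congr 1
      rw [Real.sqrt_eq_rpow, Real.sqrt_eq_rpow, ← Real.rpow_natCast, ← Real.rpow_natCast,
        ← Real.rpow_mul (by norm_num), ← Real.rpow_mul (by norm_num), mul_comm]
    rw [e]
    have hs1 : √(A * G) ≤ 1 := by
      rw [Real.sqrt_le_iff]; refine ⟨zero_le_one, ?_⟩; rw [one_pow]; exact mul_le_one₀ hA1 hG hG1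
    calc C₂ * (2 * q ^ k) * (√(∫ z, b z ^ 2) * √(∫ z, g z ^ 2)) ≤ C₂ * (2 * q ^ k) * (D * 1) := by
          refine mul_le_mul_of_nonneg_left (sqbg.trans ?_) (by positivity)
          exact mul_le_mul_of_nonneg_left hs1 (by positivity)
      _ = (2 * C₂ * D) * q ^ k := by ring
      _ ≤ _ := by
          gcongr
          rw [hK]
          have : 0 ≤ 2 * C₁ * D ^ 2 := by positivity
          linarith
  have l1' : L ≤ K * A := l1.trans (by gcongr)
  have l2' : L ≤ K * G := l2.trans (by gcongr)
  have := lm_interp hL0 (by positivity) hA0 hG0 (by positivity) hv0 hx.le hy.le (w := w) (by positivity)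
    (by rw [hvw]; exact min_le_left _ _) (by rw [hvw]; exact min_le_right _ _) hsum l1' l2' l3 l4
  refine this.trans (le_of_eq ?_)
  rw [← hθ]
  have : (q ^ k) ^ θ = (q ^ θ) ^ k := by
    rw [← Real.rpow_natCast, ← Real.rpow_natCast, ← Real.rpow_mul hq0.le, ← Real.rpow_mul hq0.le, mul_comm]
  rw [this]; ring

theorem lm_local {n : ℕ} (hn : 2 ≤ n) {x y : ℝ} (hx : 0 < x) (hy : 0 < y)
    (h1 : x + y / n < 1) (h2 : x / n + y < 1) : ∃ C ρ : ℝ, 0 < C ∧ 0 < ρ ∧ ρ < 1 ∧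
    ∀ σ : Measure (Rn n), LRot σ → ∀ (b : Rn n → ℝ) (E : Set (Rn n)) (l A G : ℝ) (k : ℕ), LNice b →
      (∀ z, |b z| ≤ 1) → MeasurableSet E → volume E ≠ ∞ → 0 < l → 0 ≤ A → A ≤ 1 → 0 ≤ G → G ≤ 1 →
      ∫ z, |b z| ≤ 2 * A * l ^ n → volume.real E ≤ G * l ^ n →
      (∀ j, ∫ z in lcell (l * (1 / 2) ^ k) j, b z = 0) →
      |∫ z in E, ∫ u, b (z - (l / 4) • u) ∂σ| ≤ C * ρ ^ k * l ^ n * A ^ x * G ^ y := by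
  obtain ⟨C, ρ, hC, hρ, hρ1, H⟩ := lm_local1 hn hx hy h1 h2
  refine ⟨C, ρ, hC, hρ, hρ1, ?_⟩
  intro σ hσ b E l A G k hb hb1 hE hEf hl hA hA1 hG hG1 hbA hgG hmean
  set t := l / 4 with ht
  have ht0 : 0 < t := by positivity
  have hlt : l = 4 * t := by rw [ht]; ring
  have hgn : LNice (E.indicator (1 : Rn n → ℝ)) := by
    refine ⟨measurable_one.indicator hE, ⟨1, fun z => ?_⟩, ?_⟩
    · by_cases hz : z ∈ E
      · simp [hz]
      · simp [hz]
    · exact (integrable_indicator_iff hE).2 (integrableOn_const hEf)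
  have hg1 : ∀ z, |E.indicator (1 : Rn n → ℝ) z| ≤ 1 := by
    intro z
    by_cases hz : z ∈ E
    · simp [hz]
    · simp [hz]
  have key := H σ hσ (fun z => b (t • z)) (fun z => E.indicator 1 (t • z)) A G k (hb.smul ht0)
    (hgn.smul ht0) (fun z => hb1 _) (fun z => hg1 _) hA hA1 hG hG1 ?_ ?_ ?_
  · have e : ∀ z, lconv σ (fun z => b (t • z)) z * E.indicator 1 (t • z)
        = (fun z => (∫ u, b (z - t • u) ∂σ) * E.indicator 1 z) (t • z) := by
      intro z
      simp only [lconv, smul_sub]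
    simp_rw [e] at key
    rw [lscale (fun z => (∫ u, b (z - t • u) ∂σ) * E.indicator 1 z) ht0] at key
    have e2 : ∫ z, (∫ u, b (z - t • u) ∂σ) * E.indicator 1 z = ∫ z in E, ∫ u, b (z - t • u) ∂σ := by
      rw [← integral_indicator hE]
      congr 1
      funext z
      by_cases hz : z ∈ E
      · simp [hz]
      · simp [hz]
    rw [e2, abs_mul, abs_of_pos (by positivity : 0 < (t ^ n)⁻¹), inv_mul_le_iff₀ (by positivity)] at key
    refine key.trans ?_
    have : t ^ n ≤ l ^ n := by gcongr; linarith
    calc t ^ n * (C * ρ ^ k * A ^ x * G ^ y) ≤ l ^ n * (C * ρ ^ k * A ^ x * G ^ y) := by gcongr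
      _ = _ := by ring
  · rw [lscale (fun z => |b z|) ht0, inv_mul_le_iff₀ (by positivity)]
    refine hbA.trans (le_of_eq ?_)
    rw [hlt, mul_pow]; ring
  · rw [lscale (fun z => |E.indicator (1 : Rn n → ℝ) z|) ht0, inv_mul_le_iff₀ (by positivity)]
    have e : ∀ z, |E.indicator (1 : Rn n → ℝ) z| = E.indicator 1 z := fun z =>
      abs_of_nonneg (indicator_nonneg (fun _ _ => zero_le_one) _)
    simp_rw [e]
    rw [integral_indicator_one hE]
    refine hgG.trans ?_
    rw [hlt, mul_pow]
    have : 0 ≤ G * (4 ^ n * t ^ n) := by positivity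
    linarith
  · intro j
    have hm := hmean j
    rw [← integral_indicator (lcell_meas _ _)] at hm ⊢
    have e : ∀ z, (lcell (4 * (1 / 2) ^ k) j).indicator (fun z => b (t • z)) z
        = (fun z => (lcell (l * (1 / 2) ^ k) j).indicator b z) (t • z) := by
      intro z
      have : t • z ∈ lcell (l * (1 / 2) ^ k) j ↔ z ∈ lcell (4 * (1 / 2) ^ k) j := by
        simp only [lcell, mem_setOf_eq]
        rw [show l * (1 / 2) ^ k = t * (4 * (1 / 2) ^ k) by rw [hlt]; ring, lidx_smul ht0]
      by_cases hz : z ∈ lcell (4 * (1 / 2) ^ k) j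
      · simp only [indicator_of_mem hz, indicator_of_mem (this.2 hz)]
      · simp only [indicator_of_notMem hz, indicator_of_notMem (fun h => hz (this.1 h))]
    simp_rw [e]
    rw [lscale (fun z => (lcell (l * (1 / 2) ^ k) j).indicator b z) ht0, hm, mul_zero]

noncomputable def dI {n : ℕ} (m : ℤ) (z : Rn n) : Fin n → ℤ := lidx ((2:ℝ) ^ m) z

def dC {n : ℕ} (m : ℤ) (j : Fin n → ℤ) : Set (Rn n) := {z | dI m z = j}

theorem dC_eq {n : ℕ} (m : ℤ) (j : Fin n → ℤ) : dC m j = lcell ((2:ℝ) ^ m) j := rfl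

theorem dC_meas {n : ℕ} (m : ℤ) (j : Fin n → ℤ) : MeasurableSet (dC m j) := lcell_meas _ _

theorem dC_vol {n : ℕ} (m : ℤ) (j : Fin n → ℤ) : volume.real (dC m j) = ((2:ℝ) ^ m) ^ n := by
  rw [dC_eq, Measure.real, lcell_vol (by positivity), ENNReal.toReal_ofReal (by positivity)]

theorem dC_fin {n : ℕ} (m : ℤ) (j : Fin n → ℤ) : volume (dC m j) ≠ ∞ := by
  rw [dC_eq, lcell_vol (by positivity)]; exact ENNReal.ofReal_ne_top

theorem dI_succ {n : ℕ} (m : ℤ) (z : Rn n) : dI (m + 1) z = fun i => dI m z i / 2 := by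
  funext i
  simp only [dI, lidx]
  rw [zpow_add₀ (by norm_num), zpow_one, ← div_div]
  exact_mod_cast Int.floor_div_natCast (z i / 2 ^ m) 2

theorem dI_mono {n : ℕ} {m m' : ℤ} (h : m ≤ m') {z w : Rn n} (hz : dI m z = dI m w) :
    dI m' z = dI m' w := by
  induction m', h using Int.le_induction with
  | base => exact hz
  | succ k hk ih => rw [dI_succ, dI_succ, ih]

theorem dI_meas {n : ℕ} (m : ℤ) : Measurable (dI (n := n) m) := lidx_meas _

noncomputable def dA {n : ℕ} (m : ℤ) (h : Rn n → ℝ) (x : Rn n) : ℝ :=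
  (((2:ℝ) ^ m) ^ n)⁻¹ * ∫ z in dC m (dI m x), h z

theorem dA_meas {n : ℕ} (m : ℤ) (h : Rn n → ℝ) : Measurable (dA m h) := by
  have : dA m h = (fun j => (((2:ℝ) ^ m) ^ n)⁻¹ * ∫ z in dC m j, h z) ∘ dI m := rfl
  rw [this]
  exact (measurable_of_countable _).comp (dI_meas m)

theorem dh_int {n : ℕ} {h : Rn n → ℝ} (hm : Measurable h) (h0 : ∀ x, 0 ≤ h x) (h1 : ∀ x, h x ≤ 1)
    {V : Set (Rn n)} (hV : volume V ≠ ∞) : IntegrableOn h V := by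
  refine Measure.integrableOn_of_bounded (M := 1) hV hm.aestronglyMeasurable ?_
  exact Filter.Eventually.of_forall fun x => by
    rw [Real.norm_eq_abs, abs_of_nonneg (h0 x)]; exact h1 x

theorem dA_nonneg {n : ℕ} (m : ℤ) {h : Rn n → ℝ} (h0 : ∀ x, 0 ≤ h x) (x : Rn n) : 0 ≤ dA m h x := by
  have : 0 ≤ ∫ z in dC m (dI m x), h z := integral_nonneg h0
  unfold dA; positivity

theorem dA_le {n : ℕ} (m : ℤ) {h : Rn n → ℝ} {B : ℝ} (x : Rn n)
    (hB : ∫ z in dC m (dI m x), h z ≤ B * ((2:ℝ) ^ m) ^ n) : dA m h x ≤ B := by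
  unfold dA
  rw [inv_mul_le_iff₀ (by positivity)]
  linarith

theorem dA_le_one {n : ℕ} (m : ℤ) {h : Rn n → ℝ} (hm : Measurable h) (h0 : ∀ x, 0 ≤ h x)
    (h1 : ∀ x, h x ≤ 1) (x : Rn n) : dA m h x ≤ 1 := by
  apply dA_le
  calc ∫ z in dC m (dI m x), h z ≤ ∫ z in dC m (dI m x), (1:ℝ) :=
        setIntegral_mono (dh_int hm h0 h1 (dC_fin _ _)) (integrableOn_const (dC_fin _ _)) h1
    _ = _ := by simp [dC_vol]

theorem dcells_le {n : ℕ} (m : ℤ) {f g : Rn n → ℝ} (hf : Integrable f) (hg : Integrable g)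
    (h : ∀ j, ∫ z in dC m j, f z ≤ ∫ z in dC m j, g z) : ∫ z, f z ≤ ∫ z, g z := by
  have hu : ⋃ j : Fin n → ℤ, dC m j = univ := by
    ext z; simp [dC]
  have hd : Pairwise (Function.onFun Disjoint (dC (n := n) m)) := by
    intro i j hij
    rw [Function.onFun, Set.disjoint_left]
    intro z hz hz'
    exact hij (hz.symm.trans hz')
  have e1 := hasSum_integral_iUnion (f := f) (μ := volume) (fun j => dC_meas (n := n) m j) hd hf.integrableOn
  have e2 := hasSum_integral_iUnion (f := g) (μ := volume) (fun j => dC_meas (n := n) m j) hd hg.integrableOn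
  rw [hu, setIntegral_univ] at e1 e2
  exact hasSum_le h e1 e2

noncomputable def dB {n : ℕ} (m : ℤ) (V : Set (Rn n)) (h : Rn n → ℝ) : Rn n → ℝ :=
  V.indicator fun x => h x - dA m h x

section
variable {n : ℕ} {m : ℤ} {V : Set (Rn n)} {h : Rn n → ℝ}

theorem dB_bd (hm : Measurable h) (h0 : ∀ x, 0 ≤ h x) (h1 : ∀ x, h x ≤ 1) (x : Rn n) :
    |dB m V h x| ≤ 1 := by
  unfold dB
  by_cases hx : x ∈ V
  · rw [indicator_of_mem hx, abs_le]
    have := h0 x; have := h1 x; have := dA_nonneg m h0 x; have := dA_le_one m hm h0 h1 x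
    constructor <;> linarith
  · simp [indicator_of_notMem hx]

theorem lnice_of_bdd {f : Rn n → ℝ} {K : ℝ} (hV : MeasurableSet V) (hVf : volume V ≠ ∞)
    (hf : Measurable f) (hK : ∀ x, |f x| ≤ K) (h : ∀ x ∉ V, f x = 0) : LNice f := by
  refine ⟨hf, ⟨K, hK⟩, ?_⟩
  have : f = V.indicator f := by
    funext x
    by_cases hx : x ∈ V
    · rw [indicator_of_mem hx]
    · rw [indicator_of_notMem hx, h x hx]
  rw [this, integrable_indicator_iff hV]
  exact Measure.integrableOn_of_bounded hVf hf.aestronglyMeasurable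
    (Filter.Eventually.of_forall fun x => by rw [Real.norm_eq_abs]; exact hK x)

theorem dB_nice (hV : MeasurableSet V) (hVf : volume V ≠ ∞) (hm : Measurable h)
    (h0 : ∀ x, 0 ≤ h x) (h1 : ∀ x, h x ≤ 1) : LNice (dB m V h) :=
  lnice_of_bdd hV hVf ((hm.sub (dA_meas m h)).indicator hV) (dB_bd hm h0 h1)
    fun _ hx => indicator_of_notMem hx _

theorem dA_cell (j : Fin n → ℤ) : ∫ z in dC m j, dA m h z = ∫ z in dC m j, h z := by
  have : ∀ z ∈ dC m j, dA m h z = (((2:ℝ) ^ m) ^ n)⁻¹ * ∫ z in dC m j, h z := by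
    intro z hz
    unfold dA
    rw [show dI m z = j from hz]
  rw [setIntegral_congr_fun (dC_meas m j) this, setIntegral_const, dC_vol, smul_eq_mul, ← mul_assoc,
    mul_inv_cancel₀ (by positivity), one_mul]

theorem dcell_dich (hVi : ∀ x x', dI m x = dI m x' → x ∈ V → x' ∈ V) (j : Fin n → ℤ) :
    (∀ z ∈ dC m j, z ∈ V) ∨ (∀ z ∈ dC m j, z ∉ V) := by
  by_cases hh : ∃ z ∈ dC m j, z ∈ V
  · obtain ⟨z, hz, hzV⟩ := hh
    left
    intro w hw
    exact hVi z w (hz.trans hw.symm) hzV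
  · right
    push Not at hh
    exact hh

theorem dA_intOn (hm : Measurable h) (h0 : ∀ x, 0 ≤ h x) (h1 : ∀ x, h x ≤ 1) (hVf : volume V ≠ ∞) :
    IntegrableOn (dA m h) V :=
  dh_int (dA_meas m h) (dA_nonneg m h0) (dA_le_one m hm h0 h1) hVf

theorem dB_mean (hVi : ∀ x x', dI m x = dI m x' → x ∈ V → x' ∈ V) (hm : Measurable h)
    (h0 : ∀ x, 0 ≤ h x) (h1 : ∀ x, h x ≤ 1) (j : Fin n → ℤ) : ∫ z in dC m j, dB m V h z = 0 := by
  rcases dcell_dich hVi j with hh | hh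
  · rw [setIntegral_congr_fun (g := fun x => h x - dA m h x) (dC_meas m j)
      (fun z hz => indicator_of_mem (hh z hz) _)]
    rw [integral_sub (dh_int hm h0 h1 (dC_fin _ _)) (dA_intOn hm h0 h1 (dC_fin _ _)), dA_cell, sub_self]
  · rw [setIntegral_congr_fun (f := dB m V h) (g := fun x => (0:ℝ)) (dC_meas m j)
      (fun z hz => indicator_of_notMem (hh z hz) _)]
    simp

theorem dB_l1 (hV : MeasurableSet V) (hVf : volume V ≠ ∞)
    (hVi : ∀ x x', dI m x = dI m x' → x ∈ V → x' ∈ V) (hm : Measurable h)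
    (h0 : ∀ x, 0 ≤ h x) (h1 : ∀ x, h x ≤ 1) : ∫ z, |dB m V h z| ≤ 2 * ∫ z in V, h z := by
  rw [← integral_indicator hV, ← integral_const_mul]
  apply dcells_le m (dB_nice hV hVf hm h0 h1).int.abs
  · exact (((integrable_indicator_iff hV).2 (dh_int hm h0 h1 hVf))).const_mul 2
  intro j
  rcases dcell_dich hVi j with hh | hh
  · rw [setIntegral_congr_fun (f := fun z => 2 * V.indicator h z) (g := fun x => h x + h x) (dC_meas m j)
      (fun z hz => by simp only [indicator_of_mem (hh z hz)]; ring)]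
    have i1 := dh_int hm h0 h1 (dC_fin m j)
    have i2 := dA_intOn (m := m) hm h0 h1 (dC_fin m j)
    calc ∫ z in dC m j, |dB m V h z| ≤ ∫ z in dC m j, (h z + dA m h z) := by
          refine setIntegral_mono (dB_nice hV hVf hm h0 h1).int.abs.integrableOn (i1.add i2) fun z => ?_
          have := h0 z; have := dA_nonneg m h0 z
          simp only [dB]
          by_cases hz : z ∈ V
          · rw [indicator_of_mem hz, abs_le]; constructor <;> linarith
          · rw [indicator_of_notMem hz, abs_zero]; linarith
      _ = _ := by rw [integral_add i1 i2, integral_add i1 i1, dA_cell]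
  · rw [setIntegral_congr_fun (g := fun x => 0) (dC_meas m j)
      (fun z hz => by simp [dB, indicator_of_notMem (hh z hz)])]
    rw [setIntegral_congr_fun (f := fun z => 2 * V.indicator h z) (g := fun x => 0) (dC_meas m j)
      (fun z hz => by simp [indicator_of_notMem (hh z hz)])]

end

def dU {n : ℕ} (S : Finset (ℤ × (Fin n → ℤ))) (m : ℤ) : Set (Rn n) :=
  {x | ∃ p ∈ S, p.1 ≤ m ∧ ∃ z ∈ dC p.1 p.2, dI m x = dI m z}

def dW {n : ℕ} (S : Finset (ℤ × (Fin n → ℤ))) (m : ℤ) : Set (Rn n) := dU S (m + 1) \ dU S m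

section
variable {n : ℕ} {S : Finset (ℤ × (Fin n → ℤ))}

theorem dU_meas (m : ℤ) : MeasurableSet (dU S m) := by
  have : dU S m = dI m ⁻¹' {j | ∃ p ∈ S, p.1 ≤ m ∧ ∃ z ∈ dC p.1 p.2, j = dI m z} := rfl
  rw [this]
  exact dI_meas m (Set.to_countable _).measurableSet

theorem dW_meas (m : ℤ) : MeasurableSet (dW S m) := (dU_meas _).diff (dU_meas _)

theorem dU_inv {m m' : ℤ} (h : m ≤ m') {x x' : Rn n} (hx : dI m x = dI m x') (hU : x ∈ dU S m') :
    x' ∈ dU S m' := by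
  obtain ⟨p, hp, hpm, z, hz, e⟩ := hU
  exact ⟨p, hp, hpm, z, hz, (dI_mono h hx).symm.trans e⟩

theorem dW_inv {m : ℤ} {x x' : Rn n} (hx : dI m x = dI m x') (hU : x ∈ dW S m) : x' ∈ dW S m :=
  ⟨dU_inv (by omega) hx hU.1, fun h => hU.2 (dU_inv le_rfl hx.symm h)⟩

theorem dU_mono {m m' : ℤ} (h : m ≤ m') : dU S m ⊆ dU S m' := by
  rintro x ⟨p, hp, hpm, z, hz, e⟩
  exact ⟨p, hp, hpm.trans h, z, hz, dI_mono h e⟩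

theorem dU_cell {p : ℤ × (Fin n → ℤ)} (hp : p ∈ S) : dC p.1 p.2 ⊆ dU S p.1 :=
  fun x hx => ⟨p, hp, le_rfl, x, hx, rfl⟩

theorem dU_empty {m : ℤ} (h : ∀ p ∈ S, m < p.1) : dU S m = ∅ := by
  ext x
  simp only [mem_empty_iff_false, iff_false]
  rintro ⟨p, hp, hpm, _⟩
  have := h p hp
  omega

theorem dW_disj {m m' : ℤ} (h : m ≠ m') : Disjoint (dW S m) (dW S m') := by
  rw [Set.disjoint_left]
  rintro x ⟨h1, h2⟩ ⟨h3, h4⟩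
  rcases lt_or_gt_of_ne h with hh | hh
  · exact h4 (dU_mono (by omega) h1)
  · exact h2 (dU_mono (by omega) h3)

theorem dW_sum {p : ℤ × (Fin n → ℤ)} (hp : p ∈ S) {N : ℕ} (hN : ∀ p' ∈ S, p.1 - N < p'.1) (x : Rn n) :
    ∑ k ∈ Finset.range N, (dC p.1 p.2 ∩ dW S (p.1 - (k + 1 : ℕ))).indicator (1 : Rn n → ℝ) x
      = (dC p.1 p.2).indicator 1 x := by
  by_cases hx : x ∈ dC p.1 p.2
  · have e : ∀ k : ℕ, (dC p.1 p.2 ∩ dW S (p.1 - (k + 1 : ℕ))).indicator (1 : Rn n → ℝ) x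
        = (fun k : ℕ => -(dU S (p.1 - k)).indicator (1 : Rn n → ℝ) x) (k + 1)
          - (fun k : ℕ => -(dU S (p.1 - k)).indicator (1 : Rn n → ℝ) x) k := by
      intro k
      have e0 : p.1 - ((k + 1 : ℕ) : ℤ) + 1 = p.1 - k := by push_cast; ring
      have hmono : dU S (p.1 - ((k + 1 : ℕ) : ℤ)) ⊆ dU S (p.1 - k) := dU_mono (by push_cast; omega)
      by_cases h1 : x ∈ dU S (p.1 - ((k + 1 : ℕ) : ℤ))
      · have h2 := hmono h1
        have h3 : x ∉ dC p.1 p.2 ∩ dW S (p.1 - (k + 1 : ℕ)) := fun h => h.2.2 h1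
        simp only [indicator_of_mem h1, indicator_of_mem h2, indicator_of_notMem h3]; simp
      · by_cases h2 : x ∈ dU S (p.1 - k)
        · have h3 : x ∈ dC p.1 p.2 ∩ dW S (p.1 - (k + 1 : ℕ)) := ⟨hx, by rw [dW, e0]; exact ⟨h2, h1⟩⟩
          simp only [indicator_of_notMem h1, indicator_of_mem h2, indicator_of_mem h3]; simp
        · have h3 : x ∉ dC p.1 p.2 ∩ dW S (p.1 - (k + 1 : ℕ)) := fun h => h2 (by
            have := h.2.1; rwa [e0] at this)
          simp only [indicator_of_notMem h1, indicator_of_notMem h2, indicator_of_notMem h3]; simp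
    rw [Finset.sum_congr rfl fun k _ => e k,
      Finset.sum_range_sub (fun k : ℕ => -(dU S (p.1 - k)).indicator (1 : Rn n → ℝ) x)]
    have : dU S (p.1 - N) = ∅ := dU_empty hN
    simp only [this, indicator_empty, Nat.cast_zero, sub_zero, indicator_of_mem (dU_cell hp hx),
      indicator_of_mem hx]
    simp
  · rw [indicator_of_notMem hx]
    apply Finset.sum_eq_zero
    intro k _
    exact indicator_of_notMem (fun h => hx h.1) _

end

theorem lsplit {n : ℕ} (μ : Measure (Rn n)) [IsProbabilityMeasure μ] {h g : Rn n → ℝ} {N : ℕ}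
    {b : ℕ → Rn n → ℝ} (hh : LNice h) (hg : LNice g) (hb : ∀ k, LNice (b k)) {B : ℝ}
    (hgB : ∀ x, |g x| ≤ B) (e : ∀ x, h x = g x + ∑ k ∈ Finset.range N, b k x)
    {E : Set (Rn n)} (hE : MeasurableSet E) (hEf : volume E ≠ ∞) :
    ∫ z in E, lconv μ h z ≤ B * volume.real E + ∑ k ∈ Finset.range N, |∫ z in E, lconv μ (b k) z| := by
  have e1 : ∀ z, lconv μ h z = lconv μ g z + ∑ k ∈ Finset.range N, lconv μ (b k) z := by
    intro z
    simp only [lconv]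
    simp_rw [e]
    rw [integral_add (lslice_int μ hg z) (integrable_finset_sum _ fun k _ => lslice_int μ (hb k) z),
      integral_finset_sum _ fun k _ => lslice_int μ (hb k) z]
  simp_rw [e1]
  rw [integral_add (lconv_nice μ hg).int.integrableOn
    (integrable_finset_sum _ fun k _ => (lconv_nice μ (hb k)).int.integrableOn),
    integral_finset_sum _ fun k _ => (lconv_nice μ (hb k)).int.integrableOn]
  refine add_le_add ?_ (Finset.sum_le_sum fun k _ => le_abs_self _)
  calc ∫ z in E, lconv μ g z ≤ ∫ z in E, B := by
        refine setIntegral_mono (lconv_nice μ hg).int.integrableOn (integrableOn_const hEf) fun z => ?_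
        exact (le_abs_self _).trans (lconv_bdd μ hgB z)
    _ = _ := by simp [mul_comm]

theorem lconv_smulmap {n : ℕ} (σ : Measure (Rn n)) (t : ℝ) {f : Rn n → ℝ} (hf : Measurable f) (z : Rn n) :
    lconv (σ.map (fun u => t • u)) f z = ∫ u, f (z - t • u) ∂σ := by
  unfold lconv
  rw [integral_map (by fun_prop)]
  exact (hf.comp (by fun_prop)).aestronglyMeasurable

/-- per cube decomposition -/
theorem lm_cube {n : ℕ} {S : Finset (ℤ × (Fin n → ℤ))} (σ : Measure (Rn n)) [IsProbabilityMeasure σ]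
    {p : ℤ × (Fin n → ℤ)} (hp : p ∈ S) {N : ℕ} (hN : ∀ p' ∈ S, p.1 - N < p'.1) {h : Rn n → ℝ}
    (hm : Measurable h) (h0 : ∀ x, 0 ≤ h x) (h1 : ∀ x, h x ≤ 1) (hs : ∀ x ∉ dC p.1 p.2, h x = 0)
    {B : ℝ} (hB0 : 0 ≤ B)
    (hB : ∀ m < p.1, ∀ x ∈ dC p.1 p.2 ∩ dW S m, dA m h x ≤ B) {E : Set (Rn n)}
    (hE : MeasurableSet E) (hEf : volume E ≠ ∞) (t : ℝ) :
    ∫ z in E, ∫ u, h (z - t • u) ∂σ ≤ B * volume.real E + ∑ k ∈ Finset.range N,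
      |∫ z in E, ∫ u, dB (p.1 - (k + 1 : ℕ)) (dC p.1 p.2 ∩ dW S (p.1 - (k + 1 : ℕ))) h (z - t • u) ∂σ| := by
  have hprob : IsProbabilityMeasure (σ.map (fun u => t • u)) :=
    Measure.isProbabilityMeasure_map (by fun_prop)
  have hVm : ∀ k : ℕ, MeasurableSet (dC p.1 p.2 ∩ dW S (p.1 - (k + 1 : ℕ))) := fun k =>
    (dC_meas _ _).inter (dW_meas _)
  have hVf : ∀ k : ℕ, volume (dC p.1 p.2 ∩ dW S (p.1 - (k + 1 : ℕ))) ≠ ∞ := fun k =>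
    ((measure_mono inter_subset_left).trans_lt (dC_fin p.1 p.2).lt_top).ne
  have hb : ∀ k : ℕ, LNice (dB (p.1 - (k + 1 : ℕ)) (dC p.1 p.2 ∩ dW S (p.1 - (k + 1 : ℕ))) h) :=
    fun k => dB_nice (hVm k) (hVf k) hm h0 h1
  have hh : LNice h := lnice_of_bdd (dC_meas p.1 p.2) (dC_fin _ _) hm
    (fun x => by rw [abs_of_nonneg (h0 x)]; exact h1 x) hs
  have hgm : Measurable fun x => ∑ k ∈ Finset.range N,
      (dC p.1 p.2 ∩ dW S (p.1 - (k + 1 : ℕ))).indicator (dA (p.1 - (k + 1 : ℕ)) h) x :=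
    Finset.measurable_sum _ fun k _ => (dA_meas _ _).indicator (hVm k)
  have hgB : ∀ x, |∑ k ∈ Finset.range N,
      (dC p.1 p.2 ∩ dW S (p.1 - (k + 1 : ℕ))).indicator (dA (p.1 - (k + 1 : ℕ)) h) x| ≤ B := by
    intro x
    rw [abs_of_nonneg (Finset.sum_nonneg fun k _ => indicator_nonneg (fun x _ => dA_nonneg _ h0 x) x)]
    calc _ ≤ ∑ k ∈ Finset.range N,
          B * (dC p.1 p.2 ∩ dW S (p.1 - (k + 1 : ℕ))).indicator (1 : Rn n → ℝ) x := by
          refine Finset.sum_le_sum fun k _ => ?_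
          by_cases hx : x ∈ dC p.1 p.2 ∩ dW S (p.1 - (k + 1 : ℕ))
          · rw [indicator_of_mem hx, indicator_of_mem hx, Pi.one_apply, mul_one]
            exact hB _ (by push_cast; omega) x hx
          · rw [indicator_of_notMem hx, indicator_of_notMem hx, mul_zero]
      _ = B * (dC p.1 p.2).indicator 1 x := by rw [← Finset.mul_sum, dW_sum hp hN]
      _ ≤ B * 1 := by
          refine mul_le_mul_of_nonneg_left ?_ hB0
          by_cases hx : x ∈ dC p.1 p.2 <;> simp [hx]
      _ = B := mul_one B
  have hg : LNice fun x => ∑ k ∈ Finset.range N,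
      (dC p.1 p.2 ∩ dW S (p.1 - (k + 1 : ℕ))).indicator (dA (p.1 - (k + 1 : ℕ)) h) x := by
    refine lnice_of_bdd (dC_meas p.1 p.2) (dC_fin _ _) hgm hgB fun x hx => ?_
    exact Finset.sum_eq_zero fun k _ => indicator_of_notMem (fun h => hx h.1) _
  have key := lsplit (σ.map (fun u => t • u)) hh hg hb hgB (N := N) (fun x => by
    rw [← Finset.sum_add_distrib]
    have : ∀ k ∈ Finset.range N,
        (dC p.1 p.2 ∩ dW S (p.1 - (k + 1 : ℕ))).indicator (dA (p.1 - (k + 1 : ℕ)) h) x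
        + dB (p.1 - (k + 1 : ℕ)) (dC p.1 p.2 ∩ dW S (p.1 - (k + 1 : ℕ))) h x
        = (dC p.1 p.2 ∩ dW S (p.1 - (k + 1 : ℕ))).indicator (1 : Rn n → ℝ) x * h x := by
      intro k _
      unfold dB
      by_cases hx : x ∈ dC p.1 p.2 ∩ dW S (p.1 - (k + 1 : ℕ))
      · simp only [indicator_of_mem hx, Pi.one_apply]; ring
      · simp only [indicator_of_notMem hx]; ring
    rw [Finset.sum_congr rfl this, ← Finset.sum_mul, dW_sum hp hN]
    by_cases hx : x ∈ dC p.1 p.2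
    · simp [hx]
    · simp [hx, hs x hx]) hE hEf
  simp_rw [lconv_smulmap σ t hm] at key
  have e3 : ∀ k : ℕ, ∀ z, lconv (σ.map (fun u => t • u))
      (dB (p.1 - (k + 1 : ℕ)) (dC p.1 p.2 ∩ dW S (p.1 - (k + 1 : ℕ))) h) z
      = ∫ u, dB (p.1 - (k + 1 : ℕ)) (dC p.1 p.2 ∩ dW S (p.1 - (k + 1 : ℕ))) h (z - t • u) ∂σ :=
    fun k z => lconv_smulmap σ t (hb k).meas z
  simp_rw [e3] at key
  exact key

theorem lm_pt {a g α γ K x y : ℝ} (ha : 0 ≤ a) (hg : 0 ≤ g) (hα : 0 < α) (hγ : 0 < γ) (hK : 0 < K)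
    (haK : a ≤ K * α) (hxy : 1 ≤ x + y) (hy0 : 0 < y) (hy1 : y < 1) :
    a ^ x * g ^ y ≤ K ^ (x + y - 1) * (α ^ x * γ ^ y) * (a / α + g / γ) := by
  have e1 : a ^ x = a ^ (x + y - 1) * a ^ (1 - y) := by
    rw [← Real.rpow_add_of_nonneg ha (by linarith) (by linarith)]; congr 1; ring
  have e2 : α ^ x = α ^ (x + y - 1) * α ^ (1 - y) := by
    rw [← Real.rpow_add hα]; congr 1; ring
  have h1 : a ^ (x + y - 1) ≤ K ^ (x + y - 1) * α ^ (x + y - 1) := by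
    rw [← Real.mul_rpow hK.le hα.le]
    exact Real.rpow_le_rpow ha haK (by linarith)
  have hA : 0 ≤ a / α := by positivity
  have hG : 0 ≤ g / γ := by positivity
  have h2 : (a / α) ^ (1 - y) * (g / γ) ^ y ≤ a / α + g / γ := by
    refine (Real.geom_mean_le_arith_mean2_weighted (by linarith) hy0.le hA hG (by ring)).trans ?_
    nlinarith
  have e3 : a ^ (1 - y) * g ^ y = α ^ (1 - y) * γ ^ y * ((a / α) ^ (1 - y) * (g / γ) ^ y) := by
    rw [Real.div_rpow ha hα.le, Real.div_rpow hg hγ.le]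
    have : 0 < α ^ (1 - y) := by positivity
    have : 0 < γ ^ y := by positivity
    field_simp
  calc a ^ x * g ^ y = a ^ (x + y - 1) * (a ^ (1 - y) * g ^ y) := by rw [e1]; ring
    _ ≤ (K ^ (x + y - 1) * α ^ (x + y - 1)) * (a ^ (1 - y) * g ^ y) :=
        mul_le_mul_of_nonneg_right h1 (by positivity)
    _ = K ^ (x + y - 1) * (α ^ x * γ ^ y) * ((a / α) ^ (1 - y) * (g / γ) ^ y) := by
        rw [e3, e2]; ring
    _ ≤ _ := mul_le_mul_of_nonneg_left h2 (by positivity)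

theorem lm_vsum {n : ℕ} {ι : Type*} (S : Finset ι) (s : ι → Set (Rn n)) {A : Set (Rn n)}
    (hm : ∀ i ∈ S, MeasurableSet (s i)) (hA : volume A ≠ ∞) (hs : ∀ i ∈ S, s i ⊆ A)
    (hd : (S : Set ι).PairwiseDisjoint s) : ∑ i ∈ S, volume.real (s i) ≤ volume.real A := by
  rw [← measureReal_biUnion_finset hd hm (fun i hi => ((measure_mono (hs i hi)).trans_lt hA.lt_top).ne)]
  exact measureReal_mono (iUnion₂_subset hs) hA

theorem lm_finite {n : ℕ} (hn : 2 ≤ n) {x y K : ℝ} (hx : 0 < x) (hy : 0 < y) (hx1 : x ≤ 1) (hy1 : y < 1)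
    (h1 : x + y / n < 1) (h2 : x / n + y < 1) (hxy : 1 ≤ x + y) (hK : 0 < K) :
    ∃ C : ℝ, 0 < C ∧ ∀ σ : Measure (Rn n), LRot σ → ∀ (F G : Set (Rn n)) (q₀ : ℤ) (m₀ : Fin n → ℤ)
      (α γ : ℝ) (S : Finset (ℤ × (Fin n → ℤ))) (E T : ℤ × (Fin n → ℤ) → Set (Rn n)),
      MeasurableSet F → volume G ≠ ∞ → 0 < α → α ≤ 1 → 0 < γ → γ ≤ 1 →
      volume.real (F ∩ dC q₀ m₀) ≤ α * (2 ^ q₀) ^ n → volume.real G ≤ γ * (2 ^ q₀) ^ n →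
      (∀ p ∈ S, p.1 ≤ q₀ ∧ dC p.1 p.2 ⊆ dC q₀ m₀) →
      (∀ p ∈ S, ∀ z ∈ dC p.1 p.2, ∀ q, p.1 ≤ q → q ≤ q₀ →
        volume.real (F ∩ dC q (dI q z)) ≤ K * α * (2 ^ q) ^ n) →
      (∀ p ∈ S, MeasurableSet (E p)) → (∀ p ∈ S, E p ⊆ G) → (∀ p ∈ S, E p ⊆ dC p.1 p.2) →
      (S : Set (ℤ × (Fin n → ℤ))).PairwiseDisjoint E →
      (∀ p ∈ S, MeasurableSet (T p)) → (∀ p ∈ S, T p ⊆ dC p.1 p.2) →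
      ∑ p ∈ S, ∫ z in E p, ∫ u, (T p ∩ F).indicator (1 : Rn n → ℝ) (z - ((2:ℝ) ^ p.1 / 4) • u) ∂σ
        ≤ C * (2 ^ q₀) ^ n * (α ^ x * γ ^ y) := by
  obtain ⟨C, ρ, hC, hρ, hρ1, H⟩ := lm_local hn hx hy h1 h2
  refine ⟨2 ^ n * K + C * K ^ (x + y - 1) * 2 * (1 - ρ)⁻¹, ?_, ?_⟩
  · have : 0 < 1 - ρ := by linarith
    positivity
  intro σ hσ F G q₀ m₀ α γ S E T hF hGf hα hα1 hγ hγ1 hFα hGγ hS hK' hE hEG hEC hEd hT hTC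
  have := hσ.prob
  obtain ⟨N, hN⟩ : ∃ N : ℕ, ∀ p ∈ S, ∀ p' ∈ S, p.1 - N < p'.1 := by
    refine ⟨∑ p ∈ S, (2 * p.1.natAbs) + 1, fun p hp p' hp' => ?_⟩
    have a1 := Finset.single_le_sum (f := fun p : ℤ × (Fin n → ℤ) => 2 * p.1.natAbs) (fun i _ => Nat.zero_le _) hp
    have a2 := Finset.single_le_sum (f := fun p : ℤ × (Fin n → ℤ) => 2 * p.1.natAbs) (fun i _ => Nat.zero_le _) hp'
    omega
  have hV0 : (0:ℝ) < (2 ^ q₀) ^ n := by positivity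
  have hEf : ∀ p ∈ S, volume (E p) ≠ ∞ := fun p hp => ((measure_mono (hEG p hp)).trans_lt hGf.lt_top).ne
  have hind : ∀ p x, 0 ≤ (T p ∩ F).indicator (1 : Rn n → ℝ) x := fun p x =>
    indicator_nonneg (fun _ _ => zero_le_one) x
  have hind1 : ∀ p x, (T p ∩ F).indicator (1 : Rn n → ℝ) x ≤ 1 := fun p x =>
    indicator_le_self' (fun _ _ => zero_le_one) x
  have hindm : ∀ p ∈ S, Measurable ((T p ∩ F).indicator (1 : Rn n → ℝ)) := fun p hp =>
    measurable_one.indicator ((hT p hp).inter hF)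
  have hVm : ∀ (p : ℤ × (Fin n → ℤ)) (m : ℤ), MeasurableSet (dC p.1 p.2 ∩ dW S m) := fun p m =>
    (dC_meas _ _).inter (dW_meas _)
  have hVf : ∀ (p : ℤ × (Fin n → ℤ)) (m : ℤ), volume (dC p.1 p.2 ∩ dW S m) ≠ ∞ := fun p m =>
    ((measure_mono inter_subset_left).trans_lt (dC_fin p.1 p.2).lt_top).ne
  have hintV : ∀ p ∈ S, ∀ V : Set (Rn n), MeasurableSet V → volume V ≠ ∞ →
      ∫ z in V, (T p ∩ F).indicator (1 : Rn n → ℝ) z ≤ volume.real (F ∩ V) := by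
    intro p hp V hV hVf
    rw [integral_indicator_one ((hT p hp).inter hF), measureReal_restrict_apply ((hT p hp).inter hF)]
    refine measureReal_mono ?_ ((measure_mono inter_subset_right).trans_lt hVf.lt_top).ne
    exact fun z hz => ⟨hz.1.2, hz.2⟩
  have step1 : ∀ p ∈ S, ∫ z in E p, ∫ u, (T p ∩ F).indicator (1 : Rn n → ℝ) (z - ((2:ℝ) ^ p.1 / 4) • u) ∂σ
      ≤ (2 ^ n * K * α) * volume.real (E p) + ∑ k ∈ Finset.range N,
      |∫ z in E p, ∫ u, dB (p.1 - (k + 1 : ℕ)) (dC p.1 p.2 ∩ dW S (p.1 - (k + 1 : ℕ)))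
        ((T p ∩ F).indicator (1 : Rn n → ℝ)) (z - ((2:ℝ) ^ p.1 / 4) • u) ∂σ| := by
    intro p hp
    refine lm_cube σ hp (hN p hp) (hindm p hp) (hind p) (hind1 p) ?_ (by positivity) ?_ (hE p hp) (hEf p hp) _
    · intro x hx
      exact indicator_of_notMem (fun h => hx (hTC p hp h.1)) _
    · intro m hm z hz
      apply dA_le
      refine (hintV p hp _ (dC_meas _ _) (dC_fin _ _)).trans ?_
      obtain ⟨p', hp', hpm, w, hw, e⟩ := hz.2.1
      have := hK' p' hp' w hw (m + 1) hpm (by have := (hS p hp).1; omega)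
      rw [← e] at this
      have hsub : F ∩ dC m (dI m z) ⊆ F ∩ dC (m + 1) (dI (m + 1) z) :=
        inter_subset_inter_right _ fun v hv => dI_mono (by omega) (show dI m v = dI m z from hv)
      refine (measureReal_mono hsub ((measure_mono inter_subset_right).trans_lt (dC_fin _ _).lt_top).ne).trans
        (this.trans (le_of_eq ?_))
      rw [zpow_add₀ (by norm_num), zpow_one, mul_pow]; ring
  have step2 : ∀ p ∈ S, ∀ k : ℕ,
      |∫ z in E p, ∫ u, dB (p.1 - (k + 1 : ℕ)) (dC p.1 p.2 ∩ dW S (p.1 - (k + 1 : ℕ)))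
        ((T p ∩ F).indicator (1 : Rn n → ℝ)) (z - ((2:ℝ) ^ p.1 / 4) • u) ∂σ|
      ≤ C * ρ ^ k * K ^ (x + y - 1) * (α ^ x * γ ^ y) *
        (volume.real (F ∩ (dC p.1 p.2 ∩ dW S (p.1 - (k + 1 : ℕ)))) / α + volume.real (E p) / γ) := by
    intro p hp k
    have hl : (0:ℝ) < ((2:ℝ) ^ p.1) ^ n := by positivity
    have hFV : volume.real (F ∩ (dC p.1 p.2 ∩ dW S (p.1 - (k + 1 : ℕ)))) ≤ volume.real (F ∩ dC p.1 p.2) :=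
      measureReal_mono (inter_subset_inter_right _ inter_subset_left)
        ((measure_mono inter_subset_right).trans_lt (dC_fin _ _).lt_top).ne
    have hFC : volume.real (F ∩ dC p.1 p.2) ≤ ((2:ℝ) ^ p.1) ^ n := by
      rw [← dC_vol p.1 p.2]; exact measureReal_mono inter_subset_right (dC_fin _ _)
    have hEC' : volume.real (E p) ≤ ((2:ℝ) ^ p.1) ^ n := by
      rw [← dC_vol p.1 p.2]; exact measureReal_mono (hEC p hp) (dC_fin _ _)
    have hFK : volume.real (F ∩ dC p.1 p.2) ≤ K * α * ((2:ℝ) ^ p.1) ^ n := by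
      by_cases hne : (dC p.1 p.2).Nonempty
      · obtain ⟨z, hz⟩ := hne
        have := hK' p hp z hz p.1 le_rfl (hS p hp).1
        rwa [show dI p.1 z = p.2 from hz] at this
      · rw [not_nonempty_iff_eq_empty] at hne
        rw [hne]; simp; positivity
    have hloc := H σ hσ (dB (p.1 - (k + 1 : ℕ)) (dC p.1 p.2 ∩ dW S (p.1 - (k + 1 : ℕ)))
        ((T p ∩ F).indicator (1 : Rn n → ℝ))) (E p) ((2:ℝ) ^ p.1)
        (volume.real (F ∩ (dC p.1 p.2 ∩ dW S (p.1 - (k + 1 : ℕ)))) / ((2:ℝ) ^ p.1) ^ n)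
        (volume.real (E p) / ((2:ℝ) ^ p.1) ^ n) (k + 1)
        (dB_nice (hVm _ _) (hVf _ _) (hindm p hp) (hind p) (hind1 p))
        (dB_bd (hindm p hp) (hind p) (hind1 p)) (hE p hp) (hEf p hp) (by positivity)
        (by positivity) (by rw [div_le_one hl]; linarith) (by positivity) (by rw [div_le_one hl]; linarith)
        ?_ (by rw [div_mul_cancel₀ _ hl.ne']) ?_
    · refine hloc.trans ?_
      have hpt := lm_pt (a := volume.real (F ∩ (dC p.1 p.2 ∩ dW S (p.1 - (k + 1 : ℕ)))) / ((2:ℝ) ^ p.1) ^ n)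
        (g := volume.real (E p) / ((2:ℝ) ^ p.1) ^ n) (K := K) (x := x) (y := y)
        (by positivity) (by positivity) hα hγ hK
        (by rw [div_le_iff₀ hl]; linarith) hxy hy hy1
      have hρk : ρ ^ (k + 1) ≤ ρ ^ k := pow_le_pow_of_le_one hρ.le hρ1.le (by omega)
      calc _ = C * ρ ^ (k + 1) * ((2:ℝ) ^ p.1) ^ n * ((volume.real (F ∩ (dC p.1 p.2 ∩ dW S (p.1 - (k + 1 : ℕ)))) / ((2:ℝ) ^ p.1) ^ n) ^ x * (volume.real (E p) / ((2:ℝ) ^ p.1) ^ n) ^ y) := by ring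
        _ ≤ C * ρ ^ k * ((2:ℝ) ^ p.1) ^ n * (K ^ (x + y - 1) * (α ^ x * γ ^ y) * ((volume.real (F ∩ (dC p.1 p.2 ∩ dW S (p.1 - (k + 1 : ℕ)))) / ((2:ℝ) ^ p.1) ^ n) / α + (volume.real (E p) / ((2:ℝ) ^ p.1) ^ n) / γ)) := by
            refine mul_le_mul ?_ hpt (by positivity) (by positivity)
            exact mul_le_mul_of_nonneg_right (mul_le_mul_of_nonneg_left hρk hC.le) hl.le
        _ = _ := by field_simp
    · refine (dB_l1 (hVm _ _) (hVf _ _) ?_ (hindm p hp) (hind p) (hind1 p)).trans ?_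
      · rintro v v' hv ⟨hv1, hv2⟩
        refine ⟨?_, dW_inv hv hv2⟩
        exact (dI_mono (by push_cast; omega) hv).symm.trans hv1
      · have := hintV p hp _ (hVm p (p.1 - (k + 1 : ℕ))) (hVf _ _)
        rw [mul_assoc, div_mul_cancel₀ _ hl.ne']
        linarith
    · intro j
      have e : (2:ℝ) ^ p.1 * (1 / 2) ^ (k + 1) = (2:ℝ) ^ (p.1 - ((k + 1 : ℕ) : ℤ)) := by
        rw [zpow_sub₀ (by norm_num), zpow_natCast]; simp [div_eq_mul_inv]
      rw [e, ← dC_eq]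
      refine dB_mean ?_ (hindm p hp) (hind p) (hind1 p) j
      rintro v v' hv ⟨hv1, hv2⟩
      refine ⟨?_, dW_inv hv hv2⟩
      exact (dI_mono (by push_cast; omega) hv).symm.trans hv1
  have sumE : ∑ p ∈ S, volume.real (E p) ≤ γ * (2 ^ q₀) ^ n := (lm_vsum S E hE hGf hEG hEd).trans hGγ
  have sumF : ∀ k : ℕ, ∑ p ∈ S, volume.real (F ∩ (dC p.1 p.2 ∩ dW S (p.1 - (k + 1 : ℕ))))
      ≤ α * (2 ^ q₀) ^ n := by
    intro k
    refine (lm_vsum S _ (A := F ∩ dC q₀ m₀) (fun p _ => hF.inter (hVm _ _))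
      ((measure_mono inter_subset_right).trans_lt (dC_fin _ _).lt_top).ne
      (fun p hp => inter_subset_inter_right _ (inter_subset_left.trans (hS p hp).2)) ?_).trans hFα
    intro p hp p' hp' hne
    rw [Function.onFun, Set.disjoint_left]
    rintro z ⟨_, hz1, hz2⟩ ⟨_, hz3, hz4⟩
    by_cases hq : p.1 = p'.1
    · apply hne
      refine Prod.ext hq ?_
      have a1 : dI p.1 z = p.2 := hz1
      have a2 : dI p'.1 z = p'.2 := hz3
      rw [← a1, ← a2, hq]
    · exact Set.disjoint_left.1 (dW_disj (S := S) (m := p.1 - (k + 1 : ℕ)) (m' := p'.1 - (k + 1 : ℕ))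
        (fun h => hq (by omega))) hz2 hz4
  have hαγ : α * γ ≤ α ^ x * γ ^ y := by
    have a1 : α ≤ α ^ x := by
      nth_rewrite 1 [← Real.rpow_one α]; exact Real.rpow_le_rpow_of_exponent_ge hα hα1 hx1
    have a2 : γ ≤ γ ^ y := by
      nth_rewrite 1 [← Real.rpow_one γ]; exact Real.rpow_le_rpow_of_exponent_ge hγ hγ1 hy1.le
    exact mul_le_mul a1 a2 hγ.le (by positivity)
  have hgeo : ∑ k ∈ Finset.range N, ρ ^ k ≤ (1 - ρ)⁻¹ := by
    rw [← tsum_geometric_of_lt_one hρ.le hρ1]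
    exact (summable_geometric_of_lt_one hρ.le hρ1).sum_le_tsum _ (fun k _ => by positivity)
  have step3 : ∀ k ∈ Finset.range N, ∑ p ∈ S,
      |∫ z in E p, ∫ u, dB (p.1 - (k + 1 : ℕ)) (dC p.1 p.2 ∩ dW S (p.1 - (k + 1 : ℕ)))
        ((T p ∩ F).indicator (1 : Rn n → ℝ)) (z - ((2:ℝ) ^ p.1 / 4) • u) ∂σ|
      ≤ ρ ^ k * (C * K ^ (x + y - 1) * 2 * (2 ^ q₀) ^ n * (α ^ x * γ ^ y)) := by
    intro k _
    refine (Finset.sum_le_sum fun p hp => step2 p hp k).trans ?_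
    rw [← Finset.mul_sum, Finset.sum_add_distrib, ← Finset.sum_div, ← Finset.sum_div]
    have a1 := (div_le_iff₀' hα).2 (sumF k)
    have a2 := (div_le_iff₀' hγ).2 sumE
    calc _ ≤ C * ρ ^ k * K ^ (x + y - 1) * (α ^ x * γ ^ y) * ((2 ^ q₀) ^ n + (2 ^ q₀) ^ n) :=
          mul_le_mul_of_nonneg_left (add_le_add a1 a2) (by positivity)
      _ = _ := by ring
  calc _ ≤ _ := Finset.sum_le_sum step1
    _ = (2 ^ n * K * α) * ∑ p ∈ S, volume.real (E p) + ∑ k ∈ Finset.range N, ∑ p ∈ S,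
      |∫ z in E p, ∫ u, dB (p.1 - (k + 1 : ℕ)) (dC p.1 p.2 ∩ dW S (p.1 - (k + 1 : ℕ)))
        ((T p ∩ F).indicator (1 : Rn n → ℝ)) (z - ((2:ℝ) ^ p.1 / 4) • u) ∂σ| := by
        rw [Finset.sum_add_distrib, ← Finset.mul_sum, Finset.sum_comm]
    _ ≤ (2 ^ n * K * α) * (γ * (2 ^ q₀) ^ n) + ∑ k ∈ Finset.range N,
        ρ ^ k * (C * K ^ (x + y - 1) * 2 * (2 ^ q₀) ^ n * (α ^ x * γ ^ y)) :=
        add_le_add (mul_le_mul_of_nonneg_left sumE (by positivity)) (Finset.sum_le_sum step3)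
    _ = 2 ^ n * K * (2 ^ q₀) ^ n * (α * γ) + (∑ k ∈ Finset.range N, ρ ^ k) *
        (C * K ^ (x + y - 1) * 2 * (2 ^ q₀) ^ n * (α ^ x * γ ^ y)) := by
        rw [Finset.sum_mul]; ring
    _ ≤ 2 ^ n * K * (2 ^ q₀) ^ n * (α ^ x * γ ^ y) + (1 - ρ)⁻¹ *
        (C * K ^ (x + y - 1) * 2 * (2 ^ q₀) ^ n * (α ^ x * γ ^ y)) :=
        add_le_add (mul_le_mul_of_nonneg_left hαγ (by positivity))
          (mul_le_mul_of_nonneg_right hgeo (by positivity))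
    _ = _ := by ring

theorem lm_select {n : ℕ} {ι : Type*} [Encodable ι] (S : Finset ι) (a : ι → Rn n → ℝ) (D : ι → Set (Rn n))
    (φ : Rn n → ℝ) {G : Set (Rn n)} (hG : MeasurableSet G) (hφ : Measurable φ)
    (hD : ∀ p ∈ S, MeasurableSet (D p)) (ha : ∀ p ∈ S, Measurable (a p))
    (ha0 : ∀ p ∈ S, ∀ x ∉ D p, a p x = 0) (hap : ∀ p ∈ S, ∀ x, 0 ≤ a p x)
    (hint : ∀ p ∈ S, IntegrableOn (a p) G) (hφi : IntegrableOn φ G)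
    (h : ∀ x ∈ G, φ x ≤ 0 ∨ ∃ p ∈ S, φ x ≤ a p x) :
    ∃ E : ι → Set (Rn n), (∀ p ∈ S, MeasurableSet (E p)) ∧ (∀ p ∈ S, E p ⊆ G) ∧ (∀ p ∈ S, E p ⊆ D p) ∧
      (S : Set ι).PairwiseDisjoint E ∧ ∫ x in G, φ x ≤ ∑ p ∈ S, ∫ x in E p, a p x := by
  classical
  let R : ι → Set (Rn n) := fun p => {x | x ∈ G ∧ x ∈ D p ∧ φ x ≤ a p x}
  let E : ι → Set (Rn n) := fun p => R p \ ⋃ p' ∈ S.filter (fun p' => Encodable.encode p' < Encodable.encode p), R p'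
  have hR : ∀ p ∈ S, MeasurableSet (R p) := fun p hp =>
    hG.inter ((hD p hp).inter (measurableSet_le hφ (ha p hp)))
  have hE : ∀ p ∈ S, MeasurableSet (E p) := fun p hp =>
    (hR p hp).diff (Finset.measurableSet_biUnion _ fun p' hp' => hR p' (Finset.mem_filter.1 hp').1)
  have hEG : ∀ p ∈ S, E p ⊆ G := fun p _ x hx => hx.1.1
  refine ⟨E, hE, hEG, fun p _ x hx => hx.1.2.1, ?_, ?_⟩
  · intro p hp p' hp' hne
    rw [Function.onFun, Set.disjoint_left]
    rintro x hx hx'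
    have hne' : Encodable.encode p ≠ Encodable.encode p' := fun h => hne (Encodable.encode_injective h)
    rcases lt_or_gt_of_ne hne' with hlt | hlt
    · exact hx'.2 (mem_biUnion (x := p) (by simpa using ⟨hp, hlt⟩) hx.1)
    · exact hx.2 (mem_biUnion (x := p') (by simpa using ⟨hp', hlt⟩) hx'.1)
  · have e : ∀ p ∈ S, ∫ x in E p, a p x = ∫ x in G, (E p).indicator (a p) x := by
      intro p hp
      rw [setIntegral_indicator (hE p hp), inter_eq_self_of_subset_right (hEG p hp)]
    have hi : ∀ p ∈ S, IntegrableOn ((E p).indicator (a p)) G := fun p hp =>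
      (hint p hp).indicator (hE p hp)
    rw [Finset.sum_congr rfl e, ← integral_finset_sum _ hi]
    refine setIntegral_mono_on hφi (integrable_finset_sum _ hi) hG fun x hx => ?_
    have hnn : ∀ p ∈ S, 0 ≤ (E p).indicator (a p) x := fun p hp => indicator_nonneg (fun x _ => hap p hp x) x
    rcases le_or_gt (φ x) 0 with h0 | h0
    · exact h0.trans (Finset.sum_nonneg hnn)
    rcases h x hx with h1 | ⟨p, hp, h1⟩
    · linarith
    have hmem : ∀ p ∈ S, φ x ≤ a p x → x ∈ R p := by
      intro p hp h1
      refine ⟨hx, ?_, h1⟩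
      by_contra hc
      rw [ha0 p hp x hc] at h1
      linarith
    obtain ⟨p₁, hp₁, hmin⟩ := Finset.exists_min_image (S.filter fun p => φ x ≤ a p x)
      (fun p => Encodable.encode p) ⟨p, Finset.mem_filter.2 ⟨hp, h1⟩⟩
    rw [Finset.mem_filter] at hp₁
    have hxE : x ∈ E p₁ := by
      refine ⟨hmem p₁ hp₁.1 hp₁.2, fun hc => ?_⟩
      rw [mem_iUnion₂] at hc
      obtain ⟨p', hp', hx'⟩ := hc
      rw [Finset.mem_filter] at hp'
      have := hmin p' (Finset.mem_filter.2 ⟨hp'.1, hx'.2.2⟩)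
      omega
    calc φ x ≤ a p₁ x := hp₁.2
      _ = (E p₁).indicator (a p₁) x := (indicator_of_mem hxE _).symm
      _ ≤ _ := Finset.single_le_sum hnn hp₁.1

noncomputable def dM {n : ℕ} (P : Set (ℤ × (Fin n → ℤ))) (a : ℤ × (Fin n → ℤ) → Rn n → ℝ) (x : Rn n) : ℝ :=
  ⨆ p, P.indicator (fun p => a p x) p

section
variable {n : ℕ} {P : Set (ℤ × (Fin n → ℤ))} {a : ℤ × (Fin n → ℤ) → Rn n → ℝ}

theorem dM_bdd (h1 : ∀ p x, a p x ≤ 1) (x : Rn n) : BddAbove (range fun p => P.indicator (fun p => a p x) p) := by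
  refine ⟨1, ?_⟩
  rintro _ ⟨p, rfl⟩
  exact indicator_apply_le' (fun _ => h1 p x) (fun _ => zero_le_one)

theorem dM_meas (hm : ∀ p ∈ P, Measurable (a p)) : Measurable (dM P a) := by
  refine Measurable.iSup fun p => ?_
  by_cases hp : p ∈ P
  · simpa [hp] using hm p hp
  · simp [hp]

theorem dM_nonneg (h0 : ∀ p x, 0 ≤ a p x) (x : Rn n) : 0 ≤ dM P a x :=
  Real.iSup_nonneg fun p => indicator_nonneg (fun p _ => h0 p x) p

theorem dM_le (h1 : ∀ p x, a p x ≤ 1) (x : Rn n) : dM P a x ≤ 1 :=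
  ciSup_le fun p => indicator_apply_le' (fun _ => h1 p x) (fun _ => zero_le_one)

theorem dM_zero {x : Rn n} (h : ∀ p ∈ P, a p x = 0) : dM P a x = 0 := by
  have : ∀ p, P.indicator (fun p => a p x) p = 0 := by
    intro p
    by_cases hp : p ∈ P
    · simp [hp, h p hp]
    · simp [hp]
  simp [dM, this]

theorem dM_limit (hm : ∀ p ∈ P, Measurable (a p)) (h0 : ∀ p x, 0 ≤ a p x) (h1 : ∀ p x, a p x ≤ 1)
    {G : Set (Rn n)} (hG : MeasurableSet G) (hGf : volume G ≠ ∞) {B : ℝ}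
    (H : ∀ (S : Finset (ℤ × (Fin n → ℤ))) (G' : Set (Rn n)) , (∀ p ∈ S, p ∈ P) → MeasurableSet G' →
      G' ⊆ G → (∀ x ∈ G', dM P a x / 2 ≤ 0 ∨ ∃ p ∈ S, dM P a x / 2 ≤ a p x) →
      ∫ x in G', dM P a x / 2 ≤ B) : ∫ x in G, dM P a x ≤ 2 * B := by
  classical
  let S : ℕ → Finset (ℤ × (Fin n → ℤ)) := fun N =>
    ((Finset.range N).biUnion fun i => (Encodable.decode (α := ℤ × (Fin n → ℤ)) i).toFinset).filter (· ∈ P)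
  have hSm : ∀ N p, p ∈ S N ↔ (∃ i < N, Encodable.decode (α := ℤ × (Fin n → ℤ)) i = some p) ∧ p ∈ P := by
    intro N p; simp [S]
  let X : ℕ → Set (Rn n) := fun N => {x | x ∈ G ∧ (dM P a x / 2 ≤ 0 ∨ ∃ p ∈ S N, dM P a x / 2 ≤ a p x)}
  have hdm := dM_meas (P := P) hm
  have hX : ∀ N, MeasurableSet (X N) := by
    intro N
    refine hG.inter ((measurableSet_le (hdm.div_const 2) measurable_const).union ?_)
    have : {x | ∃ p ∈ S N, dM P a x / 2 ≤ a p x} = ⋃ p ∈ S N, {x | dM P a x / 2 ≤ a p x} := by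
      ext x; simp
    change MeasurableSet {x | ∃ p ∈ S N, dM P a x / 2 ≤ a p x}
    rw [this]
    exact Finset.measurableSet_biUnion _ fun p hp =>
      measurableSet_le (hdm.div_const 2) (hm p ((hSm N p).1 hp).2)
  have hmono : Monotone X := by
    rintro N N' hN x ⟨hx, h | ⟨p, hp, h⟩⟩
    · exact ⟨hx, Or.inl h⟩
    · refine ⟨hx, Or.inr ⟨p, ?_, h⟩⟩
      rw [hSm] at hp ⊢
      obtain ⟨⟨i, hi, e⟩, hp⟩ := hp
      exact ⟨⟨i, by omega, e⟩, hp⟩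
  have hU : ⋃ N, X N = G := by
    ext x
    simp only [mem_iUnion]
    constructor
    · rintro ⟨N, h⟩; exact h.1
    · intro hx
      rcases le_or_gt (dM P a x) 0 with h | h
      · exact ⟨0, hx, Or.inl (by linarith)⟩
      · obtain ⟨p, hp⟩ := exists_lt_of_lt_ciSup (show dM P a x / 2 < ⨆ p, P.indicator (fun p => a p x) p by
          change dM P a x / 2 < dM P a x; linarith)
        have hpP : p ∈ P := by
          by_contra hc
          rw [indicator_of_notMem hc] at hp
          linarith
        rw [indicator_of_mem hpP] at hp
        refine ⟨Encodable.encode p + 1, hx, Or.inr ⟨p, ?_, hp.le⟩⟩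
        rw [hSm]
        exact ⟨⟨Encodable.encode p, by omega, Encodable.encodek p⟩, hpP⟩
  have hint : IntegrableOn (fun x => dM P a x / 2) G :=
    (dh_int hdm (dM_nonneg h0) (dM_le h1) hGf).div_const 2
  have hlim := tendsto_setIntegral_of_monotone (f := fun x => dM P a x / 2) (μ := volume) hX hmono
    (by rw [hU]; exact hint)
  rw [hU] at hlim
  have := le_of_tendsto' hlim fun N => H (S N) (X N) (fun p hp => ((hSm N p).1 hp).2) (hX N)
    (fun x hx => hx.1) (fun x hx => hx.2)
  rw [integral_div] at this
  linarith

end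

noncomputable def da {n : ℕ} (σ : Measure (Rn n)) (F : Set (Rn n)) (T : ℤ × (Fin n → ℤ) → Set (Rn n))
    (p : ℤ × (Fin n → ℤ)) (x : Rn n) : ℝ :=
  ∫ u, (T p ∩ F).indicator (1 : Rn n → ℝ) (x - ((2:ℝ) ^ p.1 / 4) • u) ∂σ

section
variable {n : ℕ} {σ : Measure (Rn n)} {F : Set (Rn n)} {T : ℤ × (Fin n → ℤ) → Set (Rn n)}

theorem da_nonneg (p x) : 0 ≤ da σ F T p x :=
  integral_nonneg fun u => indicator_nonneg (fun _ _ => zero_le_one) _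

theorem da_le_one [IsProbabilityMeasure σ] (p x) : da σ F T p x ≤ 1 := by
  calc da σ F T p x ≤ ∫ u, (1:ℝ) ∂σ := by
        refine integral_mono_of_nonneg (Filter.Eventually.of_forall fun u =>
          indicator_nonneg (fun _ _ => zero_le_one) _) (integrable_const _)
          (Filter.Eventually.of_forall fun u => ?_)
        exact indicator_le_self' (fun _ _ => zero_le_one) _
    _ = 1 := by simp

theorem da_meas [IsProbabilityMeasure σ] (hF : MeasurableSet F) {p} (hT : MeasurableSet (T p)) :
    Measurable (da σ F T p) := by
  have hm : Measurable ((T p ∩ F).indicator (1 : Rn n → ℝ)) := measurable_one.indicator (hT.inter hF)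
  have : da σ F T p = lconv (σ.map (fun u => ((2:ℝ) ^ p.1 / 4) • u)) ((T p ∩ F).indicator (1 : Rn n → ℝ)) := by
    funext x
    rw [lconv_smulmap σ _ hm]; rfl
  rw [this]
  have hprob : IsProbabilityMeasure (σ.map (fun u => ((2:ℝ) ^ p.1 / 4) • u)) :=
    Measure.isProbabilityMeasure_map (by fun_prop)
  exact lconv_meas _ hm

end

/-- hypotheses on an indexed family of dyadic cubes -/
structure DSet {n : ℕ} (σ : Measure (Rn n)) (F : Set (Rn n)) (q₀ : ℤ) (m₀ : Fin n → ℤ) (α K : ℝ)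
    (P : Set (ℤ × (Fin n → ℤ))) (T : ℤ × (Fin n → ℤ) → Set (Rn n)) : Prop where
  F_meas : MeasurableSet F
  F_le : volume.real (F ∩ dC q₀ m₀) ≤ α * (2 ^ q₀) ^ n
  sub : ∀ p ∈ P, p.1 ≤ q₀ ∧ dC p.1 p.2 ⊆ dC q₀ m₀
  dens : ∀ p ∈ P, ∀ z ∈ dC p.1 p.2, ∀ q, p.1 ≤ q → q ≤ q₀ →
        volume.real (F ∩ dC q (dI q z)) ≤ K * α * (2 ^ q) ^ n
  T_meas : ∀ p ∈ P, MeasurableSet (T p)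
  T_sub : ∀ p ∈ P, T p ⊆ dC p.1 p.2
  supp : ∀ p ∈ P, ∀ x ∉ dC p.1 p.2, da σ F T p x = 0

theorem lm_G {n : ℕ} (hn : 2 ≤ n) {x y K : ℝ} (hx : 0 < x) (hy : 0 < y) (hx1 : x ≤ 1) (hy1 : y < 1)
    (h1 : x + y / n < 1) (h2 : x / n + y < 1) (hxy : 1 ≤ x + y) (hK : 0 < K) :
    ∃ C : ℝ, 0 < C ∧ ∀ σ : Measure (Rn n), LRot σ → ∀ (F : Set (Rn n)) (q₀ : ℤ) (m₀ : Fin n → ℤ)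
      (α : ℝ) (P) (T), DSet σ F q₀ m₀ α K P T → 0 < α → α ≤ 1 → ∀ (G : Set (Rn n)) (γ : ℝ),
      MeasurableSet G → volume G ≠ ∞ → 0 < γ → γ ≤ 1 → volume.real G ≤ γ * (2 ^ q₀) ^ n →
      ∫ z in G, dM P (da σ F T) z ≤ C * (2 ^ q₀) ^ n * (α ^ x * γ ^ y) := by
  obtain ⟨C, hC, H⟩ := lm_finite hn hx hy hx1 hy1 h1 h2 hxy hK
  refine ⟨2 * C, by positivity, ?_⟩
  intro σ hσ F q₀ m₀ α P T hD hα hα1 G γ hG hGf hγ hγ1 hGγ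
  have := hσ.prob
  have hm : ∀ p ∈ P, Measurable (da σ F T p) := fun p hp => da_meas hD.F_meas (hD.T_meas p hp)
  have key := dM_limit (P := P) (a := da σ F T) (B := C * (2 ^ q₀) ^ n * (α ^ x * γ ^ y))
    hm da_nonneg da_le_one hG hGf ?_
  · linarith
  intro S G' hS hG' hG'G hsel
  have hG'f : volume G' ≠ ∞ := ((measure_mono hG'G).trans_lt hGf.lt_top).ne
  have hdm := dM_meas (P := P) hm
  obtain ⟨E, hE, hEG, hED, hEd, hle⟩ := lm_select S (da σ F T) (fun p => dC p.1 p.2)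
    (fun x => dM P (da σ F T) x / 2) hG' (hdm.div_const 2) (fun p _ => dC_meas _ _)
    (fun p hp => hm p (hS p hp)) (fun p hp => hD.supp p (hS p hp)) (fun p _ => da_nonneg p)
    (fun p hp => dh_int (hm p (hS p hp)) (da_nonneg p) (da_le_one p) hG'f)
    ((dh_int hdm (dM_nonneg da_nonneg) (dM_le da_le_one) hG'f).div_const 2) hsel
  refine hle.trans ?_
  exact H σ hσ F G' q₀ m₀ α γ S E T hD.F_meas hG'f hα hα1 hγ hγ1 hD.F_le
    ((measureReal_mono hG'G hGf).trans hGγ) (fun p hp => hD.sub p (hS p hp))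
    (fun p hp => hD.dens p (hS p hp)) hE hEG hED hEd (fun p hp => hD.T_meas p (hS p hp))
    (fun p hp => hD.T_sub p (hS p hp))

theorem lm_layer {v β : ℝ} (hβ : 0 < β) (hv : 0 ≤ v) : ∀ N : ℕ, v < 2 ^ N * β →
    v ≤ β + ∑ i ∈ Finset.range N, 2 ^ (i + 1) * β * (if 2 ^ i * β ≤ v then 1 else 0) := by
  intro N
  induction N with
  | zero => intro h; simp at h ⊢; linarith
  | succ N ih =>
    intro h
    have hs : 0 ≤ ∑ i ∈ Finset.range N, 2 ^ (i + 1) * β * (if 2 ^ i * β ≤ v then (1:ℝ) else 0) :=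
      Finset.sum_nonneg fun i _ => by split_ifs <;> positivity
    rw [Finset.sum_range_succ]
    by_cases hc : 2 ^ N * β ≤ v
    · rw [if_pos hc]; linarith
    · rw [if_neg hc]
      have := ih (not_le.1 hc)
      linarith

theorem lm_main {n : ℕ} (hn : 2 ≤ n) {x y s K : ℝ} (hx : 0 < x) (hy : 0 < y) (hx1 : x ≤ 1) (hy1 : y < 1)
    (h1 : x + y / n < 1) (h2 : x / n + y < 1) (hxy : 1 ≤ x + y) (hK : 0 < K) (hs : 0 < s) (hys : 1 < s * y) :
    ∃ C : ℝ, 0 < C ∧ ∀ σ : Measure (Rn n), LRot σ → ∀ (F : Set (Rn n)) (q₀ : ℤ) (m₀ : Fin n → ℤ)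
      (α : ℝ) (P) (T), DSet σ F q₀ m₀ α K P T → 0 < α → α ≤ 1 → ∀ (f : Rn n → ℝ) (β : ℝ),
      Measurable f → (∀ x, 0 ≤ f x) → (∃ M, ∀ x, f x ≤ M) → 0 < β →
      ∫ z in dC q₀ m₀, f z ^ s ≤ β ^ s * (2 ^ q₀) ^ n →
      ∫ z, dM P (da σ F T) z * f z ≤ C * (2 ^ q₀) ^ n * α ^ x * β := by
  obtain ⟨C, hC, H⟩ := lm_G hn hx hy hx1 hy1 h1 h2 hxy hK
  let ρ : ℝ := 2 ^ (1 - s * y)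
  have hρ : 0 < ρ := by positivity
  have hρ1 : ρ < 1 := Real.rpow_lt_one_of_one_lt_of_neg (by norm_num) (by linarith)
  have hρ1' : 0 < 1 - ρ := by linarith
  refine ⟨C * (1 + 2 * (1 - ρ)⁻¹), by positivity, ?_⟩
  intro σ hσ F q₀ m₀ α P T hD hα hα1 f β hf hf0 ⟨M, hM⟩ hβ hfs
  have := hσ.prob
  have hm : ∀ p ∈ P, Measurable (da σ F T p) := fun p hp => da_meas hD.F_meas (hD.T_meas p hp)
  have hdm := dM_meas (P := P) hm
  have h0 := dM_nonneg (P := P) (a := da σ F T) da_nonneg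
  have hle1 := dM_le (P := P) (a := da σ F T) da_le_one
  obtain ⟨N, hN⟩ : ∃ N : ℕ, M < 2 ^ N * β := by
    obtain ⟨N, hN⟩ := pow_unbounded_of_one_lt (M / β) (one_lt_two)
    exact ⟨N, by rwa [div_lt_iff₀ hβ] at hN⟩
  let G : ℕ → Set (Rn n) := fun i => dC q₀ m₀ ∩ {z | 2 ^ i * β ≤ f z}
  have hGm : ∀ i, MeasurableSet (G i) := fun i => (dC_meas _ _).inter (measurableSet_le measurable_const hf)
  have hGf : ∀ i, volume (G i) ≠ ∞ := fun i =>
    ((measure_mono inter_subset_left).trans_lt (dC_fin q₀ m₀).lt_top).ne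
  have hfsm : Measurable fun z => f z ^ s := hf.pow_const s
  have hfsi : IntegrableOn (fun z => f z ^ s) (dC q₀ m₀) := by
    refine Measure.integrableOn_of_bounded (M := M ^ s) (dC_fin _ _) hfsm.aestronglyMeasurable ?_
    refine Filter.Eventually.of_forall fun z => ?_
    rw [Real.norm_eq_abs, abs_of_nonneg (Real.rpow_nonneg (hf0 z) s)]
    exact Real.rpow_le_rpow (hf0 z) (hM z) hs.le
  have hGγ : ∀ i : ℕ, volume.real (G i) ≤ ((2:ℝ) ^ (-(i * s))) * (2 ^ q₀) ^ n := by
    intro i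
    have hc : (2 ^ i * β) ^ s * volume.real (G i) ≤ β ^ s * (2 ^ q₀) ^ n := by
      refine le_trans ?_ hfs
      calc (2 ^ i * β) ^ s * volume.real (G i) = ∫ z in G i, (2 ^ i * β) ^ s := by simp [mul_comm]
        _ ≤ ∫ z in G i, f z ^ s := by
            refine setIntegral_mono_on (integrableOn_const (hGf i)) (hfsi.mono_set inter_subset_left) (hGm i) ?_
            intro z hz
            exact Real.rpow_le_rpow (by positivity) hz.2 hs.le
        _ ≤ _ := setIntegral_mono_set hfsi
            (Filter.Eventually.of_forall fun z => Real.rpow_nonneg (hf0 z) s)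
            (HasSubset.Subset.eventuallyLE inter_subset_left)
    rw [Real.mul_rpow (by positivity) hβ.le] at hc
    have hβs : 0 < β ^ s := by positivity
    have e : ((2:ℝ) ^ i) ^ s = 2 ^ (i * s) := by
      rw [← Real.rpow_natCast, ← Real.rpow_mul (by norm_num)]
    rw [e] at hc
    rw [Real.rpow_neg (by norm_num), inv_mul_eq_div, le_div_iff₀ (by positivity)]
    refine le_of_mul_le_mul_left ?_ hβs
    linarith
  have hdi : IntegrableOn (dM P (da σ F T)) (dC q₀ m₀) := dh_int hdm h0 hle1 (dC_fin _ _)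
  have hGi : ∀ i : ℕ, ∫ z in G i, dM P (da σ F T) z ≤ C * (2 ^ q₀) ^ n * α ^ x * (2:ℝ) ^ (-(i * (s * y))) := by
    intro i
    have := H σ hσ F q₀ m₀ α P T hD hα hα1 (G i) ((2:ℝ) ^ (-(i * s))) (hGm i) (hGf i) (by positivity)
      (Real.rpow_le_one_of_one_le_of_nonpos (by norm_num) (by simp; positivity)) (hGγ i)
    refine this.trans (le_of_eq ?_)
    rw [← Real.rpow_mul (by norm_num)]
    rw [show -((i:ℝ) * s) * y = -(i * (s * y)) by ring]; ring
  have hQi : ∫ z in dC q₀ m₀, dM P (da σ F T) z ≤ C * (2 ^ q₀) ^ n * α ^ x := by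
    have := H σ hσ F q₀ m₀ α P T hD hα hα1 (dC q₀ m₀) 1 (dC_meas _ _) (dC_fin _ _) one_pos le_rfl
      (by rw [dC_vol, one_mul])
    rw [Real.one_rpow, mul_one] at this
    exact this
  have hsupp : ∀ z ∉ dC q₀ m₀, dM P (da σ F T) z = 0 := fun z hz =>
    dM_zero fun p hp => hD.supp p hp z fun h => hz ((hD.sub p hp).2 h)
  have e0 : ∫ z, dM P (da σ F T) z * f z = ∫ z in dC q₀ m₀, dM P (da σ F T) z * f z := by
    rw [setIntegral_eq_integral_of_forall_compl_eq_zero]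
    intro z hz
    rw [hsupp z hz, zero_mul]
  have hti : ∀ i : ℕ, IntegrableOn (fun z => 2 ^ (i + 1) * β * (G i).indicator (dM P (da σ F T)) z) (dC q₀ m₀) :=
    fun i => (hdi.indicator (hGm i)).const_mul _
  have e1 : ∫ z in dC q₀ m₀, dM P (da σ F T) z * f z ≤ ∫ z in dC q₀ m₀, (β * dM P (da σ F T) z
      + ∑ i ∈ Finset.range N, 2 ^ (i + 1) * β * (G i).indicator (dM P (da σ F T)) z) := by
    refine setIntegral_mono_on ?_ ((hdi.const_mul β).add (integrable_finset_sum _ fun i _ => hti i)) (dC_meas _ _) ?_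
    · refine Measure.integrableOn_of_bounded (M := M) (dC_fin _ _) (hdm.mul hf).aestronglyMeasurable ?_
      refine Filter.Eventually.of_forall fun z => ?_
      rw [Real.norm_eq_abs, abs_of_nonneg (mul_nonneg (h0 z) (hf0 z))]
      have := h0 z; have := hle1 z; have := hf0 z; have := hM z
      nlinarith
    · intro z hz
      have := lm_layer hβ (hf0 z) N ((hM z).trans_lt hN)
      refine (mul_le_mul_of_nonneg_left this (h0 z)).trans (le_of_eq ?_)
      rw [mul_add, Finset.mul_sum, mul_comm]
      congr 1
      refine Finset.sum_congr rfl fun i _ => ?_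
      by_cases hc : 2 ^ i * β ≤ f z
      · rw [if_pos hc, indicator_of_mem (show z ∈ G i from ⟨hz, hc⟩)]; ring
      · rw [if_neg hc, indicator_of_notMem (show z ∉ G i from fun h => hc h.2)]; ring
  rw [e0]
  refine e1.trans ?_
  rw [integral_add (hdi.const_mul β) (integrable_finset_sum _ fun i _ => hti i),
    integral_finset_sum _ fun i _ => hti i, integral_const_mul]
  have e2 : ∀ i ∈ Finset.range N, ∫ z in dC q₀ m₀, 2 ^ (i + 1) * β * (G i).indicator (dM P (da σ F T)) z
      ≤ ρ ^ i * (2 * β * (C * (2 ^ q₀) ^ n * α ^ x)) := by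
    intro i _
    rw [integral_const_mul, setIntegral_indicator (hGm i), inter_eq_self_of_subset_right inter_subset_left]
    refine (mul_le_mul_of_nonneg_left (hGi i) (by positivity)).trans (le_of_eq ?_)
    have : ρ ^ i = 2 ^ i * (2:ℝ) ^ (-(i * (s * y))) := by
      rw [← Real.rpow_natCast, ← Real.rpow_natCast, ← Real.rpow_mul (by norm_num), ← Real.rpow_add (by norm_num)]
      congr 1; ring
    rw [this, pow_succ]; ring
  have hgeo : ∑ k ∈ Finset.range N, ρ ^ k ≤ (1 - ρ)⁻¹ := by
    rw [← tsum_geometric_of_lt_one hρ.le hρ1]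
    exact (summable_geometric_of_lt_one hρ.le hρ1).sum_le_tsum _ (fun k _ => by positivity)
  calc _ ≤ β * (C * (2 ^ q₀) ^ n * α ^ x) + ∑ i ∈ Finset.range N, ρ ^ i * (2 * β * (C * (2 ^ q₀) ^ n * α ^ x)) :=
        add_le_add (mul_le_mul_of_nonneg_left hQi hβ.le) (Finset.sum_le_sum e2)
    _ ≤ β * (C * (2 ^ q₀) ^ n * α ^ x) + (1 - ρ)⁻¹ * (2 * β * (C * (2 ^ q₀) ^ n * α ^ x)) := by
        rw [← Finset.sum_mul]
        exact add_le_add le_rfl (mul_le_mul_of_nonneg_right hgeo (by positivity))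
    _ = _ := by ring

theorem lreg_half {A : Set (ℝ × ℝ)} {a b c : ℝ} (hab : 0 < a ^ 2 + b ^ 2)
    (h : ∀ p ∈ A, c ≤ a * p.1 + b * p.2) {p : ℝ × ℝ} (hp : p ∈ interior A) : c < a * p.1 + b * p.2 := by
  have hc : Filter.Tendsto (fun t : ℝ => ((p.1 - t * a, p.2 - t * b) : ℝ × ℝ)) (nhdsWithin 0 (Ioi 0)) (nhds p) := by
    have : Continuous (fun t : ℝ => ((p.1 - t * a, p.2 - t * b) : ℝ × ℝ)) := by fun_prop
    have h2 := this.tendsto 0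
    simp only [zero_mul, sub_zero] at h2
    exact h2.mono_left nhdsWithin_le_nhds
  have h1 : ∀ᶠ t in nhdsWithin (0:ℝ) (Ioi 0), ((p.1 - t * a, p.2 - t * b) : ℝ × ℝ) ∈ A :=
    hc (mem_interior_iff_mem_nhds.1 hp)
  have h1' : ∀ᶠ t in nhdsWithin (0:ℝ) (Ioi 0), t ∈ Ioi (0:ℝ) := self_mem_nhdsWithin
  obtain ⟨t, ht, ht0⟩ := (h1.and h1').exists
  have := h _ ht
  simp only at this
  have h3 : 0 < t * (a ^ 2 + b ^ 2) := mul_pos ht0 hab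
  nlinarith

theorem lreg_ge {n : ℕ} {a b c : ℝ} (h1 : c ≤ b) (h2 : c ≤ a)
    (h3 : c ≤ a * ((n:ℝ) / (n + 1)) + b * ((n:ℝ) / (n + 1))) :
    ∀ p ∈ Lregion n, c ≤ a * p.1 + b * p.2 := by
  have hconv : Convex ℝ {p : ℝ × ℝ | c ≤ a * p.1 + b * p.2} := by
    intro p hp q hq s t hs ht hst
    simp only [mem_setOf_eq, Prod.fst_add, Prod.snd_add, Prod.smul_fst, Prod.smul_snd, smul_eq_mul] at hp hq ⊢
    have : c = s * c + t * c := by rw [← add_mul, hst, one_mul]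
    nlinarith [mul_le_mul_of_nonneg_left hp hs, mul_le_mul_of_nonneg_left hq ht]
  apply convexHull_min _ hconv
  intro p hp
  simp only [mem_insert_iff, mem_singleton_iff] at hp
  rcases hp with rfl | rfl | rfl <;> simp <;> linarith

theorem lreg {n : ℕ} (hn : 2 ≤ n) {x y : ℝ} (h : ((x, y) : ℝ × ℝ) ∈ interior (Lregion n)) :
    1 < x + y ∧ x + y / n < 1 ∧ x / n + y < 1 := by
  have hn0 : (2:ℝ) ≤ n := by exact_mod_cast hn
  have hn1 : (1:ℝ) / n ≤ 1 := by rw [div_le_one (by linarith)]; linarith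
  have hv : (1:ℝ) ≤ 2 * ((n:ℝ) / (n + 1)) := by
    rw [mul_div_assoc', le_div_iff₀ (by linarith)]; linarith
  have hv2 : (n:ℝ) / (n + 1) + (1 / n) * ((n:ℝ) / (n + 1)) = 1 := by field_simp
  refine ⟨?_, ?_, ?_⟩
  · have := lreg_half (a := 1) (b := 1) (c := 1) (by norm_num) (lreg_ge le_rfl le_rfl (by linarith)) h
    simp only at this; linarith
  · have := lreg_half (a := -1) (b := -(1 / n)) (c := -1) (by positivity)
      (lreg_ge (by linarith) (by linarith) (by linarith)) h
    simp only at this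
    have e : y / n = 1 / n * y := by ring
    linarith
  · have := lreg_half (a := -(1 / n)) (b := -1) (c := -1) (by positivity)
      (lreg_ge (by linarith) (by linarith) (by linarith)) h
    simp only at this
    have e : x / n = 1 / n * x := by ring
    linarith

noncomputable def cQ {n : ℕ} (p : ℤ × (Fin n → ℤ)) : Cube n :=
  ⟨fun i => (2:ℝ) ^ p.1 * p.2 i, (2:ℝ) ^ p.1, by positivity⟩

theorem cQ_dy {n : ℕ} (p : ℤ × (Fin n → ℤ)) : IsDyadic (cQ p) := ⟨p.1, p.2, rfl, fun _ => rfl⟩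

theorem cQ_ex {n : ℕ} {Q : Cube n} (h : IsDyadic Q) : ∃ p, Q = cQ p := by
  obtain ⟨q, m, h1, h2⟩ := h
  refine ⟨(q, m), ?_⟩
  obtain ⟨c, l, hl⟩ := Q
  simp only at h1 h2
  subst h1
  obtain rfl : c = fun i => (2:ℝ) ^ q * m i := funext h2
  rfl

theorem dC_mem {n : ℕ} (p : ℤ × (Fin n → ℤ)) (z : Rn n) :
    z ∈ dC p.1 p.2 ↔ ∀ i, (2:ℝ) ^ p.1 * p.2 i ≤ z i ∧ z i < (2:ℝ) ^ p.1 * p.2 i + (2:ℝ) ^ p.1 := by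
  rw [dC_eq, lcell_eq (by positivity)]; rfl

theorem cQ_mem {n : ℕ} (p : ℤ × (Fin n → ℤ)) (z : Rn n) :
    z ∈ (cQ p).toSet ↔ ∀ i, (2:ℝ) ^ p.1 * p.2 i ≤ z i ∧ z i ≤ (2:ℝ) ^ p.1 * p.2 i + (2:ℝ) ^ p.1 := Iff.rfl

theorem dC_sub_cQ {n : ℕ} (p : ℤ × (Fin n → ℤ)) : dC p.1 p.2 ⊆ (cQ p).toSet := by
  intro z hz
  rw [dC_mem] at hz
  rw [cQ_mem]
  exact fun i => ⟨(hz i).1, (hz i).2.le⟩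

theorem cQ_vol {n : ℕ} (p : ℤ × (Fin n → ℤ)) : volume (cQ p).toSet = ENNReal.ofReal (((2:ℝ) ^ p.1) ^ n) := by
  have : (cQ p).toSet = {z | ∀ i, z i ∈ Icc ((2:ℝ) ^ p.1 * p.2 i) ((2:ℝ) ^ p.1 * p.2 i + (2:ℝ) ^ p.1)} := rfl
  rw [this, lbox_vol _ (fun i => measurableSet_Icc)]
  simp [ENNReal.ofReal_pow (show (0:ℝ) ≤ 2 ^ p.1 by positivity)]

theorem cQ_ae {n : ℕ} (p : ℤ × (Fin n → ℤ)) : (dC p.1 p.2 : Set (Rn n)) =ᵐ[volume] (cQ p).toSet := by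
  refine ae_eq_of_subset_of_measure_ge (dC_sub_cQ p) ?_ (dC_meas _ _).nullMeasurableSet ?_
  · rw [cQ_vol, dC_eq, lcell_vol (by positivity)]
  · rw [cQ_vol]; exact ENNReal.ofReal_ne_top

theorem cQ_cmp {n : ℕ} {p p' : ℤ × (Fin n → ℤ)} (h : (cQ p).toSet ⊆ (cQ p').toSet) (i : Fin n) :
    (2:ℝ) ^ p'.1 * p'.2 i ≤ (2:ℝ) ^ p.1 * p.2 i ∧
    (2:ℝ) ^ p.1 * p.2 i + (2:ℝ) ^ p.1 ≤ (2:ℝ) ^ p'.1 * p'.2 i + (2:ℝ) ^ p'.1 := by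
  have hl : (0:ℝ) < 2 ^ p.1 := by positivity
  have h1 := h (show WithLp.toLp 2 (fun i => (2:ℝ) ^ p.1 * p.2 i) ∈ (cQ p).toSet from
    (cQ_mem _ _).2 fun i => ⟨le_rfl, by change (2:ℝ) ^ p.1 * p.2 i ≤ _; linarith⟩)
  have h2 := h (show WithLp.toLp 2 (fun i => (2:ℝ) ^ p.1 * p.2 i + (2:ℝ) ^ p.1) ∈ (cQ p).toSet from
    (cQ_mem _ _).2 fun i => ⟨by change _ ≤ (2:ℝ) ^ p.1 * p.2 i + (2:ℝ) ^ p.1; linarith, le_rfl⟩)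
  exact ⟨((cQ_mem _ _).1 h1 i).1, ((cQ_mem _ _).1 h2 i).2⟩

theorem cQ_sub {n : ℕ} (hn : 2 ≤ n) {p p' : ℤ × (Fin n → ℤ)} (h : (cQ p).toSet ⊆ (cQ p').toSet) :
    p.1 ≤ p'.1 ∧ dC p.1 p.2 ⊆ dC p'.1 p'.2 := by
  constructor
  · obtain ⟨a, b⟩ := cQ_cmp h ⟨0, by omega⟩
    have : (2:ℝ) ^ p.1 ≤ 2 ^ p'.1 := by linarith
    exact (zpow_le_zpow_iff_right₀ (by norm_num)).1 this
  · intro z hz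
    rw [dC_mem] at hz ⊢
    intro i
    obtain ⟨a, b⟩ := cQ_cmp h i
    have := hz i
    exact ⟨by linarith, by linarith⟩

theorem dC_sub {n : ℕ} {p p' : ℤ × (Fin n → ℤ)} (h : dC p.1 p.2 ⊆ dC p'.1 p'.2) :
    (cQ p).toSet ⊆ (cQ p').toSet := by
  have hl : (0:ℝ) < 2 ^ p.1 := by positivity
  have key : ∀ i : Fin n, ∀ w, (2:ℝ) ^ p.1 * p.2 i ≤ w → w < (2:ℝ) ^ p.1 * p.2 i + (2:ℝ) ^ p.1 →
      (2:ℝ) ^ p'.1 * p'.2 i ≤ w ∧ w < (2:ℝ) ^ p'.1 * p'.2 i + (2:ℝ) ^ p'.1 := by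
    intro i w hw1 hw2
    have hz : WithLp.toLp 2 (fun j => if j = i then w else (2:ℝ) ^ p.1 * p.2 j) ∈ (dC p.1 p.2 : Set (Rn n)) := by
      rw [dC_mem]
      intro j
      by_cases hj : j = i
      · subst hj; simp [hw1, hw2]
      · simp [hj, hl]
    have := (dC_mem _ _).1 (h hz) i
    simpa using this
  intro z hz
  rw [cQ_mem] at hz ⊢
  intro i
  have h1 := key i _ le_rfl (by linarith)
  refine ⟨h1.1.trans (hz i).1, (hz i).2.trans ?_⟩
  refine le_of_forall_lt fun w hw => ?_
  refine (le_max_left w ((2:ℝ) ^ p.1 * p.2 i)).trans_lt ?_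
  exact (key i _ (le_max_right _ _) (max_lt hw (by linarith))).2

theorem cQ_avgF {n : ℕ} (p : ℤ × (Fin n → ℤ)) {F : Set (Rn n)} (hF : MeasurableSet F) {r : ℝ} (hr : 0 < r) :
    cubeAvg (cQ p) r (F.indicator 1) = ((((2:ℝ) ^ p.1) ^ n)⁻¹ * volume.real (F ∩ dC p.1 p.2)) ^ (1 / r) := by
  unfold cubeAvg
  rw [cQ_vol, ENNReal.toReal_ofReal (by positivity), ← setIntegral_congr_set (cQ_ae p)]
  have : ∀ x, |F.indicator (1 : Rn n → ℝ) x| ^ r = F.indicator 1 x := by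
    intro x
    by_cases hx : x ∈ F
    · simp [hx]
    · simp [hx, Real.zero_rpow hr.ne']
  simp_rw [this]
  rw [integral_indicator_one hF, measureReal_restrict_apply hF]

theorem cQ_avgf {n : ℕ} (p : ℤ × (Fin n → ℤ)) {f : Rn n → ℝ} (hf : ∀ x, 0 ≤ f x) {s : ℝ} :
    cubeAvg (cQ p) s f = ((((2:ℝ) ^ p.1) ^ n)⁻¹ * ∫ z in dC p.1 p.2, f z ^ s) ^ (1 / s) := by
  unfold cubeAvg
  rw [cQ_vol, ENNReal.toReal_ofReal (by positivity), ← setIntegral_congr_set (cQ_ae p)]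
  simp_rw [abs_of_nonneg (hf _)]

noncomputable def cT {n : ℕ} (p : ℤ × (Fin n → ℤ)) : Set (Rn n) := (cQ p).third.toSet

theorem cT_mem {n : ℕ} (p : ℤ × (Fin n → ℤ)) (z : Rn n) :
    z ∈ cT p ↔ ∀ i, (2:ℝ) ^ p.1 * p.2 i + (2:ℝ) ^ p.1 / 3 ≤ z i ∧
      z i ≤ (2:ℝ) ^ p.1 * p.2 i + (2:ℝ) ^ p.1 / 3 + (2:ℝ) ^ p.1 / 3 := Iff.rfl

theorem cT_meas {n : ℕ} (p : ℤ × (Fin n → ℤ)) : MeasurableSet (cT (n := n) p) :=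
  lbox_meas (fun i => Icc ((2:ℝ) ^ p.1 * p.2 i + (2:ℝ) ^ p.1 / 3)
    ((2:ℝ) ^ p.1 * p.2 i + (2:ℝ) ^ p.1 / 3 + (2:ℝ) ^ p.1 / 3)) fun i => measurableSet_Icc

theorem cT_sub {n : ℕ} (p : ℤ × (Fin n → ℤ)) : cT (n := n) p ⊆ dC p.1 p.2 := by
  intro z hz
  rw [cT_mem] at hz
  rw [dC_mem]
  intro i
  have hl : (0:ℝ) < 2 ^ p.1 := by positivity
  have := hz i
  constructor <;> linarith

theorem cT_supp {n : ℕ} {σ : Measure (Rn n)} (hσ : LRot σ) (F : Set (Rn n)) (p : ℤ × (Fin n → ℤ))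
    (x : Rn n) (hx : x ∉ dC p.1 p.2) : da σ F cT p x = 0 := by
  unfold da
  refine integral_eq_zero_of_ae ?_
  filter_upwards [hσ.supp] with u hu
  refine indicator_of_notMem (fun h => hx ?_) _
  have h1 := (cT_mem _ _).1 h.1
  rw [dC_mem]
  intro i
  have hl : (0:ℝ) < 2 ^ p.1 := by positivity
  have h2 := h1 i
  have h3 : |u i| ≤ 1 := by
    rw [← hu]; exact PiLp.norm_apply_le u i
  rw [abs_le] at h3
  simp only [PiLp.sub_apply, PiLp.smul_apply, smul_eq_mul] at h2
  constructor <;> nlinarith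

theorem cQ_AQ {n : ℕ} (F : Set (Rn n)) (p : ℤ × (Fin n → ℤ)) (x : Rn n) :
    AQ (cQ p) (F.indicator 1) x = da (sphMeasure n) F cT p x := by
  unfold AQ sphereAvg da
  rw [indicator_indicator]
  rfl

theorem cQ_sup {n : ℕ} (hσ : LRot (sphMeasure n)) (F : Set (Rn n)) {𝒬 : Set (Cube n)}
    (h : ∀ Q ∈ 𝒬, IsDyadic Q) (x : Rn n) :
    (⨆ Q ∈ 𝒬, AQ Q (F.indicator 1) x) = dM {p | cQ p ∈ 𝒬} (da (sphMeasure n) F cT) x := by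
  have := hσ.prob
  have hne : Nonempty (Cube n) := ⟨cQ (0, fun _ => 0)⟩
  have hb := dM_bdd (P := {p | cQ p ∈ 𝒬}) (a := da (sphMeasure n) F cT) da_le_one x
  have h0 := dM_nonneg (P := {p | cQ p ∈ 𝒬}) (a := da (sphMeasure n) F cT) da_nonneg x
  have hle : ∀ Q, (⨆ _ : Q ∈ 𝒬, AQ Q (F.indicator 1) x) ≤ dM {p | cQ p ∈ 𝒬} (da (sphMeasure n) F cT) x := by
    intro Q
    by_cases hQ : Q ∈ 𝒬
    · obtain ⟨p, rfl⟩ := cQ_ex (h Q hQ)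
      simp only [hQ, ciSup_unique]
      rw [cQ_AQ]
      have := le_ciSup hb p
      simp only [indicator_of_mem (show p ∈ {p | cQ p ∈ 𝒬} from hQ)] at this
      exact this
    · simp only [hQ, Real.iSup_of_isEmpty]
      exact h0
  apply le_antisymm
  · exact ciSup_le hle
  · refine ciSup_le fun p => ?_
    have hb2 : BddAbove (range fun Q => ⨆ _ : Q ∈ 𝒬, AQ Q (F.indicator 1) x) := by
      refine ⟨dM {p | cQ p ∈ 𝒬} (da (sphMeasure n) F cT) x, ?_⟩
      rintro _ ⟨Q, rfl⟩
      exact hle Q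
    have := le_ciSup hb2 (cQ p)
    by_cases hp : cQ p ∈ 𝒬
    · simp only [hp, ciSup_unique] at this
      rw [cQ_AQ] at this
      rw [indicator_of_mem (show p ∈ {p | cQ p ∈ 𝒬} from hp)]
      exact this
    · simp only [hp, Real.iSup_of_isEmpty] at this
      rw [indicator_of_notMem (show p ∉ {p | cQ p ∈ 𝒬} from hp)]
      exact this

theorem lm_dset {n : ℕ} (hn : 2 ≤ n) {σ : Measure (Rn n)} (hσ : LRot σ) {F : Set (Rn n)}
    (hF : MeasurableSet F) {p₀ : ℤ × (Fin n → ℤ)} {α K : ℝ} {𝒬 : Set (Cube n)}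
    (h𝒬 : ∀ Q ∈ 𝒬, IsDyadic Q ∧ Q.toSet ⊆ (cQ p₀).toSet)
    (hα : volume.real (F ∩ dC p₀.1 p₀.2) ≤ α * (2 ^ p₀.1) ^ n)
    (hd : ∀ p p' : ℤ × (Fin n → ℤ), cQ p ∈ 𝒬 → (cQ p).toSet ⊆ (cQ p').toSet →
      (cQ p').toSet ⊆ (cQ p₀).toSet → dC p'.1 p'.2 ⊆ dC p₀.1 p₀.2 →
      volume.real (F ∩ dC p'.1 p'.2) ≤ K * α * (2 ^ p'.1) ^ n) :
    DSet σ F p₀.1 p₀.2 α K {p | cQ p ∈ 𝒬} cT where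
  F_meas := hF
  F_le := hα
  sub := fun p hp => cQ_sub hn (h𝒬 _ hp).2
  dens := by
    intro p hp z hz q hq1 hq2
    have hs := (cQ_sub hn (h𝒬 _ hp).2).2
    have a1 : dC p.1 p.2 ⊆ (dC q (dI q z) : Set (Rn n)) := fun w hw =>
      dI_mono hq1 ((show dI p.1 w = p.2 from hw).trans (show dI p.1 z = p.2 from hz).symm)
    have a2 : (dC q (dI q z) : Set (Rn n)) ⊆ dC p₀.1 p₀.2 := fun w hw =>
      (dI_mono hq2 (show dI q w = dI q z from hw)).trans (hs hz)
    exact hd p (q, dI q z) hp (dC_sub a1) (dC_sub a2) a2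
  T_meas := fun p _ => cT_meas p
  T_sub := fun p _ => cT_sub p
  supp := fun p _ => cT_supp hσ F p

theorem lm_lim {L K a x : ℝ} (hx : 0 < x) (h : ∀ t : ℝ, 0 < t → t ≤ 1 → L ≤ K * t ^ x * a) : L ≤ 0 := by
  have hc : Filter.Tendsto (fun t : ℝ => K * t ^ x * a) (nhdsWithin 0 (Ioi 0)) (nhds (K * 0 ^ x * a)) := by
    refine Filter.Tendsto.mono_left ?_ nhdsWithin_le_nhds
    exact (((Real.continuousAt_rpow_const 0 x (Or.inr hx.le)).tendsto).const_mul K).mul_const a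
  rw [Real.zero_rpow hx.ne', mul_zero, zero_mul] at hc
  refine ge_of_tendsto hc ?_
  filter_upwards [Ioc_mem_nhdsGT (zero_lt_one (α := ℝ))] with t ht
  exact h t ht.1 ht.2

end

/-- The main lemma for the lacunary maximal function: under the stopping
condition with constant `C₀`, `⟨sup_{Q ∈ 𝒬} A_Q 1_{F₁}, f₂⟩ ≲ |Q₀| ⟨1_{F₁}⟩_{Q₀,r} ⟨f₂⟩_{Q₀,s}`. -/
theorem lacunary_main_lemma (n : ℕ) (hn : 2 ≤ n) (r s : ℝ)
    (hmem : ((1/r, 1/s) : ℝ × ℝ) ∈ interior (Lregion n)) (C₀ : ℝ) (hC₀ : 1 < C₀) :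
    ∃ C > (0 : ℝ), ∀ Q₀ : Cube n, IsDyadic Q₀ →
      ∀ F₁ : Set (Rn n), MeasurableSet F₁ →
      ∀ f₂ : Rn n → ℝ, Measurable f₂ → (∀ x, 0 ≤ f₂ x) → (∃ M, ∀ x, f₂ x ≤ M) →
      ∀ 𝒬 : Set (Cube n), (∀ Q ∈ 𝒬, IsDyadic Q ∧ Q.toSet ⊆ Q₀.toSet) →
      (∀ Q' ∈ 𝒬, ∀ Q : Cube n, IsDyadic Q → Q'.toSet ⊆ Q.toSet → Q.toSet ⊆ Q₀.toSet →
        cubeAvg Q r (F₁.indicator 1) / cubeAvg Q₀ r (F₁.indicator 1)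
          + cubeAvg Q s f₂ / cubeAvg Q₀ s f₂ < C₀) →
      ∫ x, (⨆ Q ∈ 𝒬, AQ Q (F₁.indicator 1) x) * f₂ x
        ≤ C * (volume Q₀.toSet).toReal
            * cubeAvg Q₀ r (F₁.indicator 1) * cubeAvg Q₀ s f₂ := by
  obtain ⟨g1, g2, g3⟩ := lreg hn hmem
  have hn0 : (2:ℝ) ≤ n := by exact_mod_cast hn
  have hnn : (1:ℝ) / n ≤ 1 / 2 := one_div_le_one_div_of_le (by norm_num) hn0
  have hnp : (0:ℝ) < 1 / n := by positivity
  have ex : ∀ t : ℝ, t / n = 1 / n * t := fun t => by ring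
  rw [ex] at g2 g3
  have hx : 0 < 1 / r := by
    by_contra hc
    nlinarith
  have hy : 0 < 1 / s := by
    by_contra hc
    nlinarith
  have hr : 0 < r := one_div_pos.1 hx
  have hs : 0 < s := one_div_pos.1 hy
  obtain ⟨ε, hε, hε1, hε2⟩ : ∃ ε : ℝ, 0 < ε ∧ 1 / r + 1 / n * (1 / s) + ε < 1 ∧
      1 / n * (1 / r) + 1 / s + ε < 1 := by
    refine ⟨min (1 - (1 / r + 1 / n * (1 / s))) (1 - (1 / n * (1 / r) + 1 / s)) / 2, ?_, ?_, ?_⟩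
    · have : 0 < min (1 - (1 / r + 1 / n * (1 / s))) (1 - (1 / n * (1 / r) + 1 / s)) :=
        lt_min (by linarith) (by linarith)
      linarith
    · have := min_le_left (1 - (1 / r + 1 / n * (1 / s))) (1 - (1 / n * (1 / r) + 1 / s))
      linarith
    · have := min_le_right (1 - (1 / r + 1 / n * (1 / s))) (1 - (1 / n * (1 / r) + 1 / s))
      linarith
  have hxn : 0 < 1 / (n:ℝ) * (1 / r) := by positivity
  have hyn : 0 < 1 / (n:ℝ) * (1 / s) := by positivity
  have hK : 0 < C₀ ^ r := by positivity
  obtain ⟨C, hC, H⟩ := lm_main hn (x := 1 / r) (y := 1 / s + ε) (s := s) (K := C₀ ^ r) hx (by linarith)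
    (by linarith) (by linarith) (by rw [ex]; nlinarith) (by rw [ex]; linarith) (by linarith) hK hs
    (by rw [mul_add, mul_one_div_cancel hs.ne']; have := mul_pos hs hε; linarith)
  refine ⟨C, hC, ?_⟩
  intro Q₀ hQ₀ F hF f hf hf0 hfM 𝒬 h𝒬 hst
  obtain ⟨p₀, rfl⟩ := cQ_ex hQ₀
  have hV : (0:ℝ) < ((2:ℝ) ^ p₀.1) ^ n := by positivity
  have hvol : (volume (cQ p₀).toSet).toReal = ((2:ℝ) ^ p₀.1) ^ n := by
    rw [cQ_vol, ENNReal.toReal_ofReal hV.le]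
  rw [hvol]
  have hA0 : 0 ≤ (((2:ℝ) ^ p₀.1) ^ n)⁻¹ * volume.real (F ∩ dC p₀.1 p₀.2) := by positivity
  have hI0 : 0 ≤ ∫ z in dC p₀.1 p₀.2, f z ^ s := integral_nonneg fun z => Real.rpow_nonneg (hf0 z) s
  have hB0 : 0 ≤ (((2:ℝ) ^ p₀.1) ^ n)⁻¹ * ∫ z in dC p₀.1 p₀.2, f z ^ s := by positivity
  have hcF : 0 ≤ cubeAvg (cQ p₀) r (F.indicator 1) := by
    rw [cQ_avgF p₀ hF hr]; exact Real.rpow_nonneg hA0 _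
  have hcf : ∀ p, 0 ≤ cubeAvg (cQ p) s f := by
    intro p
    rw [cQ_avgf p hf0]
    refine Real.rpow_nonneg (mul_nonneg (by positivity) (integral_nonneg fun z => Real.rpow_nonneg (hf0 z) s)) _
  rcases lm_sph n with h0 | hσ
  · have : ∀ x, (⨆ Q ∈ 𝒬, AQ Q (F.indicator 1) x) = 0 := by
      intro x
      simp [AQ, sphereAvg, h0]
    simp_rw [this]
    simp only [zero_mul, integral_zero]
    have := hcf p₀
    positivity
  simp_rw [cQ_sup hσ F (fun Q hQ => (h𝒬 Q hQ).1)]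
  obtain ⟨α, hαdef⟩ : ∃ α, α = (((2:ℝ) ^ p₀.1) ^ n)⁻¹ * volume.real (F ∩ dC p₀.1 p₀.2) := ⟨_, rfl⟩
  have hα0 : 0 ≤ α := by rw [hαdef]; exact hA0
  have hα1 : α ≤ 1 := by
    rw [hαdef, inv_mul_le_iff₀ hV, mul_one, ← dC_vol p₀.1 p₀.2]
    exact measureReal_mono inter_subset_right (dC_fin _ _)
  have hαV : volume.real (F ∩ dC p₀.1 p₀.2) = α * (2 ^ p₀.1) ^ n := by
    rw [hαdef]; field_simp
  have hcα : cubeAvg (cQ p₀) r (F.indicator 1) = α ^ (1 / r) := by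
    rw [cQ_avgF p₀ hF hr, hαdef]
  obtain ⟨β, hβdef⟩ : ∃ β, β = cubeAvg (cQ p₀) s f := ⟨_, rfl⟩
  have hβ0 : 0 ≤ β := by rw [hβdef]; exact hcf p₀
  have hβs : ∫ z in dC p₀.1 p₀.2, f z ^ s = β ^ s * (2 ^ p₀.1) ^ n := by
    rw [hβdef, cQ_avgf p₀ hf0, ← Real.rpow_mul hB0, one_div_mul_cancel hs.ne', Real.rpow_one]
    field_simp
  have main : ∀ β' : ℝ, 0 < β' → β ≤ β' →
      ∫ z, dM {p | cQ p ∈ 𝒬} (da (sphMeasure n) F cT) z * f z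
        ≤ C * ((2:ℝ) ^ p₀.1) ^ n * α ^ (1 / r) * β' := by
    intro β' hβ' hββ
    have hint : ∫ z in dC p₀.1 p₀.2, f z ^ s ≤ β' ^ s * (2 ^ p₀.1) ^ n := by
      rw [hβs]
      exact mul_le_mul_of_nonneg_right (Real.rpow_le_rpow hβ0 hββ hs.le) hV.le
    rcases hα0.eq_or_lt with hz | hpos
    · rw [← hz, Real.zero_rpow hx.ne', mul_zero, zero_mul]
      rw [← hz, zero_mul] at hαV
      refine lm_lim (K := C * ((2:ℝ) ^ p₀.1) ^ n) (a := β') hx fun t ht ht1 => ?_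
      refine H _ hσ F p₀.1 p₀.2 t _ _ (lm_dset hn hσ hF h𝒬 ?_ ?_) ht ht1 f β' hf hf0 hfM hβ' hint
      · rw [hαV]; positivity
      · intro p p' _ _ _ hsub
        have : volume.real (F ∩ dC p'.1 p'.2) ≤ 0 := by
          rw [← hαV]
          exact measureReal_mono (inter_subset_inter_right _ hsub)
            ((measure_mono inter_subset_right).trans_lt (dC_fin _ _).lt_top).ne
        exact this.trans (by positivity)
    · refine H _ hσ F p₀.1 p₀.2 α _ _ (lm_dset hn hσ hF h𝒬 hαV.le ?_) hpos hα1 f β' hf hf0 hfM hβ' hint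
      intro p p' hp hs1 hs2 _
      have h1 := hst _ hp _ (cQ_dy p') hs1 hs2
      have h2 : 0 ≤ cubeAvg (cQ p') s f / cubeAvg (cQ p₀) s f := div_nonneg (hcf _) (hcf _)
      have hap : 0 < α ^ (1 / r) := by positivity
      have h3 : cubeAvg (cQ p') r (F.indicator 1) / cubeAvg (cQ p₀) r (F.indicator 1) < C₀ := by linarith
      have hV' : (0:ℝ) < ((2:ℝ) ^ p'.1) ^ n := by positivity
      rw [hcα, div_lt_iff₀ hap, cQ_avgF p' hF hr] at h3
      have e : C₀ * α ^ (1 / r) = (C₀ ^ r * α) ^ (1 / r) := by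
        rw [Real.mul_rpow hK.le hα0, ← Real.rpow_mul (by linarith), mul_one_div_cancel hr.ne', Real.rpow_one]
      rw [e] at h3
      have h4 := (Real.rpow_lt_rpow_iff (by positivity) (by positivity) hx).1 h3
      rw [inv_mul_lt_iff₀ hV'] at h4
      linarith
  rw [hcα, ← hβdef]
  rcases hβ0.eq_or_lt with hz | hpos
  · rw [← hz, mul_zero]
    refine lm_lim (K := C * ((2:ℝ) ^ p₀.1) ^ n * α ^ (1 / r)) (a := 1) (x := 1) one_pos fun t ht _ => ?_
    rw [Real.rpow_one, mul_one]
    exact main t ht (by linarith)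
  · exact main β hpos le_rfl
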